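/- Let π be a non-degenerate permutation of {1,…,d}, and let P = (p_1<p_2<p_3<p_4) and Q = (q_1<q_2<q_3<q_4) be increasing 4-tuples of elements of {1,…,d}, on each of which π restricts to a permutation in the Rauzy class of (4321), forming an accessible pair. Let L_T and L_S be vectors in ℝ^d with nonnegative entries summing to 1 such that L_T vanishes outside the index set {p_1,p_2,p_3,p_4}, L_S vanishes outside the index set {q_1,q_2,q_3,q_4}, and the interval exchange transformations T_{π,L_T} and T_{π,L_S} are both uniquely ergodic. Then there exists a continuous path γ : [0,1] → ℝ^d with γ(0) = L_T and γ(1) = L_S such that for every t ∈ [0,1] the vector γ(t) has nonnegative entries summing to 1 and the interval exchange transformation T_{π,γ(t)} is uniquely ergodic. -/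

import Mathlib

open MeasureTheory

/-- The interval exchange transformation determined by a permutation `π` of `Fin n`
and a length vector `L`. -/
noncomputable def ietMap {n : ℕ} (π : Equiv.Perm (Fin n)) (L : Fin n → ℝ) (x : ℝ) : ℝ :=
  if h : ∃ j : Fin n,
      (∑ k ∈ Finset.univ.filter (fun k => k < j), L k) ≤ x ∧
      x < (∑ k ∈ Finset.univ.filter (fun k => k < j), L k) + L j then
    x - (∑ k ∈ Finset.univ.filter (fun k => k < h.choose), L k)
      + (∑ k ∈ Finset.univ.filter (fun k => π k < π h.choose), L k)
  else x

/-- `T` is uniquely ergodic (as a transformation of `[0,1)`). -/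
def UniquelyErgodicOn01 (T : ℝ → ℝ) : Prop :=
  ∀ μ : Measure ℝ, IsProbabilityMeasure μ → μ (Set.Ico (0:ℝ) 1)ᶜ = 0 →
    (∀ A : Set ℝ, MeasurableSet A → μ (T ⁻¹' A) = μ A) →
    μ = volume.restrict (Set.Ico (0:ℝ) 1)

/-- A permutation of `{0,…,n-1}` (i.e. of `{1,…,n}`, written 0-based) is degenerate. -/
def IETDegenerate {n : ℕ} (π : Equiv.Perm (Fin n)) : Prop :=
  ∃ j : Fin n, ∃ hj : (j : ℕ) + 1 < n,
    ((π ⟨(j : ℕ) + 1, hj⟩ : ℕ) = (π j : ℕ) + 1) ∨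
    ((π j : ℕ) = n - 1 ∧ (π ⟨(j : ℕ) + 1, hj⟩ : ℕ) = 0 ∧
      (π ⟨0, by omega⟩ : ℕ) = (π ⟨n - 1, by omega⟩ : ℕ) + 1) ∨
    ((π ⟨(j : ℕ) + 1, hj⟩ : ℕ) = 0 ∧ (π ⟨0, by omega⟩ : ℕ) = (π j : ℕ) + 1) ∨
    ((π ⟨(j : ℕ) + 1, hj⟩ : ℕ) = (π ⟨n - 1, by omega⟩ : ℕ) + 1 ∧ (π j : ℕ) = n - 1)


/-- The Rauzy class of the permutation `(4321)`, written 0-based. -/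
def RauzyClass4321 : Set (Equiv.Perm (Fin 4)) :=
  {σ | (σ⁻¹ 0, σ⁻¹ 1, σ⁻¹ 2, σ⁻¹ 3) ∈
    ({((3 : Fin 4), (2 : Fin 4), (1 : Fin 4), (0 : Fin 4)),
      (3, 1, 0, 2), (3, 0, 2, 1), (1, 3, 2, 0), (2, 1, 3, 0), (1, 3, 0, 2), (2, 0, 3, 1)} :
      Set (Fin 4 × Fin 4 × Fin 4 × Fin 4))}

/-- A permutation of `{0,…,n-1}` is irreducible if it maps no proper initial segment
`{0,…,k-1}` (with `0 < k < n`) to itself. -/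
def PermIrreducible {n : ℕ} (π : Equiv.Perm (Fin n)) : Prop :=
  ∀ k : ℕ, 0 < k → k < n → ∃ i : Fin n, (i : ℕ) < k ∧ k ≤ (π i : ℕ)

/-- `σ` is the restriction of `π` to the `4`-tuple `p`: for all indices `a, b`,
`σ a < σ b` iff `π (p a) < π (p b)`. -/
def RestrictsTo {d : ℕ} (π : Equiv.Perm (Fin d)) (p : Fin 4 → Fin d)
    (σ : Equiv.Perm (Fin 4)) : Prop :=
  ∀ a b : Fin 4, σ a < σ b ↔ π (p a) < π (p b)

/-- `π` restricts on the `4`-tuple `p` to a permutation in the Rauzy class of `(4321)`. -/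
def RestrictsToRauzyClass {d : ℕ} (π : Equiv.Perm (Fin d)) (p : Fin 4 → Fin d) : Prop :=
  ∃ σ ∈ RauzyClass4321, RestrictsTo π p σ

/-- Two increasing `4`-tuples `p`, `q` form an *accessible pair* for `π`: there are
indices `r₁ < r₂` and `s₁ < s₂` such that `p r₁, p r₂, q s₁, q s₂` are pairwise
distinct, `π` restricts on them (listed in increasing order by `u`) to an irreducible
permutation of `{1,2,3,4}` other than the transposition exchanging the first and last
symbols, and `π` acts as a rotation on both `(p r₁, p r₂)` and `(q s₁, q s₂)`. -/
def AccessiblePair {d : ℕ} (π : Equiv.Perm (Fin d)) (p q : Fin 4 → Fin d) : Prop :=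
  ∃ r₁ r₂ s₁ s₂ : Fin 4, r₁ < r₂ ∧ s₁ < s₂ ∧
    ({p r₁, p r₂, q s₁, q s₂} : Finset (Fin d)).card = 4 ∧
    (∃ u : Fin 4 → Fin d, StrictMono u ∧
      Set.range u = ({p r₁, p r₂, q s₁, q s₂} : Set (Fin d)) ∧
      ∃ σ : Equiv.Perm (Fin 4), RestrictsTo π u σ ∧ PermIrreducible σ ∧
        σ ≠ Equiv.swap 0 3) ∧
    π (p r₂) < π (p r₁) ∧ π (q s₂) < π (q s₁)

namespace IET
open Set Filter Topology

/-- Rigidity of monotone quasi-invariant functions for irrational rotations. -/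
theorem rotation {P Q : ℝ} (hP : 0 < P) (hQ : 0 < Q) (hirr : Irrational (P / Q)) {F : ℝ → ℝ}
    (hmono : MonotoneOn F (Icc 0 (P + Q))) (h0 : F 0 = 0)
    (h1 : ∀ u, 0 ≤ u → u ≤ P → F (Q + u) - F Q = F u)
    (h2 : ∀ u, 0 ≤ u → u ≤ Q → F (P + u) - F P = F u) :
    ∀ x ∈ Icc (0:ℝ) (P + Q), F x * (P + Q) = F (P + Q) * x := by
  set N := P + Q with hN
  have hNpos : 0 < N := by positivity
  set c := F N / N with hc
  have hcN : c * N = F N := by rw [hc]; field_simp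
  have hFN : 0 ≤ F N := by
    have := hmono (left_mem_Icc.2 hNpos.le) (right_mem_Icc.2 hNpos.le) hNpos.le
    linarith
  have hc0 : 0 ≤ c := by rw [hc]; positivity
  have hPQ : F P + F Q = F N := by
    have := h2 Q hQ.le le_rfl
    rw [← hN] at this; linarith
  set r : ℝ → ℝ := fun x => N * Int.fract (x / N) with hr
  have hr0 : ∀ x, 0 ≤ r x := fun x => by rw [hr]; have := Int.fract_nonneg (x / N); positivity
  have hrN : ∀ x, r x < N := fun x => by
    rw [hr]; have := Int.fract_lt_one (x / N); simp only; nlinarith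
  have hrper : ∀ x, r (x + N) = r x := fun x => by
    simp only [hr]; rw [add_div, div_self hNpos.ne', Int.fract_add_one]
  have hrfix : ∀ x, 0 ≤ x → x < N → r x = x := fun x hx hx' => by
    simp only [hr]; rw [Int.fract_eq_self.2 ⟨by positivity, by rw [div_lt_one hNpos]; exact hx'⟩]
    field_simp
  have hrdec : ∀ x, ∃ m : ℤ, x = r x + m * N := fun x => by
    refine ⟨⌊x / N⌋, ?_⟩
    simp only [hr, Int.fract]; field_simp; ring
  have hrperz : ∀ x (m : ℤ), r (x + m * N) = r x := fun x m => by
    simp only [hr]; rw [add_div, mul_div_assoc, div_self hNpos.ne', mul_one, Int.fract_add_intCast]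
  set E : ℝ → ℝ := fun x => F (r x) - c * r x with hE
  have hEper : ∀ x (m : ℤ), E (x + m * N) = E x := fun x m => by simp only [hE, hrperz]
  have hr_zero : r 0 = 0 := hrfix 0 le_rfl hNpos
  have hE0 : E 0 = 0 := by simp only [hE, hr_zero, h0]; ring
  set g := F Q - c * Q with hg
  have hstep : ∀ x, E (x + Q) = E x + g := by
    intro x
    obtain ⟨m, hm⟩ := hrdec x
    have e1 : E (x + Q) = E (r x + Q) := by
      rw [← hEper (r x + Q) m]; congr 1; linarith
    rw [e1]
    have hx0 := hr0 x
    have hxN := hrN x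
    have e2 : E x = F (r x) - c * r x := rfl
    rw [e2]
    generalize r x = y at *
    rcases lt_or_ge y P with hy | hy
    · have : r (y + Q) = y + Q := hrfix _ (by linarith) (by linarith)
      simp only [hE, this]
      have := h1 y hx0 hy.le
      rw [add_comm Q y] at this
      rw [hg]; linarith
    · have : r (y + Q) = y - P := by
        have : y + Q = (y - P) + N := by rw [hN]; ring
        rw [this, hrper, hrfix _ (by linarith) (by linarith)]
      simp only [hE, this]
      have := h2 (y - P) (by linarith) (by linarith)
      rw [add_sub_cancel] at this
      have : c * P + c * Q = F N := by rw [← hcN, hN]; ring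
      rw [hg]; linarith
  have hbd : ∀ x, |E x| ≤ F N := by
    intro x
    have a1 := hmono (left_mem_Icc.2 hNpos.le) ⟨hr0 x, (hrN x).le⟩ (hr0 x)
    have a2 := hmono ⟨hr0 x, (hrN x).le⟩ (right_mem_Icc.2 hNpos.le) (hrN x).le
    have a3 : 0 ≤ c * r x := mul_nonneg hc0 (hr0 x)
    have a4 : c * r x ≤ F N := by rw [← hcN]; exact mul_le_mul_of_nonneg_left (hrN x).le hc0
    rw [abs_le]; simp only [hE]; constructor <;> linarith
  have hiter : ∀ n : ℕ, E (n * Q) = n * g := by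
    intro n
    induction n with
    | zero => simp [hE0]
    | succ k ih => push_cast; rw [add_mul, one_mul, hstep, ih]; ring
  have hg0 : g = 0 := by
    by_contra hne
    obtain ⟨n, hn⟩ := exists_nat_gt (F N / |g|)
    have := hbd (n * Q)
    rw [hiter, abs_mul, Nat.abs_cast] at this
    rw [div_lt_iff₀ (abs_pos.2 hne)] at hn
    linarith
  have hperQ : ∀ x, E (x + Q) = E x := fun x => by rw [hstep, hg0, add_zero]
  have hdense : Dense (AddSubgroup.closure {N, Q} : Set ℝ) := by
    rw [dense_addSubgroupClosure_pair_iff]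
    have : N / Q = P / Q + 1 := by rw [hN]; field_simp
    rw [this]
    simpa using hirr.add_intCast 1
  have hclos : ∀ h ∈ AddSubgroup.closure {N, Q}, ∀ x, E (x + h) = E x := by
    intro h hh
    induction hh using AddSubgroup.closure_induction with
    | mem y hy =>
      intro x
      rcases hy with rfl | hy
      · simpa using hEper x 1
      · rw [mem_singleton_iff] at hy; subst hy; exact hperQ x
    | zero => intro x; simp
    | add a b _ _ ha hb => intro x; rw [← add_assoc, hb, ha]
    | neg a _ ha => intro x; rw [← ha (x + -a)]; congr 1; ring
  have hval : ∀ h ∈ AddSubgroup.closure {N, Q}, 0 ≤ h → h < N → F h = c * h := by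
    intro h hh h0' hN'
    have := hclos h hh 0
    rw [zero_add, hE0] at this
    simp only [hE, hrfix h h0' hN'] at this
    linarith
  have key : ∀ x ∈ Icc (0:ℝ) N, F x = c * x := by
    rintro x ⟨hx0, hxN⟩
    rcases hx0.eq_or_lt with rfl | hx0
    · rw [h0]; ring
    rcases hxN.eq_or_lt with rfl | hxN
    · exact hcN.symm
    apply le_antisymm
    · by_contra hlt
      push Not at hlt
      obtain ⟨y, hy, hy'⟩ := hdense.exists_between (show x < min N (x + (F x - c * x) / (c + 1)) by
        refine lt_min hxN ?_
        have : 0 < (F x - c * x) / (c + 1) := by apply div_pos <;> linarith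
        linarith)
      have h3 := lt_min_iff.1 hy'.2
      have h4 := hval y hy (by linarith [hy'.1]) h3.1
      have h5 := hmono ⟨hx0.le, hxN.le⟩ ⟨by linarith [hy'.1], h3.1.le⟩ hy'.1.le
      have h6 : (y - x) * (c + 1) < F x - c * x := by
        rw [← lt_div_iff₀ (by linarith)]; linarith [h3.2]
      nlinarith [hy'.1]
    · by_contra hlt
      push Not at hlt
      obtain ⟨y, hy, hy'⟩ := hdense.exists_between (show max 0 (x - (c * x - F x) / (c + 1)) < x by
        refine max_lt hx0 ?_
        have : 0 < (c * x - F x) / (c + 1) := by apply div_pos <;> linarith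
        linarith)
      have h3 := max_lt_iff.1 hy'.1
      have h4 := hval y hy h3.1.le (by linarith [hy'.2])
      have h5 := hmono ⟨h3.1.le, by linarith [hy'.2]⟩ ⟨hx0.le, hxN.le⟩ hy'.2.le
      have h6 : (x - y) * (c + 1) < c * x - F x := by
        rw [← lt_div_iff₀ (by linarith)]; linarith [h3.2]
      nlinarith [hy'.2]
  intro x hx
  rw [key x hx, ← hcN]; ring

section basics
variable {ι : Type*} [Fintype ι]

/-- Starting point of the interval `j` when the intervals are ordered by `τ`. -/
noncomputable def st (τ : ι → ℕ) (L : ι → ℝ) (j : ι) : ℝ := ∑ k, if τ k < τ j then L k else 0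

/-- total length -/
noncomputable def tot (L : ι → ℝ) : ℝ := ∑ k, L k

/-- `F` is (the distribution function of) an invariant measure. -/
def Inv (τ β : ι → ℕ) (L : ι → ℝ) (F : ℝ → ℝ) : Prop :=
  ∀ j u, 0 ≤ u → u ≤ L j →
    F (st β L j + u) - F (st β L j) = F (st τ L j + u) - F (st τ L j)

/-- Unique ergodicity, in terms of distribution functions. -/
def UEF (τ β : ι → ℕ) (L : ι → ℝ) : Prop :=
  ∀ F : ℝ → ℝ, MonotoneOn F (Icc 0 (tot L)) → F 0 = 0 → Inv τ β L F →
    ∀ x ∈ Icc (0:ℝ) (tot L), F x * tot L = F (tot L) * x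

/-- The set of uniquely ergodic length vectors. -/
def U (τ β : ι → ℕ) : Set (ι → ℝ) := {L | (∀ i, 0 ≤ L i) ∧ 0 < tot L ∧ UEF τ β L}

theorem Inv.swap {τ β : ι → ℕ} {L : ι → ℝ} {F : ℝ → ℝ} (h : Inv τ β L F) : Inv β τ L F :=
  fun j u h0 h1 => (h j u h0 h1).symm

theorem UEF.swap {τ β : ι → ℕ} {L : ι → ℝ} (h : UEF τ β L) : UEF β τ L :=
  fun F hm h0 hi => h F hm h0 hi.swap

theorem U_swap (τ β : ι → ℕ) : U τ β = U β τ := by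
  ext L; exact ⟨fun h => ⟨h.1, h.2.1, h.2.2.swap⟩, fun h => ⟨h.1, h.2.1, h.2.2.swap⟩⟩

theorem st_nonneg {τ : ι → ℕ} {L : ι → ℝ} (h : ∀ i, 0 ≤ L i) (j : ι) : 0 ≤ st τ L j :=
  Finset.sum_nonneg fun k _ => by split_ifs; exacts [h k, le_rfl]

theorem st_add_le {τ : ι → ℕ} {L : ι → ℝ} (h : ∀ i, 0 ≤ L i) (j : ι) :
    st τ L j + L j ≤ tot L := by
  classical
  have : L j = ∑ k, if k = j then L k else 0 := by simp
  rw [st, this, ← Finset.sum_add_distrib]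
  refine Finset.sum_le_sum fun k _ => ?_
  by_cases hk : k = j
  · subst hk; simp
  · simp only [hk, if_false, add_zero]; split_ifs; exacts [le_rfl, h k]

theorem st_smul (τ : ι → ℕ) (c : ℝ) (L : ι → ℝ) (j : ι) : st τ (c • L) j = c * st τ L j := by
  simp [st, Finset.mul_sum]

theorem tot_smul (c : ℝ) (L : ι → ℝ) : tot (c • L) = c * tot L := by
  simp [tot, Finset.mul_sum]

theorem tot_nonneg {L : ι → ℝ} (h : ∀ i, 0 ≤ L i) : 0 ≤ tot L := Finset.sum_nonneg fun k _ => h k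

theorem le_tot {L : ι → ℝ} (h : ∀ i, 0 ≤ L i) (j : ι) : L j ≤ tot L :=
  Finset.single_le_sum (fun k _ => h k) (Finset.mem_univ j)

theorem UEF.smul {τ β : ι → ℕ} {L : ι → ℝ} (h : UEF τ β L) {c : ℝ} (hc : 0 < c) :
    UEF τ β (c • L) := by
  intro F hm h0 hi x hx
  rw [tot_smul] at *
  have := h (fun y => F (c * y)) (fun a ha b hb hab => hm ⟨by have := ha.1; positivity,
      mul_le_mul_of_nonneg_left ha.2 hc.le⟩ ⟨by have := hb.1; positivity,
      mul_le_mul_of_nonneg_left hb.2 hc.le⟩ (mul_le_mul_of_nonneg_left hab hc.le)) (by simpa using h0)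
    (fun j u hu0 hu1 => by
      have := hi j (c * u) (by positivity) (by simpa using mul_le_mul_of_nonneg_left hu1 hc.le)
      rw [st_smul, st_smul] at this
      simpa [mul_add] using this) (x / c) ⟨by have := hx.1; positivity, by
        rw [div_le_iff₀ hc]; linarith [hx.2]⟩
  have e : c * (x / c) = x := by field_simp
  simp only [e] at this
  calc F x * (c * tot L) = c * (F x * tot L) := by ring
    _ = F (c * tot L) * (c * (x / c)) := by rw [this]; ring
    _ = _ := by rw [e]

theorem U_smul {τ β : ι → ℕ} {L : ι → ℝ} (h : L ∈ U τ β) {c : ℝ} (hc : 0 < c) : c • L ∈ U τ β :=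
  ⟨fun i => mul_nonneg hc.le (h.1 i), by rw [tot_smul]; exact mul_pos hc h.2.1, h.2.2.smul hc⟩

theorem join_smul {τ β : ι → ℕ} {L : ι → ℝ} (h : L ∈ U τ β) {c : ℝ} (hc : 0 < c) :
    JoinedIn (U τ β) L (c • L) := by
  apply JoinedIn.of_segment_subset
  rintro _ ⟨a, b, ha, hb, hab, rfl⟩
  rw [smul_smul, ← add_smul]
  apply U_smul h
  rcases ha.eq_or_lt with rfl | ha
  · have : b = 1 := by linarith
    subst this; simpa using hc
  · have : 0 ≤ b * c := by positivity
    linarith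

theorem join_map_smul {τ β : ι → ℕ} {L L' : ι → ℝ} (h : JoinedIn (U τ β) L L') {c : ℝ}
    (hc : 0 < c) : JoinedIn (U τ β) (c • L) (c • L') :=
  ((join_smul h.source_mem hc).symm.trans h).trans (join_smul h.target_mem hc)

end basics
end IET

set_option linter.unusedSectionVars false
set_option linter.unusedSimpArgs false
set_option linter.unusedVariables false
set_option linter.style.longLine false
namespace IET
open Set Filter Topology
section triples
variable {ι : Type*} [Fintype ι] [DecidableEq ι]

theorem st_add (τ : ι → ℕ) (L L' : ι → ℝ) (j : ι) : st τ (L + L') j = st τ L j + st τ L' j := by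
  simp only [st, ← Finset.sum_add_distrib]
  refine Finset.sum_congr rfl fun k _ => ?_
  split_ifs <;> simp

theorem tot_add (L L' : ι → ℝ) : tot (L + L') = tot L + tot L' := by
  simp [tot, Finset.sum_add_distrib]

theorem st_single (τ : ι → ℕ) (a : ι) (x : ℝ) (j : ι) :
    st τ (Pi.single a x) j = if τ a < τ j then x else 0 := by
  rw [st, Finset.sum_eq_single a]
  · simp
  · intro b _ hb; simp [Pi.single_eq_of_ne hb]
  · simp

theorem tot_single (a : ι) (x : ℝ) : tot (Pi.single a x : ι → ℝ) = x := by
  simp [tot]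

/-- A vector supported on three letters. -/
def v3 (a b c : ι) (x y z : ℝ) : ι → ℝ := Pi.single a x + Pi.single b y + Pi.single c z

/-- A vector supported on two letters. -/
def v2 (a b : ι) (x y : ℝ) : ι → ℝ := Pi.single a x + Pi.single b y

theorem st_v3 (τ : ι → ℕ) (a b c : ι) (x y z : ℝ) (j : ι) : st τ (v3 a b c x y z) j =
    (if τ a < τ j then x else 0) + (if τ b < τ j then y else 0) + (if τ c < τ j then z else 0) := by
  rw [v3, st_add, st_add, st_single, st_single, st_single]

theorem st_v2 (τ : ι → ℕ) (a b : ι) (x y : ℝ) (j : ι) : st τ (v2 a b x y) j =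
    (if τ a < τ j then x else 0) + (if τ b < τ j then y else 0) := by
  rw [v2, st_add, st_single, st_single]

theorem tot_v3 (a b c : ι) (x y z : ℝ) : tot (v3 a b c x y z) = x + y + z := by
  rw [v3, tot_add, tot_add, tot_single, tot_single, tot_single]

theorem tot_v2 (a b : ι) (x y : ℝ) : tot (v2 a b x y) = x + y := by
  rw [v2, tot_add, tot_single, tot_single]

theorem v3_nonneg (a b c : ι) {x y z : ℝ} (hx : 0 ≤ x) (hy : 0 ≤ y) (hz : 0 ≤ z) (i : ι) :
    0 ≤ v3 a b c x y z i := by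
  have h : ∀ (a : ι) (x : ℝ), 0 ≤ x → 0 ≤ (Pi.single a x : ι → ℝ) i := fun a x hx => by
    rw [Pi.single_apply]; split_ifs <;> simp [hx]
  have h1 := h a x hx
  have h2 := h b y hy
  have h3 := h c z hz
  simp only [v3, Pi.add_apply]; linarith

theorem v3_zero2 (a b c : ι) (x z : ℝ) : v3 a b c x 0 z = v2 a c x z := by simp [v3, v2]
theorem v3_zero3 (a b c : ι) (x y : ℝ) : v3 a b c x y 0 = v2 a b x y := by simp [v3, v2]
theorem v3_zero1 (a b c : ι) (y z : ℝ) : v3 a b c 0 y z = v2 b c y z := by simp [v3, v2]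
theorem v2_comm (a b : ι) (x y : ℝ) : v2 a b x y = v2 b a y x := by simp [v2, add_comm]
theorem v2_smul (c : ℝ) (a b : ι) (x y : ℝ) : c • v2 a b x y = v2 a b (c * x) (c * y) := by
  ext i; simp [v2, Pi.single_apply, mul_add]

theorem v2_nonneg (a b : ι) {x y : ℝ} (hx : 0 ≤ x) (hy : 0 ≤ y) (i : ι) :
    0 ≤ v2 a b x y i := by
  rw [← v3_zero3 a b b]; exact v3_nonneg a b b hx hy le_rfl i

theorem v3_seg {a b c : ι} {x y z x' y' z' s t : ℝ} :
    s • v3 a b c x y z + t • v3 a b c x' y' z' =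
      v3 a b c (s * x + t * x') (s * y + t * y') (s * z + t * z') := by
  ext i; simp [v3, Pi.single_apply]; split_ifs <;> ring

theorem merge_mem {τ β : ι → ℕ} {a b c : ι} (h1 : τ a < τ b) (h2 : τ b < τ c) (h3 : β c < β a)
    (h4 : β a < β b) {x y z : ℝ} (hx : 0 ≤ x) (hy : 0 ≤ y) (hP : 0 < x + y) (hz : 0 < z)
    (hirr : Irrational ((x + y) / z)) : v3 a b c x y z ∈ U τ β := by
  have hab : a ≠ b := fun h => by simp [h] at h1
  have hbc : b ≠ c := fun h => by simp [h] at h2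
  have hac : a ≠ c := fun h => by simp [h] at h3
  refine ⟨v3_nonneg a b c hx hy hz.le, by rw [tot_v3]; linarith, ?_⟩
  intro F hm h0 hi
  rw [tot_v3] at *
  have ta := hi a
  have tb := hi b
  have tc := hi c
  simp only [st_v3] at ta tb tc
  simp [v3, hab, hbc, hac, hab.symm, hbc.symm, hac.symm, h1, h2, h3, h4, h1.trans h2,
    h3.trans h4, h1.le, h2.le, h3.le, h4.le, (h1.trans h2).le, (h3.trans h4).le,
    (h1.trans h2).not_gt, (h3.trans h4).not_gt, h1.not_gt, h2.not_gt, h3.not_gt, h4.not_gt, h0] at ta tb tc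
  refine rotation hP hz hirr hm h0 ?_ ?_
  · intro u hu0 hu1
    rcases le_or_gt u x with hux | hux
    · exact ta u hu0 hux
    · have e1 := ta x hx le_rfl
      have e2 := tb (u - x) (by linarith) (by linarith)
      rw [show x + z + (u - x) = z + u by ring, show x + (u - x) = u by ring, add_comm x z] at e2
      linarith
  · intro u hu0 hu1
    exact (tc u hu0 hu1).symm

theorem merge_join {τ β : ι → ℕ} {a b c : ι} (h1 : τ a < τ b) (h2 : τ b < τ c) (h3 : β c < β a)
    (h4 : β a < β b) {x y z x' y' : ℝ} (hx : 0 ≤ x) (hy : 0 ≤ y) (hx' : 0 ≤ x') (hy' : 0 ≤ y')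
    (hP : 0 < x + y) (hz : 0 < z) (hirr : Irrational ((x + y) / z)) (hs : x + y = x' + y') :
    JoinedIn (U τ β) (v3 a b c x y z) (v3 a b c x' y' z) := by
  apply JoinedIn.of_segment_subset
  rintro _ ⟨s, t, hs0, ht0, hst, rfl⟩
  rw [v3_seg]
  have e1 : s * x + t * x' + (s * y + t * y') = x + y := by
    have : s * x + t * x' + (s * y + t * y') = s * (x + y) + t * (x' + y') := by ring
    rw [this, ← hs, ← add_mul, hst, one_mul]
  have e2 : s * z + t * z = z := by rw [← add_mul, hst, one_mul]
  rw [e2]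
  apply merge_mem h1 h2 h3 h4 (by positivity) (by positivity) (by rwa [e1]) hz (by rwa [e1])

theorem flip_mem {τ β : ι → ℕ} {a b c : ι} (h1 : τ a < τ b) (h2 : τ b < τ c) (h3 : β c < β b)
    (h4 : β b < β a) {x y z : ℝ} (hx : 0 ≤ x) (hy : 0 ≤ y) (hz : 0 ≤ z) (hP : 0 < x + y)
    (hQ : 0 < y + z) (hirr : Irrational ((x + y) / (y + z))) : v3 a b c x y z ∈ U τ β := by
  have hab : a ≠ b := fun h => by simp [h] at h1
  have hbc : b ≠ c := fun h => by simp [h] at h2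
  have hac : a ≠ c := fun h => by rw [h] at h4; omega
  refine ⟨v3_nonneg a b c hx hy hz, by rw [tot_v3]; linarith, ?_⟩
  intro F hm h0 hi
  rw [tot_v3] at *
  have ta := hi a
  have tb := hi b
  have tc := hi c
  simp only [st_v3] at ta tb tc
  simp [v3, hab, hbc, hac, hab.symm, hbc.symm, hac.symm, h1, h2, h3, h4, h1.trans h2,
    h3.trans h4, h1.le, h2.le, h3.le, h4.le, (h1.trans h2).le, (h3.trans h4).le,
    (h1.trans h2).not_gt, (h3.trans h4).not_gt, h1.not_gt, h2.not_gt, h3.not_gt, h4.not_gt, h0] at ta tb tc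
  set G : ℝ → ℝ := fun w => if w ≤ x + y + z then F w else
    F (x + y + z) + (F (w - y - z) - F x) with hG
  have G1 : ∀ w, w ≤ x + y + z → G w = F w := fun w hw => if_pos hw
  have G2 : ∀ w, x + y + z ≤ w → G w = F (x + y + z) + (F (w - y - z) - F x) := fun w hw => by
    rcases hw.eq_or_lt with rfl | hw
    · rw [G1 _ le_rfl, show x + y + z - y - z = x by ring]; ring
    · exact if_neg (not_le.2 hw)
  have Gm : MonotoneOn G (Icc 0 ((x + y) + (y + z))) := by
    intro v hv w hw hvw
    rcases le_total w (x + y + z) with h | h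
    · rw [G1 w h, G1 v (hvw.trans h)]
      exact hm ⟨hv.1, hvw.trans h⟩ ⟨hw.1, h⟩ hvw
    · rw [G2 w h]
      rcases le_total v (x + y + z) with h' | h'
      · rw [G1 v h']
        have e1 := hm ⟨hv.1, h'⟩ ⟨by linarith, le_rfl⟩ h'
        have e2 := hm (a := x) ⟨hx, by linarith⟩ (b := w - y - z) ⟨by linarith, by linarith [hw.2]⟩
          (by linarith)
        linarith
      · rw [G2 v h']
        have e2 := hm (a := v - y - z) ⟨by linarith, by linarith [hv.2]⟩ (b := w - y - z)
          ⟨by linarith, by linarith [hw.2]⟩ (by linarith)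
        linarith
  have e0 := ta x hx le_rfl
  have e00 := tc z hz le_rfl
  have key := rotation hP hQ hirr Gm (by rw [G1 _ (by linarith), h0]) ?_ ?_
  · have k1 := key (x + y + z) ⟨by linarith, by linarith⟩
    intro w hw
    have k2 := key w ⟨hw.1, by linarith [hw.2]⟩
    rw [G1 _ le_rfl] at k1
    rw [G1 _ hw.2] at k2
    have hN : 0 < x + y + (y + z) := by linarith
    apply mul_right_cancel₀ hN.ne'
    calc F w * (x + y + z) * (x + y + (y + z)) = (F w * (x + y + (y + z))) * (x + y + z) := by ring
      _ = (G (x + y + (y + z)) * (x + y + z)) * w := by rw [k2]; ring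
      _ = _ := by rw [← k1]; ring
  · intro u hu0 hu1
    rw [G1 (y + z) (by linarith), G1 u (by linarith)]
    rcases le_or_gt u x with hux | hux
    · rw [G1 _ (by linarith)]; exact ta u hu0 hux
    · rw [G2 _ (by linarith), show y + z + u - y - z = u by ring]
      rw [show y + z + x = x + y + z by ring] at e0
      linarith
  · intro u hu0 hu1
    rw [G1 (x + y) (by linarith), G1 u (by linarith)]
    rcases le_or_gt u z with hux | hux
    · rw [G1 _ (by linarith)]; exact (tc u hu0 hux).symm
    · rw [G2 _ (by linarith), show x + y + u - y - z = x + (u - z) by ring]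
      have e2 := tb (u - z) (by linarith) (by linarith)
      rw [show z + (u - z) = u by ring] at e2
      linarith

theorem flip_join {τ β : ι → ℕ} {a b c : ι} (h1 : τ a < τ b) (h2 : τ b < τ c) (h3 : β c < β b)
    (h4 : β b < β a) {x y z x' y' z' : ℝ} (hx : 0 ≤ x) (hy : 0 ≤ y) (hz : 0 ≤ z)
    (hx' : 0 ≤ x') (hy' : 0 ≤ y') (hz' : 0 ≤ z') (hP : 0 < x + y)
    (hQ : 0 < y + z) (hirr : Irrational ((x + y) / (y + z)))
    (hs : x + y = x' + y') (hs' : y + z = y' + z') :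
    JoinedIn (U τ β) (v3 a b c x y z) (v3 a b c x' y' z') := by
  apply JoinedIn.of_segment_subset
  rintro _ ⟨s, t, hs0, ht0, hst, rfl⟩
  rw [v3_seg]
  have e1 : s * x + t * x' + (s * y + t * y') = x + y := by
    have : s * x + t * x' + (s * y + t * y') = s * (x + y) + t * (x' + y') := by ring
    rw [this, ← hs, ← add_mul, hst, one_mul]
  have e2 : s * y + t * y' + (s * z + t * z') = y + z := by
    have : s * y + t * y' + (s * z + t * z') = s * (y + z) + t * (y' + z') := by ring
    rw [this, ← hs', ← add_mul, hst, one_mul]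
  apply flip_mem h1 h2 h3 h4 (by positivity) (by positivity) (by positivity) (by rwa [e1])
    (by rwa [e2]) (by rwa [e1, e2])

theorem edge_mem {τ β : ι → ℕ} {a b : ι} (h1 : τ a < τ b) (h3 : β b < β a)
    {x y : ℝ} (hx : 0 < x) (hy : 0 < y)
    (hirr : Irrational (x / y)) : v2 a b x y ∈ U τ β := by
  have hab : a ≠ b := fun h => by simp [h] at h1
  refine ⟨v2_nonneg a b hx.le hy.le, by rw [tot_v2]; linarith, ?_⟩
  intro F hm h0 hi
  rw [tot_v2] at *
  have ta := hi a
  have tb := hi b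
  simp only [st_v2] at ta tb
  simp [v2, hab, hab.symm, h1, h3, h1.le, h3.le, h1.not_gt, h3.not_gt, h0] at ta tb
  exact rotation hx hy hirr hm h0 ta (fun u h h' => (tb u h h').symm)

/-- If all translations are multiples of `e` then there are many invariant measures. -/
theorem not_uef_of_commens {τ β : ι → ℕ} {L : ι → ℝ} (hT : 0 < tot L) {e : ℝ} (he : 0 < e)
    (h : ∀ j, 0 < L j → ∃ m : ℤ, st β L j = st τ L j + m * e) : ¬ UEF τ β L := by
  intro hU
  obtain ⟨n, hn⟩ := exists_nat_gt (e / tot L)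
  have hn0 : (0:ℝ) < n := lt_trans (by positivity) hn
  set e' := e / n with he'
  have he'0 : 0 < e' := by positivity
  have hle : e' < tot L := by
    rw [div_lt_iff₀ hT] at hn
    rw [he', div_lt_iff₀ hn0]; linarith
  have hshift : ∀ y (m : ℤ), e' * ⌊(y + m * e) / e'⌋ = e' * ⌊y / e'⌋ + m * e := by
    intro y m
    have : (y + m * e) / e' = y / e' + ((m * n : ℤ) : ℝ) := by
      rw [he']; push_cast; field_simp
    rw [this, Int.floor_add_intCast]; push_cast; rw [he']; field_simp
  have := hU (fun w => e' * ⌊w / e'⌋) ?_ (by simp) ?_ (e' / 2) ⟨by positivity, by linarith⟩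
  · have h1 : ⌊e' / 2 / e'⌋ = 0 := by
      rw [Int.floor_eq_zero_iff]; rw [show e' / 2 / e' = 1 / 2 by field_simp]; constructor <;> norm_num
    have h2 : (1:ℤ) ≤ ⌊tot L / e'⌋ := by
      rw [Int.le_floor]; push_cast; rw [le_div_iff₀ he'0]; linarith
    have h3 : (1:ℝ) ≤ ⌊tot L / e'⌋ := by exact_mod_cast h2
    simp only [h1, Int.cast_zero, mul_zero, zero_mul] at this
    have h4 : 0 < e' * ⌊tot L / e'⌋ * (e' / 2) := by positivity
    linarith
  · intro a _ b _ hab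
    simp only
    gcongr
  · intro j u hu0 hu1
    rcases hu0.eq_or_lt with rfl | hu0
    · simp
    · obtain ⟨m, hm⟩ := h j (by linarith)
      simp only [hm]
      rw [show st τ L j + m * e + u = (st τ L j + u) + m * e by ring, hshift, hshift]; ring

theorem commens {P Q : ℝ} (hP : 0 ≤ P) (hQ : 0 ≤ Q) (hPQ : 0 < P + Q)
    (h : ¬ (0 < P ∧ 0 < Q ∧ Irrational (P / Q))) :
    ∃ e : ℝ, 0 < e ∧ ∃ m n : ℤ, P = m * e ∧ Q = n * e := by
  rcases hP.eq_or_lt with rfl | hP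
  · exact ⟨Q, by linarith, 0, 1, by simp, by simp⟩
  rcases hQ.eq_or_lt with rfl | hQ
  · exact ⟨P, by linarith, 1, 0, by simp, by simp⟩
  have : ¬ Irrational (P / Q) := fun hh => h ⟨hP, hQ, hh⟩
  rw [Irrational, not_not] at this
  obtain ⟨r, hr⟩ := this
  have hd : (0:ℝ) < r.den := by exact_mod_cast r.den_pos
  refine ⟨Q / r.den, by positivity, r.num, r.den, ?_, ?_⟩
  · have : (r : ℝ) = r.num / r.den := by exact_mod_cast (Rat.num_div_den r).symm
    rw [this, eq_div_iff hQ.ne'] at hr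
    rw [← hr]; field_simp
  · push_cast; field_simp

theorem merge_irr {τ β : ι → ℕ} {a b c : ι} (h1 : τ a < τ b) (h2 : τ b < τ c) (h3 : β c < β a)
    (h4 : β a < β b) {x y z : ℝ} (hx : 0 ≤ x) (hy : 0 ≤ y) (hz : 0 ≤ z)
    (hU : v3 a b c x y z ∈ U τ β) :
    0 < x + y ∧ 0 < z ∧ Irrational ((x + y) / z) := by
  by_contra hcon
  have hab : a ≠ b := fun h => by simp [h] at h1
  have hbc : b ≠ c := fun h => by simp [h] at h2
  have hac : a ≠ c := fun h => by simp [h] at h3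
  have ht := hU.2.1
  obtain ⟨e, he, m, n, hm, hn⟩ := commens (P := x + y) (Q := z) (by linarith) hz
    (by rw [tot_v3] at ht; linarith) hcon
  refine not_uef_of_commens ht he (fun j hj => ?_) hU.2.2
  rw [st_v3, st_v3]
  by_cases hja : j = a
  · subst hja
    refine ⟨n, ?_⟩
    simp [h1.not_gt, (h1.trans h2).not_gt, h3, h4.not_gt, hn]
  by_cases hjb : j = b
  · subst hjb
    refine ⟨n, ?_⟩
    simp [h1, h2.not_gt, h4, h3.trans h4, hn]
  by_cases hjc : j = c
  · subst hjc
    refine ⟨-m, ?_⟩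
    simp [h2, h1.trans h2, h3.not_gt, (h3.trans h4).not_gt, hm]
  · simp [v3, hja, hjb, hjc] at hj

theorem flip_irr {τ β : ι → ℕ} {a b c : ι} (h1 : τ a < τ b) (h2 : τ b < τ c) (h3 : β c < β b)
    (h4 : β b < β a) {x y z : ℝ} (hx : 0 ≤ x) (hy : 0 ≤ y) (hz : 0 ≤ z)
    (hU : v3 a b c x y z ∈ U τ β) :
    0 < x + y ∧ 0 < y + z ∧ Irrational ((x + y) / (y + z)) := by
  by_contra hcon
  have hab : a ≠ b := fun h => by simp [h] at h1
  have hbc : b ≠ c := fun h => by simp [h] at h2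
  have hac : a ≠ c := fun h => by rw [h] at h4; omega
  have ht := hU.2.1
  obtain ⟨e, he, m, n, hm, hn⟩ := commens (P := x + y) (Q := y + z) (by linarith) (by linarith)
    (by rw [tot_v3] at ht; linarith) hcon
  refine not_uef_of_commens ht he (fun j hj => ?_) hU.2.2
  rw [st_v3, st_v3]
  by_cases hja : j = a
  · subst hja
    refine ⟨n, ?_⟩
    simp [h1.not_gt, (h1.trans h2).not_gt, h3.trans h4, h4, hn]
  by_cases hjb : j = b
  · subst hjb
    refine ⟨n - m, ?_⟩
    simp [h1, h2.not_gt, h3, h4.not_gt]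
    linarith
  by_cases hjc : j = c
  · subst hjc
    refine ⟨-m, ?_⟩
    simp [h2, h1.trans h2, h3.not_gt, (h3.trans h4).not_gt, hm]
  · simp [v3, hja, hjb, hjc] at hj

theorem red_first {τ β : ι → ℕ} {a b c : ι} (h1 : τ a < τ b) (h2 : τ b < τ c) (h3 : β a < β c)
    (h4 : β c < β b) {x y z : ℝ} (hx : 0 ≤ x) (hy : 0 ≤ y) (hz : 0 ≤ z)
    (hU : v3 a b c x y z ∈ U τ β) : x = 0 := by
  by_contra hcon
  have hx : 0 < x := lt_of_le_of_ne hx (Ne.symm hcon)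
  have ht := hU.2.1
  have hU := hU.2.2
  rw [UEF, tot_v3] at hU
  have := hU (fun w => min w (x / 2)) (fun u _ v _ huv => min_le_min_right _ huv)
    (by simp; linarith) ?_ (x / 2) ⟨by linarith, by linarith⟩
  · simp only [min_self] at this
    rw [min_eq_right (by linarith)] at this
    have := mul_left_cancel₀ (by linarith) this
    linarith
  · intro j u hu0 hu1
    rcases hu0.eq_or_lt with rfl | hu0
    · simp
    rw [st_v3, st_v3]
    by_cases hja : j = a
    · subst hja
      simp [h1.not_gt, (h1.trans h2).not_gt, h3.not_gt, (h3.trans h4).not_gt]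
    by_cases hjb : j = b
    · subst hjb
      simp only [h1, h2.not_gt, h4, h3.trans h4, if_true, if_false, lt_irrefl]
      rw [min_eq_right (by linarith), min_eq_right (by linarith), min_eq_right (by linarith),
        min_eq_right (by linarith)]
    by_cases hjc : j = c
    · subst hjc
      simp only [h1.trans h2, h2, h4.not_gt, h3, if_true, if_false, lt_irrefl]
      rw [min_eq_right (by linarith), min_eq_right (by linarith), min_eq_right (by linarith),
        min_eq_right (by linarith)]
    · simp [v3, hja, hjb, hjc] at hu1; linarith

theorem red_last {τ β : ι → ℕ} {a b c : ι} (h1 : τ a < τ b) (h2 : τ b < τ c) (h3 : β b < β a)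
    (h4 : β a < β c) {x y z : ℝ} (hx : 0 ≤ x) (hy : 0 ≤ y) (hz : 0 ≤ z)
    (hU : v3 a b c x y z ∈ U τ β) : z = 0 := by
  by_contra hcon
  have hx : 0 < z := lt_of_le_of_ne hz (Ne.symm hcon)
  have hab : a ≠ b := fun h => by simp [h] at h1
  have hbc : b ≠ c := fun h => by simp [h] at h2
  have hac : a ≠ c := fun h => by rw [h] at h4; omega
  have ht := hU.2.1
  have hU := hU.2.2
  rw [UEF, tot_v3] at hU
  have := hU (fun w => max 0 (w - (x + y + z / 2))) (fun u _ v _ huv => max_le_max_left _ (by linarith))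
    (by simp; linarith) ?_ (x + y + z / 2) ⟨by linarith, by linarith⟩
  · simp only [sub_self, max_self, zero_mul] at this
    rw [max_eq_right (by linarith), zero_eq_mul] at this
    rcases this with h | h <;> linarith
  · intro j u hu0 hu1
    rcases hu0.eq_or_lt with rfl | hu0
    · simp
    rw [st_v3, st_v3]
    by_cases hja : j = a
    · subst hja
      simp [v3, hab, hac] at hu1
      simp only [h1.not_gt, (h1.trans h2).not_gt, h3, h4.not_gt, if_true, if_false, lt_irrefl]
      rw [max_eq_left (by linarith), max_eq_left (by linarith), max_eq_left (by linarith),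
        max_eq_left (by linarith)]
    by_cases hjb : j = b
    · subst hjb
      simp [v3, hbc, hab.symm] at hu1
      simp only [h1, h2.not_gt, h3.not_gt, (h3.trans h4).not_gt, if_true, if_false, lt_irrefl]
      rw [max_eq_left (by linarith), max_eq_left (by linarith), max_eq_left (by linarith),
        max_eq_left (by linarith)]
    by_cases hjc : j = c
    · subst hjc
      simp [h1.trans h2, h2, h4, h3.trans h4]
    · simp [v3, hja, hjb, hjc] at hu1; linarith

end triples
end IET

set_option linter.unusedSectionVars false
set_option linter.unusedSimpArgs false
set_option linter.unusedVariables false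
set_option linter.style.longLine false
namespace IET
open Set Filter Topology
section steps
variable {ι : Type*} [Fintype ι] [DecidableEq ι]

/-- The elementary Rauzy matrix: the winner `w` gets the length of the loser `l` added. -/
def M (w l : ι) (v : ι → ℝ) : ι → ℝ := v + Pi.single w (v l)

theorem M_w (w l : ι) (v : ι → ℝ) : M w l v w = v w + v l := by simp [M]
theorem M_ne {w l k : ι} (h : k ≠ w) (v : ι → ℝ) : M w l v k = v k := by simp [M, h]
theorem tot_M (w l : ι) (v : ι → ℝ) : tot (M w l v) = tot v + v l := by
  rw [M, tot_add, tot_single]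
theorem M_nonneg (w l : ι) {v : ι → ℝ} (h : ∀ i, 0 ≤ v i) (i : ι) : 0 ≤ M w l v i := by
  by_cases hi : i = w
  · subst hi; rw [M_w]; linarith [h i, h l]
  · rw [M_ne hi]; exact h i
theorem M_add (w l : ι) (v v' : ι → ℝ) : M w l (v + v') = M w l v + M w l v' := by
  ext i; simp [M, Pi.single_apply]; split_ifs <;> ring
theorem M_smul (w l : ι) (c : ℝ) (v : ι → ℝ) : M w l (c • v) = c • M w l v := by
  ext i; simp [M, Pi.single_apply]; split_ifs <;> ring
theorem M_continuous (w l : ι) : Continuous (M w l) := by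
  exact continuous_id.add ((continuous_single w).comp (continuous_apply l))

/-- A Rauzy step of top type. -/
structure StepT (τ β τ' β' : ι → ℕ) (w l : ι) : Prop where
  ne : w ≠ l
  tau : ∀ v k, st τ (M w l v) k = st τ' v k
  top : ∀ v, st τ (M w l v) w + v w = tot v
  bet : ∀ v k, k ≠ l → st β (M w l v) k = st β' v k
  bl : ∀ v, st β (M w l v) l = tot v
  bl' : ∀ v, st β' v l = st β (M w l v) w + v w

theorem StepT.uef {τ β τ' β' : ι → ℕ} {w l : ι} (h : StepT τ β τ' β' w l) {v : ι → ℝ}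
    (hv : ∀ i, 0 ≤ v i) (hT : 0 < tot v) (hU : UEF τ' β' v) : UEF τ β (M w l v) := by
  intro F hm h0 hi
  have htot := tot_M w l v
  have hvl := hv l
  have hInv : Inv τ' β' v F := by
    intro j u hu0 hu1
    by_cases hjl : j = l
    · subst hjl
      have e1 := hi w (v w + u) (by linarith [hv w]) (by rw [M_w]; linarith)
      have e2 := hi w (v w) (hv w) (by rw [M_w]; linarith)
      have e3 := hi j u hu0 (by rw [M_ne h.ne.symm]; exact hu1)
      rw [← add_assoc, ← add_assoc, h.top, ← h.bl'] at e1
      rw [h.top, ← h.bl'] at e2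
      rw [h.bl, h.tau] at e3
      linarith
    · have := hi j u hu0 (by
        by_cases hjw : j = w
        · subst hjw; rw [M_w]; linarith
        · rw [M_ne hjw]; exact hu1)
      rw [h.bet v j hjl, h.tau] at this
      exact this
  have hlin := hU F (hm.mono (Icc_subset_Icc_right (by linarith))) h0 hInv
  set k := F (tot v) / tot v with hk
  have hlin' : ∀ x ∈ Icc (0:ℝ) (tot v), F x = k * x := by
    intro x hx
    rw [hk, div_mul_eq_mul_div, eq_div_iff hT.ne']; exact hlin x hx
  have hall : ∀ x ∈ Icc (0:ℝ) (tot (M w l v)), F x = k * x := by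
    intro x hx
    rcases le_total x (tot v) with hxt | hxt
    · exact hlin' x ⟨hx.1, hxt⟩
    · have e := hi l (x - tot v) (by linarith) (by rw [M_ne h.ne.symm]; linarith [hx.2])
      have b1 := st_nonneg (τ := τ') hv l
      have b2 := st_add_le (τ := τ') hv l
      rw [h.bl, h.tau, add_sub_cancel, hlin' (st τ' v l + (x - tot v)) ⟨by linarith, by linarith [hx.2]⟩,
        hlin' (st τ' v l) ⟨b1, by linarith⟩,
        hlin' (tot v) ⟨hT.le, le_rfl⟩] at e
      linarith
  intro x hx
  rw [hall x hx, hall _ ⟨by linarith [hx.1, hx.2], le_rfl⟩]; ring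

/-- A Rauzy step. -/
def Step (τ β τ' β' : ι → ℕ) (w l : ι) : Prop := StepT τ β τ' β' w l ∨ StepT β τ β' τ' w l

theorem Step.ne {τ β τ' β' : ι → ℕ} {w l : ι} (h : Step τ β τ' β' w l) : w ≠ l := by
  rcases h with h | h <;> exact h.ne

theorem Step.uef {τ β τ' β' : ι → ℕ} {w l : ι} (h : Step τ β τ' β' w l) {v : ι → ℝ}
    (hv : ∀ i, 0 ≤ v i) (hT : 0 < tot v) (hU : UEF τ' β' v) : UEF τ β (M w l v) := by
  rcases h with h | h
  · exact h.uef hv hT hU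
  · exact (h.uef hv hT hU.swap).swap

theorem Step.mem {τ β τ' β' : ι → ℕ} {w l : ι} (h : Step τ β τ' β' w l) {v : ι → ℝ}
    (hU : v ∈ U τ' β') : M w l v ∈ U τ β :=
  ⟨M_nonneg w l hU.1, by rw [tot_M]; linarith [hU.1 l, hU.2.1], h.uef hU.1 hU.2.1 hU.2.2⟩

theorem Step.join {τ β τ' β' : ι → ℕ} {w l : ι} (h : Step τ β τ' β' w l) {v v' : ι → ℝ}
    (hU : JoinedIn (U τ' β') v v') : JoinedIn (U τ β) (M w l v) (M w l v') := by
  have := hU.map_continuousOn (f := M w l) (M_continuous w l).continuousOn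
  refine this.mono ?_
  rintro _ ⟨x, hx, rfl⟩
  exact h.mem hx

/-- `F` is invariant up to an error of total size `ε`. -/
def AInv (τ β : ι → ℕ) (L : ι → ℝ) (F : ℝ → ℝ) (ε : ℝ) : Prop :=
  ∃ E : ι → ℝ, (∀ j, 0 ≤ E j) ∧ tot E ≤ ε ∧ ∀ j u, 0 ≤ u → u ≤ L j →
    |F (st β L j + u) - F (st β L j) - (F (st τ L j + u) - F (st τ L j))| ≤ E j

/-- The masses of the top intervals. -/
noncomputable def mass (τ : ι → ℕ) (L : ι → ℝ) (F : ℝ → ℝ) (k : ι) : ℝ := F (st τ L k + L k) - F (st τ L k)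

theorem Step.ext {τ β τ' β' : ι → ℕ} {w l : ι} (h : Step τ β τ' β' w l) {v : ι → ℝ}
    (hv : ∀ i, 0 ≤ v i) {F : ℝ → ℝ} (hm : MonotoneOn F (Icc 0 (tot v))) {ε : ℝ}
    (hi : AInv τ' β' v F ε) :
    ∃ G : ℝ → ℝ, MonotoneOn G (Icc 0 (tot (M w l v))) ∧ (∀ x ≤ tot v, G x = F x) ∧
      G (tot (M w l v)) = F (tot v) + mass τ' v F l ∧
      mass τ (M w l v) G = M w l (mass τ' v F) ∧ AInv τ β (M w l v) G ε := by
  have hT := tot_nonneg hv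
  have htot := tot_M w l v
  have hvl := hv l
  set S := st τ' v l with hS
  have hS0 : 0 ≤ S := st_nonneg hv l
  have hSl : S + v l ≤ tot v := st_add_le hv l
  set G : ℝ → ℝ := fun x => if x ≤ tot v then F x else F (tot v) + (F (S + (x - tot v)) - F S) with hG
  have G1 : ∀ x, x ≤ tot v → G x = F x := fun x hx => if_pos hx
  have G2 : ∀ u, 0 ≤ u → G (tot v + u) = F (tot v) + (F (S + u) - F S) := fun u hu => by
    rcases hu.eq_or_lt with rfl | hu
    · rw [G1 _ (by linarith)]; simp
    · simp only [hG]
      rw [if_neg (by linarith), add_sub_cancel_left]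
  have Gm : MonotoneOn G (Icc 0 (tot (M w l v))) := by
    rw [htot]
    intro a ha b hb hab
    rcases le_total b (tot v) with hbt | hbt
    · rw [G1 b hbt, G1 a (hab.trans hbt)]
      exact hm ⟨ha.1, hab.trans hbt⟩ ⟨hb.1, hbt⟩ hab
    · have eb := G2 (b - tot v) (by linarith)
      rw [add_sub_cancel] at eb
      rw [eb]
      rcases le_total a (tot v) with hat | hat
      · rw [G1 a hat]
        have e1 := hm ⟨ha.1, hat⟩ ⟨hT, le_rfl⟩ hat
        have e2 := hm (a := S) ⟨hS0, by linarith⟩ (b := S + (b - tot v))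
          ⟨by linarith, by linarith [hb.2]⟩ (by linarith)
        linarith
      · have ea := G2 (a - tot v) (by linarith)
        rw [add_sub_cancel] at ea
        rw [ea]
        have e2 := hm (a := S + (a - tot v)) ⟨by linarith, by linarith [ha.2]⟩
          (b := S + (b - tot v)) ⟨by linarith, by linarith [hb.2]⟩ (by linarith)
        linarith
  obtain ⟨E, hE0, hEs, hE⟩ := hi
  refine ⟨G, Gm, G1, ?_, ?_, ?_⟩
  · rw [htot, G2 _ hvl]; rfl
  · ext k
    rcases h with h | h
    · by_cases hkw : k = w
      · subst hkw
        have e3 : st τ (M k l v) k + (v k + v l) = tot v + v l := by rw [← add_assoc, h.top]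
        rw [M_w, mass, M_w, e3, G2 _ hvl, G1 _ (by linarith [h.top v, hv k]), h.tau]
        have e1 := h.top v
        rw [h.tau] at e1
        simp only [mass, e1]; ring
      · have e2 := st_add_le (τ := τ') hv k
        rw [M_ne hkw, mass, M_ne hkw, h.tau, G1 _ e2, G1 _ (by linarith [hv k])]; rfl
    · by_cases hkw : k = w
      · subst hkw
        have e1 := h.bl' v
        rw [M_w, mass, M_w, ← add_assoc, ← e1, G1 _ hSl, G1 _ (by linarith [hv k])]
        rw [h.bet v k h.ne] at e1 ⊢
        simp only [mass, ← e1]; rw [← hS]; ring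
      · rw [M_ne hkw, mass, M_ne hkw]
        by_cases hkl : k = l
        · subst hkl
          rw [h.bl, G2 _ hvl, G1 _ le_rfl]; simp only [mass]; rw [← hS]; ring
        · have e2 := st_add_le (τ := τ') hv k
          rw [h.bet v k hkl, G1 _ e2, G1 _ (by linarith [hv k])]; rfl
  · rcases h with h | h
    · refine ⟨fun k => if k = l then 0 else if k = w then E w + E l else E k, ?_, ?_, ?_⟩
      · intro j; simp only; split_ifs
        · exact le_rfl
        · linarith [hE0 w, hE0 l]
        · exact hE0 j
      · refine le_trans (le_of_eq ?_) hEs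
        have : (fun k => if k = l then 0 else if k = w then E w + E l else E k) =
            E + Pi.single w (E l) + Pi.single l (- E l) := by
          ext k
          by_cases hkl : k = l
          · subst hkl; simp [h.ne]
          · by_cases hkw : k = w
            · subst hkw; simp [h.ne]
            · simp [hkl, hkw]
        rw [this, tot_add, tot_add, tot_single, tot_single]; ring
      · intro j u hu0 hu1
        beta_reduce
        by_cases hjl : j = l
        · subst hjl
          rw [M_ne h.ne.symm] at hu1
          rw [if_pos rfl, h.bl, h.tau, G2 u hu0, G1 _ le_rfl, G1 _ (by linarith), G1 _ (by linarith), ← hS]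
          apply le_of_eq; rw [abs_eq_zero]; ring
        rw [if_neg hjl]
        by_cases hjw : j = w
        · subst hjw
          rw [if_pos rfl]
          rw [M_w] at hu1
          have a1 := st_add_le (τ := τ') hv j
          have a2 := st_add_le (τ := β') hv j
          rcases le_total u (v j) with huv | huv
          · have := hE j u hu0 huv
            rw [h.bet v j hjl, h.tau, G1 _ (by linarith), G1 _ (by linarith), G1 _ (by linarith),
              G1 _ (by linarith)]
            linarith [hE0 l]
          · have e1 := hE j (v j) (hv j) le_rfl
            have e2 := hE l (u - v j) (by linarith) (by linarith)
            have t1 := h.top v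
            have t2 := h.bl' v
            have a3 := st_add_le (τ := β') hv l
            rw [h.bet v j hjl] at t2 ⊢
            rw [h.tau] at t1 ⊢
            have eb : st β' v j + u = st β' v l + (u - v j) := by linarith
            have et : st τ' v j + u = tot v + (u - v j) := by linarith
            rw [eb, et, G2 _ (by linarith), G1 _ (by linarith), G1 _ (by linarith [hv j]),
              G1 _ (by linarith [hv j])]
            rw [← t2, t1] at e1
            rw [← hS] at e2
            rw [abs_le] at *
            constructor <;> linarith
        · rw [if_neg hjw]
          rw [M_ne hjw] at hu1
          have a1 := st_add_le (τ := τ') hv j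
          have a2 := st_add_le (τ := β') hv j
          have := hE j u hu0 hu1
          rw [h.bet v j hjl, h.tau, G1 _ (by linarith), G1 _ (by linarith), G1 _ (by linarith),
              G1 _ (by linarith)]
          exact this
    · refine ⟨E, hE0, hEs, ?_⟩
      intro j u hu0 hu1
      have a1 := st_add_le (τ := τ') hv j
      have a2 := st_add_le (τ := β') hv j
      by_cases hjl : j = l
      · subst hjl
        rw [M_ne h.ne.symm] at hu1
        have := hE j u hu0 hu1
        rw [h.bl, h.tau, G2 u hu0, G1 _ (by linarith), G1 _ (by linarith), G1 _ le_rfl]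
        rw [← hS] at this
        rwa [add_sub_cancel_left]
      by_cases hjw : j = w
      · subst hjw
        rw [M_w] at hu1
        rcases le_total u (v j) with huv | huv
        · have := hE j u hu0 huv
          rw [h.bet v j hjl, h.tau, G1 _ (by linarith), G1 _ (by linarith), G1 _ (by linarith),
              G1 _ (by linarith)]
          exact this
        · have e1 := hE j (v j) (hv j) le_rfl
          have t1 := h.top v
          have t2 := h.bl' v
          rw [h.bet v j hjl, ← hS] at t2
          rw [h.bet v j hjl]
          rw [h.tau] at t1 ⊢
          have eb : st β' v j + u = tot v + (u - v j) := by linarith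
          have et : st τ' v j + u = S + (u - v j) := by linarith
          rw [eb, et, G2 _ (by linarith), G1 _ (by linarith [hv j]), G1 _ (by linarith),
              G1 _ (by linarith [hv j])]
          rw [← t2, t1] at e1
          rw [abs_le] at *
          constructor <;> linarith
      · rw [M_ne hjw] at hu1
        have := hE j u hu0 hu1
        rw [h.bet v j hjl, h.tau, G1 _ (by linarith), G1 _ (by linarith), G1 _ (by linarith),
              G1 _ (by linarith)]
        exact this

theorem Inv.aInv {τ β : ι → ℕ} {L : ι → ℝ} {F : ℝ → ℝ} (h : Inv τ β L F) : AInv τ β L F 0 :=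
  ⟨0, fun _ => le_rfl, by simp [tot], fun j u h0 h1 => by rw [h j u h0 h1]; simp⟩

theorem AInv.inv {τ β : ι → ℕ} {L : ι → ℝ} {F : ℝ → ℝ} (h : AInv τ β L F 0) : Inv τ β L F := by
  obtain ⟨E, hE0, hEs, hE⟩ := h
  intro j u h0 h1
  have h2 := (hE j u h0 h1).trans ((le_tot hE0 j).trans hEs)
  rw [← sub_eq_zero]; exact abs_nonpos_iff.1 h2

theorem Step.uef_conv {τ β τ' β' : ι → ℕ} {w l : ι} (h : Step τ β τ' β' w l) {v : ι → ℝ}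
    (hv : ∀ i, 0 ≤ v i) (hT : 0 < tot v) (hU : UEF τ β (M w l v)) : UEF τ' β' v := by
  intro F hm h0 hi x hx
  obtain ⟨G, Gm, G1, -, -, hG⟩ := h.ext hv hm hi.aInv
  have hlin := hU G Gm (by rw [G1 _ hT.le, h0]) hG.inv
  have htot := tot_M w l v
  have e1 := hlin x ⟨hx.1, by linarith [hv l, hx.2]⟩
  have e2 := hlin (tot v) ⟨hT.le, by linarith [hv l]⟩
  rw [G1 _ hx.2] at e1
  rw [G1 _ le_rfl] at e2
  have : 0 < tot (M w l v) := by linarith [hv l]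
  apply mul_right_cancel₀ this.ne'
  linear_combination (tot v) * e1 - x * e2

end steps
end IET

set_option linter.unusedSectionVars false
set_option linter.unusedSimpArgs false
set_option linter.unusedVariables false
set_option linter.style.longLine false
namespace IET
open Set Filter Topology
section wrappers
variable {ι : Type*} [Fintype ι] [DecidableEq ι]

theorem irr_a {x y : ℝ} (hy : 0 < y) (h : Irrational (x / y)) : Irrational ((x + y) / y) := by
  have : (x + y) / y = x / y + 1 := by field_simp
  rw [this]; simpa using h.add_intCast 1

theorem irr_inv {x y : ℝ} (h : Irrational (x / y)) : Irrational (y / x) := by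
  have := h.inv; rwa [inv_div] at this

theorem irr_b {x y : ℝ} (hx : 0 < x) (h : Irrational (x / y)) : Irrational (x / (x + y)) := by
  have := irr_inv (irr_a hx (irr_inv h)); rwa [add_comm] at this

theorem merge_v2 {τ β : ι → ℕ} {a b c : ι} (h1 : τ a < τ b) (h2 : τ b < τ c) (h3 : β c < β a)
    (h4 : β a < β b) {x z : ℝ} (hx : 0 < x) (hz : 0 < z) (hirr : Irrational (x / z)) :
    JoinedIn (U τ β) (v2 a c x z) (v2 b c x z) := by
  have := merge_join h1 h2 h3 h4 (x := x) (y := 0) (z := z) (x' := 0) (y' := x) hx.le le_rfl le_rfl hx.le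
    (by simpa) hz (by simpa) (by ring)
  rwa [v3_zero2, v3_zero1] at this

theorem merge_v3 {τ β : ι → ℕ} {a b c : ι} (h1 : τ a < τ b) (h2 : τ b < τ c) (h3 : β c < β a)
    (h4 : β a < β b) {x y z : ℝ} (hx : 0 ≤ x) (hy : 0 ≤ y) (hP : 0 < x + y) (hz : 0 < z)
    (hirr : Irrational ((x + y) / z)) :
    JoinedIn (U τ β) (v3 a b c x y z) (v2 a c (x + y) z) := by
  have := merge_join h1 h2 h3 h4 (x := x) (y := y) (z := z) (x' := x + y) (y' := 0) hx hy hP.le le_rfl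
    hP hz hirr (by ring)
  rwa [v3_zero2] at this

theorem flip_v3 {τ β : ι → ℕ} {a b c : ι} (h1 : τ a < τ b) (h2 : τ b < τ c) (h3 : β c < β b)
    (h4 : β b < β a) {x y z : ℝ} (hx : 0 ≤ x) (hy : 0 ≤ y) (hz : 0 ≤ z) (hP : 0 < x + y)
    (hQ : 0 < y + z) (hirr : Irrational ((x + y) / (y + z))) :
    JoinedIn (U τ β) (v3 a b c x y z) (v2 a c (x + y) (y + z)) := by
  have := flip_join h1 h2 h3 h4 (x := x) (y := y) (z := z) (x' := x + y) (y' := 0) (z' := y + z) hx hy hz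
    hP.le le_rfl hQ.le hP hQ hirr (by ring) (by ring)
  rwa [v3_zero2] at this

theorem flip_bc {τ β : ι → ℕ} {a b c : ι} (h1 : τ a < τ b) (h2 : τ b < τ c) (h3 : β c < β b)
    (h4 : β b < β a) {y z : ℝ} (hy : 0 < y) (hz : 0 < z) (hirr : Irrational (y / z)) :
    JoinedIn (U τ β) (v2 b c y z) (v2 a c y (y + z)) := by
  have := flip_v3 h1 h2 h3 h4 (x := 0) (y := y) (z := z) le_rfl hy.le hz.le (by linarith) (by linarith)
    (by rw [zero_add]; exact irr_b hy hirr)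
  rwa [v3_zero1, zero_add] at this

theorem flip_ab {τ β : ι → ℕ} {a b c : ι} (h1 : τ a < τ b) (h2 : τ b < τ c) (h3 : β c < β b)
    (h4 : β b < β a) {x y : ℝ} (hx : 0 < x) (hy : 0 < y) (hirr : Irrational (x / y)) :
    JoinedIn (U τ β) (v2 a b x y) (v2 a c (x + y) y) := by
  have := flip_v3 h1 h2 h3 h4 (x := x) (y := y) (z := 0) hx.le hy.le le_rfl (by linarith) (by linarith)
    (by rw [add_zero]; exact irr_a hy hirr)
  rwa [v3_zero3, add_zero] at this
end wrappers


/-- top positions -/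
def tp : Fin 7 → Fin 4 → ℕ :=
  ![![0,1,2,3], ![0,1,2,3], ![0,1,2,3], ![0,1,3,2], ![0,2,3,1], ![0,3,1,2], ![0,2,3,1]]
/-- bottom positions -/
def bp : Fin 7 → Fin 4 → ℕ :=
  ![![3,2,1,0], ![1,3,2,0], ![2,1,3,0], ![1,3,2,0], ![3,2,1,0], ![3,2,1,0], ![2,3,1,0]]
/-- last top letter -/
def lt : Fin 7 → Fin 4 := ![3, 3, 3, 2, 2, 1, 2]
/-- last bottom letter -/
def lb : Fin 7 → Fin 4 := ![0, 1, 2, 1, 0, 0, 1]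
/-- next state (`true`: top letter wins) -/
def nx : Fin 7 → Bool → Fin 7
  | s, true => ![1, 2, 0, 3, 6, 5, 4] s
  | s, false => ![4, 3, 2, 1, 5, 0, 6] s
/-- winner -/
def wn : Fin 7 → Bool → Fin 4
  | s, true => lt s
  | s, false => lb s
/-- loser -/
def ls : Fin 7 → Bool → Fin 4
  | s, true => lb s
  | s, false => lt s

/-- The uniquely ergodic set of a state. -/
abbrev US (s : Fin 7) : Set (Fin 4 → ℝ) := U (tp s) (bp s)

theorem step_t (s : Fin 7) :
    StepT (tp s) (bp s) (tp (nx s true)) (bp (nx s true)) (lt s) (lb s) := by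
  fin_cases s <;>
  (constructor
   · decide
   · intro v k
     fin_cases k <;> simp [st, M, tp, nx, lt, lb, Fin.sum_univ_four, Pi.single_apply] <;> ring
   · intro v
     simp [st, M, tp, nx, lt, lb, Fin.sum_univ_four, Pi.single_apply, tot] <;> ring
   · intro v k hk
     fin_cases k <;> simp [st, M, bp, nx, lt, lb, Fin.sum_univ_four, Pi.single_apply] at hk ⊢ <;> ring
   · intro v
     simp [st, M, bp, nx, lt, lb, Fin.sum_univ_four, Pi.single_apply, tot] <;> ring
   · intro v
     simp [st, M, bp, nx, lt, lb, Fin.sum_univ_four, Pi.single_apply, tot] <;> ring)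

theorem step_b (s : Fin 7) :
    StepT (bp s) (tp s) (bp (nx s false)) (tp (nx s false)) (lb s) (lt s) := by
  fin_cases s <;>
  (constructor
   · decide
   · intro v k
     fin_cases k <;> simp [st, M, bp, nx, lt, lb, Fin.sum_univ_four, Pi.single_apply] <;> ring
   · intro v
     simp [st, M, bp, nx, lt, lb, Fin.sum_univ_four, Pi.single_apply, tot] <;> ring
   · intro v k hk
     fin_cases k <;> simp [st, M, tp, nx, lt, lb, Fin.sum_univ_four, Pi.single_apply] at hk ⊢ <;> ring
   · intro v
     simp [st, M, tp, nx, lt, lb, Fin.sum_univ_four, Pi.single_apply, tot] <;> ring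
   · intro v
     simp [st, M, tp, nx, lt, lb, Fin.sum_univ_four, Pi.single_apply, tot] <;> ring)

theorem step_s (s : Fin 7) (c : Bool) :
    Step (tp s) (bp s) (tp (nx s c)) (bp (nx s c)) (wn s c) (ls s c) := by
  cases c
  · exact Or.inr (step_b s)
  · exact Or.inl (step_t s)
end IET

set_option linter.unusedSectionVars false
set_option linter.unusedSimpArgs false
set_option linter.unusedVariables false
set_option linter.style.longLine false
namespace IET
open Set Filter Topology

/-- golden ratio -/
noncomputable abbrev gr : ℝ := Real.goldenRatio
theorem gr1 : 1 < gr := Real.one_lt_goldenRatio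
theorem gr2 : gr < 2 := Real.goldenRatio_lt_two
theorem grsq : gr * gr = gr + 1 := by have := Real.goldenRatio_sq; rwa [sq] at this
theorem grirr : Irrational gr := Real.goldenRatio_irrational
theorem grm : Irrational (gr - 1) := by simpa using grirr.sub_intCast 1
theorem gr2m : Irrational (2 - gr) := by simpa using grirr.intCast_sub 2
theorem gr3m : Irrational (3 - gr) := by simpa using grirr.intCast_sub 3

/-- the base vector of each state -/
noncomputable def fv : Fin 4 → ℝ := v2 0 3 1 gr

theorem AD_mem (s : Fin 7) {x y : ℝ} (hx : 0 < x) (hy : 0 < y) (h : Irrational (x / y)) :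
    v2 0 3 x y ∈ US s := by
  apply edge_mem _ _ hx hy h <;> revert s <;> decide

theorem M_AD_fix {w l : Fin 4} (hl : l = 1 ∨ l = 2) (x y : ℝ) : M w l (v2 0 3 x y) = v2 0 3 x y := by
  rcases hl with rfl | rfl <;> simp [M, v2]

theorem M_AD_fix2 {w l a b : Fin 4} (ha : l ≠ a) (hb : l ≠ b) (x y : ℝ) : M w l (v2 a b x y) = v2 a b x y := by
  simp [M, v2, ha, hb]

theorem M_v2_w {a b : Fin 4} (hab : a ≠ b) (x y : ℝ) : M a b (v2 a b x y) = v2 a b (x + y) y := by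
  ext i; simp [M, v2, Pi.single_apply, hab, hab.symm]; split_ifs <;> ring

theorem M_v2_w' {a b : Fin 4} (hab : a ≠ b) (x y : ℝ) : M b a (v2 a b x y) = v2 a b x (x + y) := by
  rw [v2_comm, M_v2_w hab.symm, v2_comm, add_comm]

/-- transporting joins along an arrow -/
theorem arrow_join (s : Fin 7) (c : Bool) {v v' : Fin 4 → ℝ} (h : JoinedIn (US (nx s c)) v v') :
    JoinedIn (US s) (M (wn s c) (ls s c) v) (M (wn s c) (ls s c) v') := (step_s s c).join h

/-- transporting joins of `AD` vectors along an arrow with loser `B` or `C` -/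
theorem arrow_AD (s : Fin 7) (c : Bool) (hl : ls s c = 1 ∨ ls s c = 2) {x y x' y' : ℝ}
    (h : JoinedIn (US (nx s c)) (v2 0 3 x y) (v2 0 3 x' y')) :
    JoinedIn (US s) (v2 0 3 x y) (v2 0 3 x' y') := by
  have := arrow_join s c h
  rwa [M_AD_fix hl, M_AD_fix hl] at this

/-- all `AD` joins can be transported from the center to any state -/
theorem AD_from_center (s : Fin 7) {x y x' y' : ℝ}
    (h0 : JoinedIn (US 0) (v2 0 3 x y) (v2 0 3 x' y')) :
    JoinedIn (US s) (v2 0 3 x y) (v2 0 3 x' y') := by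
  have h2 : JoinedIn (US 2) (v2 0 3 x y) (v2 0 3 x' y') := arrow_AD 2 true (by decide) h0
  have h1 : JoinedIn (US 1) (v2 0 3 x y) (v2 0 3 x' y') := arrow_AD 1 true (by decide) h2
  have h3 : JoinedIn (US 3) (v2 0 3 x y) (v2 0 3 x' y') := arrow_AD 3 false (by decide) h1
  have h5 : JoinedIn (US 5) (v2 0 3 x y) (v2 0 3 x' y') := arrow_AD 5 false (by decide) h0
  have h4 : JoinedIn (US 4) (v2 0 3 x y) (v2 0 3 x' y') := arrow_AD 4 false (by decide) h5
  have h6 : JoinedIn (US 6) (v2 0 3 x y) (v2 0 3 x' y') := arrow_AD 6 true (by decide) h4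
  fin_cases s <;> assumption

theorem chain1 : JoinedIn (US 0) (v2 0 3 1 gr) (v2 0 3 1 (1 + gr)) := by
  have g1 := gr1
  have a1 : JoinedIn (US 0) (v2 2 3 1 (gr - 1)) (v2 0 3 1 (1 + (gr - 1))) :=
    flip_bc (by decide) (by decide) (by decide) (by decide) one_pos (by linarith) (by
      simpa using grm.inv)
  have a2 : JoinedIn (US 0) (v2 2 3 1 (gr - 1)) (v2 1 3 1 (1 + (gr - 1))) :=
    flip_bc (by decide) (by decide) (by decide) (by decide) one_pos (by linarith) (by
      simpa using grm.inv)
  have a3 : JoinedIn (US 0) (v2 1 3 1 gr) (v2 0 3 1 (1 + gr)) :=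
    flip_bc (by decide) (by decide) (by decide) (by decide) one_pos (by linarith) (by
      simpa using grirr.inv)
  rw [add_sub_cancel] at a1 a2
  exact (a1.symm.trans a2).trans a3

theorem chain2a : JoinedIn (US 0) (v2 0 3 gr 1) (v2 0 3 1 (3 - gr)) := by
  have g1 := gr1
  have g2 := gr2
  have i1 : Irrational ((gr - 1) / 1) := by simpa using grm
  have i2 : Irrational ((gr - 1) / (2 - gr)) := by
    have h := irr_inv (irr_a one_pos (x := gr - 1) (y := 1) i1)
    have : (gr - 1) / (2 - gr) = gr := by
      rw [div_eq_iff (by linarith)]; linarith [grsq]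
    rw [this]; exact grirr
  have a1 : JoinedIn (US 0) (v2 0 2 (gr - 1) 1) (v2 0 3 (gr - 1 + 1) 1) :=
    flip_ab (by decide) (by decide) (by decide) (by decide) (by linarith) one_pos i1
  have a2 : JoinedIn (US 0) (v2 1 2 (gr - 1) (2 - gr)) (v2 0 2 (gr - 1) (gr - 1 + (2 - gr))) :=
    flip_bc (by decide) (by decide) (by decide) (by decide) (by linarith) (by linarith) i2
  have a3 : JoinedIn (US 0) (v2 1 2 (gr - 1) (2 - gr)) (v2 1 3 (gr - 1 + (2 - gr)) (2 - gr)) :=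
    flip_ab (by decide) (by decide) (by decide) (by decide) (by linarith) (by linarith) i2
  have a4 : JoinedIn (US 0) (v2 1 3 1 (2 - gr)) (v2 0 3 1 (1 + (2 - gr))) :=
    flip_bc (by decide) (by decide) (by decide) (by decide) (by linarith) (by linarith)
      (by simpa using gr2m.inv)
  rw [show gr - 1 + 1 = gr by ring] at a1
  rw [show gr - 1 + (2 - gr) = 1 by ring] at a2 a3
  rw [show 1 + (2 - gr) = 3 - gr by ring] at a4
  exact ((a1.symm.trans a2.symm).trans a3).trans a4

theorem t2_AC {x z : ℝ} (hx : 0 < x) (hz : 0 < z) (h : Irrational (x / z)) :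
    JoinedIn (US 2) (v2 0 3 x z) (v2 2 3 x z) :=
  merge_v2 (by decide) (by decide) (by decide) (by decide) hx hz h

theorem t2_shift : JoinedIn (US 2) (v2 2 3 1 (gr - 1)) (v2 2 3 1 gr) := by
  have g1 := gr1
  have i1 : Irrational (1 / (gr - 1)) := by simpa using grm.inv
  have a1 : JoinedIn (US 2) (v2 1 3 1 (gr - 1)) (v2 2 3 1 (gr - 1)) :=
    merge_v2 (by decide) (by decide) (by decide) (by decide) one_pos (by linarith) i1
  have a2 : JoinedIn (US 2) (v2 1 3 1 (gr - 1)) (v2 0 3 1 (1 + (gr - 1))) :=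
    flip_bc (by decide) (by decide) (by decide) (by decide) one_pos (by linarith) i1
  rw [add_sub_cancel] at a2
  exact (a1.symm.trans a2).trans (t2_AC one_pos (by linarith) (by simpa using grirr.inv))

theorem chain2 : JoinedIn (US 0) (v2 0 3 gr 1) (v2 0 3 1 gr) := by
  have g1 := gr1
  have g2 := gr2
  have hs := grsq
  -- in state 2
  have b1 := t2_AC one_pos (z := 2 - gr) (by linarith) (by simpa using gr2m.inv)
  have b2 := arrow_join 2 false (join_map_smul t2_shift (c := gr - 1) (by linarith))
  simp only [v2_smul] at b2
  rw [show wn 2 false = 2 from rfl, show ls 2 false = 3 from rfl, M_v2_w (by decide), M_v2_w (by decide)] at b2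
  have b3 := (t2_AC one_pos (z := gr - 1) (by linarith) (by simpa using grm.inv))
  have b4 := join_smul b3.target_mem (c := gr) (by linarith)
  rw [v2_smul] at b4
  rw [show (gr - 1) * 1 + (gr - 1) * (gr - 1) = 1 by linarith, show (gr - 1) * (gr - 1) = 2 - gr by linarith,
    show (gr - 1) * gr = 1 by linarith, show (gr - 1) * 1 + 1 = gr by ring] at b2
  rw [show gr * (gr - 1) = 1 by linarith, mul_one] at b4
  have b5 := ((b1.trans b2).trans b4.symm).trans b3.symm
  have b6 := arrow_join 0 true (arrow_AD 1 true (by decide) b5)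
  rw [show wn 0 true = 3 from rfl, show ls 0 true = 0 from rfl, M_v2_w' (by decide), M_v2_w' (by decide)] at b6
  rw [show 1 + (2 - gr) = 3 - gr by ring, add_sub_cancel] at b6
  exact chain2a.trans b6

theorem f_big (s : Fin 7) : JoinedIn (US s) fv (v2 0 3 1 (1 + gr)) := AD_from_center s chain1

theorem f_small (s : Fin 7) : JoinedIn (US s) fv (v2 0 3 (1 + gr) gr) := by
  have h := AD_from_center s chain2
  have h2 := join_smul h.source_mem (c := gr) (by linarith [gr1])
  rw [v2_smul, mul_one, grsq, add_comm] at h2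
  exact h.symm.trans h2

theorem arrow_f (s : Fin 7) (c : Bool) : JoinedIn (US s) fv (M (wn s c) (ls s c) fv) := by
  have g1 := gr1
  have triv : (ls s c = 1 ∨ ls s c = 2) → JoinedIn (US s) fv (M (wn s c) (ls s c) fv) := by
    intro h
    rw [fv, M_AD_fix h]
    exact JoinedIn.refl (AD_mem s one_pos (by linarith) (by simpa using grirr.inv))
  by_cases h : ls s c = 1 ∨ ls s c = 2
  · exact triv h
  have iS : Irrational ((1 + gr) / gr) := by
    have := irr_a (x := 1) (y := gr) (by linarith) (by simpa using grirr.inv); exact this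
  have iB : Irrational ((1 + gr) / 1) := by simpa using grirr.intCast_add 1
  clear triv
  fin_cases s <;> cases c <;> first | (exfalso; revert h; decide) | skip
  -- center b
  · rw [show ls (⟨0, by decide⟩ : Fin 7) false = 3 from rfl, show wn (⟨0, by decide⟩ : Fin 7) false = 0 from rfl]
    rw [show M 0 3 fv = v2 0 3 (1 + gr) gr from M_v2_w (by decide) _ _]
    exact f_small 0
  · rw [show ls (⟨0, by decide⟩ : Fin 7) true = 0 from rfl, show wn (⟨0, by decide⟩ : Fin 7) true = 3 from rfl]
    rw [show M 3 0 fv = v2 0 3 1 (1 + gr) from M_v2_w' (by decide) _ _]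
    exact f_big 0
  · have e : M (wn 1 false) (ls 1 false) fv = v3 0 1 3 1 gr gr := by
      ext i; fin_cases i <;> simp [M, wn, ls, lt, lb, fv, v2, v3, Pi.single_apply]
    refine JoinedIn.trans (f_small 1) ?_
    rw [show M (wn (⟨1, by decide⟩ : Fin 7) false) (ls (⟨1, by decide⟩ : Fin 7) false) fv = v3 0 1 3 1 gr gr from e]
    exact (merge_v3 (by decide) (by decide) (by decide) (by decide) zero_le_one (by linarith) (by linarith)
      (by linarith) iS).symm
  · have e : M (wn 2 false) (ls 2 false) fv = v3 0 2 3 1 gr gr := by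
      ext i; fin_cases i <;> simp [M, wn, ls, lt, lb, fv, v2, v3, Pi.single_apply]
    refine JoinedIn.trans (f_small 2) ?_
    rw [show M (wn (⟨2, by decide⟩ : Fin 7) false) (ls (⟨2, by decide⟩ : Fin 7) false) fv = v3 0 2 3 1 gr gr from e]
    exact (merge_v3 (by decide) (by decide) (by decide) (by decide) zero_le_one (by linarith) (by linarith)
      (by linarith) iS).symm
  · have e : M (wn 4 true) (ls 4 true) fv = v3 3 2 0 gr 1 1 := by
      ext i; fin_cases i <;> simp [M, wn, ls, lt, lb, fv, v2, v3, Pi.single_apply]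
    refine JoinedIn.trans (f_big 4) ?_
    rw [show M (wn (⟨4, by decide⟩ : Fin 7) true) (ls (⟨4, by decide⟩ : Fin 7) true) fv = v3 3 2 0 gr 1 1 from e]
    rw [v2_comm, US, U_swap, add_comm]
    exact (merge_v3 (by decide) (by decide) (by decide) (by decide) (by linarith) zero_le_one (by linarith)
      (by linarith) (by rwa [add_comm])).symm
  · have e : M (wn 5 true) (ls 5 true) fv = v3 3 1 0 gr 1 1 := by
      ext i; fin_cases i <;> simp [M, wn, ls, lt, lb, fv, v2, v3, Pi.single_apply]
    refine JoinedIn.trans (f_big 5) ?_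
    rw [show M (wn (⟨5, by decide⟩ : Fin 7) true) (ls (⟨5, by decide⟩ : Fin 7) true) fv = v3 3 1 0 gr 1 1 from e]
    rw [v2_comm, US, U_swap, add_comm]
    exact (merge_v3 (by decide) (by decide) (by decide) (by decide) (by linarith) zero_le_one (by linarith)
      (by linarith) (by rwa [add_comm])).symm
end IET

set_option linter.unusedSectionVars false
set_option linter.unusedSimpArgs false
set_option linter.unusedVariables false
set_option linter.style.longLine false
namespace IET
open Set Filter Topology
section edges
variable {ι : Type*} [Fintype ι] [DecidableEq ι]

/-- `v` is joined to an irrational vector on the edge `a b`. -/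
def GE (τ β : ι → ℕ) (v : ι → ℝ) (a b : ι) : Prop :=
  ∃ x y : ℝ, 0 < x ∧ 0 < y ∧ Irrational (x / y) ∧ JoinedIn (U τ β) v (v2 a b x y)

variable {τ β : ι → ℕ} {v : ι → ℝ} {a b c : ι}

theorem GE.comm (h : GE τ β v a b) : GE τ β v b a := by
  obtain ⟨x, y, hx, hy, hi, hj⟩ := h
  exact ⟨y, x, hy, hx, irr_inv hi, by rwa [v2_comm]⟩

theorem GE.swap (h : GE τ β v a b) : GE β τ v a b := by
  obtain ⟨x, y, hx, hy, hi, hj⟩ := h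
  exact ⟨x, y, hx, hy, hi, by rwa [U_swap]⟩

theorem GE.merge_ab (h : GE τ β v a c) (h1 : τ a < τ b) (h2 : τ b < τ c) (h3 : β c < β a)
    (h4 : β a < β b) : GE τ β v b c := by
  obtain ⟨x, y, hx, hy, hi, hj⟩ := h
  exact ⟨x, y, hx, hy, hi, hj.trans (merge_v2 h1 h2 h3 h4 hx hy hi)⟩

theorem GE.merge_ba (h : GE τ β v b c) (h1 : τ a < τ b) (h2 : τ b < τ c) (h3 : β c < β a)
    (h4 : β a < β b) : GE τ β v a c := by
  obtain ⟨x, y, hx, hy, hi, hj⟩ := h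
  exact ⟨x, y, hx, hy, hi, hj.trans (merge_v2 h1 h2 h3 h4 hx hy hi).symm⟩

theorem GE.flip_bc (h : GE τ β v b c) (h1 : τ a < τ b) (h2 : τ b < τ c) (h3 : β c < β b)
    (h4 : β b < β a) : GE τ β v a c := by
  obtain ⟨x, y, hx, hy, hi, hj⟩ := h
  exact ⟨x, x + y, hx, by linarith, irr_b hx hi, hj.trans (IET.flip_bc h1 h2 h3 h4 hx hy hi)⟩

theorem GE.flip_ab (h : GE τ β v a b) (h1 : τ a < τ b) (h2 : τ b < τ c) (h3 : β c < β b)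
    (h4 : β b < β a) : GE τ β v a c := by
  obtain ⟨x, y, hx, hy, hi, hj⟩ := h
  exact ⟨x + y, y, by linarith, hy, irr_a hy hi, hj.trans (IET.flip_ab h1 h2 h3 h4 hx hy hi)⟩

theorem GE.of_merge (hv : v ∈ U τ β) (e : v = v3 a b c (v a) (v b) (v c)) (h1 : τ a < τ b)
    (h2 : τ b < τ c) (h3 : β c < β a) (h4 : β a < β b) : GE τ β v a c := by
  have hv' := hv
  rw [e] at hv'
  obtain ⟨p1, p2, p3⟩ := merge_irr h1 h2 h3 h4 (hv.1 a) (hv.1 b) (hv.1 c) hv'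
  refine ⟨v a + v b, v c, p1, p2, p3, ?_⟩
  have := merge_v3 h1 h2 h3 h4 (hv.1 a) (hv.1 b) p1 p2 p3
  rwa [← e] at this

theorem GE.of_flip (hv : v ∈ U τ β) (e : v = v3 a b c (v a) (v b) (v c)) (h1 : τ a < τ b)
    (h2 : τ b < τ c) (h3 : β c < β b) (h4 : β b < β a) : GE τ β v a c := by
  have hv' := hv
  rw [e] at hv'
  obtain ⟨p1, p2, p3⟩ := flip_irr h1 h2 h3 h4 (hv.1 a) (hv.1 b) (hv.1 c) hv'
  refine ⟨v a + v b, v b + v c, p1, p2, p3, ?_⟩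
  have := flip_v3 h1 h2 h3 h4 (hv.1 a) (hv.1 b) (hv.1 c) p1 p2 p3
  rwa [← e] at this

theorem red_first' (hv : v ∈ U τ β) (e : v = v3 a b c (v a) (v b) (v c)) (h1 : τ a < τ b)
    (h2 : τ b < τ c) (h3 : β a < β c) (h4 : β c < β b) : v a = 0 := by
  have hv' := hv
  rw [e] at hv'
  exact red_first h1 h2 h3 h4 (hv.1 a) (hv.1 b) (hv.1 c) hv'

theorem red_last' (hv : v ∈ U τ β) (e : v = v3 a b c (v a) (v b) (v c)) (h1 : τ a < τ b)
    (h2 : τ b < τ c) (h3 : β b < β a) (h4 : β a < β c) : v c = 0 := by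
  have hv' := hv
  rw [e] at hv'
  exact red_last h1 h2 h3 h4 (hv.1 a) (hv.1 b) (hv.1 c) hv'

end edges

theorem eq_v3 {v : Fin 4 → ℝ} (a b c d : Fin 4) (hd : v d = 0)
    (h : a ≠ b ∧ a ≠ c ∧ b ≠ c ∧ d ≠ a ∧ d ≠ b ∧ d ≠ c) : v = v3 a b c (v a) (v b) (v c) := by
  obtain ⟨h1, h2, h3, h4, h5, h6⟩ := h
  have hi : ∀ i : Fin 4, i = a ∨ i = b ∨ i = c ∨ i = d := by
    clear hd; omega
  ext i
  rcases hi i with rfl | rfl | rfl | rfl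
  · simp [v3, h1, h2]
  · simp [v3, h1, h1.symm, h3]
  · simp [v3, h2.symm, h3.symm]
  · simp [v3, hd, h4, h5, h6]

theorem zero_AD (s : Fin 7) {v : Fin 4 → ℝ} (hv : v ∈ US s) (hz : ∃ i, v i = 0) :
    GE (tp s) (bp s) v 0 3 := by
  have hv' : v ∈ U (bp s) (tp s) := by rw [U_swap]; exact hv
  have hz' : v 0 = 0 ∨ v 1 = 0 ∨ v 2 = 0 ∨ v 3 = 0 := by
    obtain ⟨i, hi⟩ := hz; fin_cases i <;> simp_all
  have e0 := fun (h : v 0 = 0) (a b c : Fin 4) => eq_v3 a b c 0 h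
  have e1 := fun (h : v 1 = 0) (a b c : Fin 4) => eq_v3 a b c 1 h
  have e2 := fun (h : v 2 = 0) (a b c : Fin 4) => eq_v3 a b c 2 h
  have e3 := fun (h : v 3 = 0) (a b c : Fin 4) => eq_v3 a b c 3 h
  clear hz
  fin_cases s
  · rcases hz' with h | h | h | h
    · exact GE.flip_bc (a := 0) (b := 1) (c := 3) (GE.of_flip hv (e0 h 1 2 3 (by decide)) (by decide) (by decide) (by decide) (by decide))
        (by decide) (by decide) (by decide) (by decide)
    · exact GE.of_flip hv (e1 h 0 2 3 (by decide)) (by decide) (by decide) (by decide) (by decide)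
    · exact GE.of_flip hv (e2 h 0 1 3 (by decide)) (by decide) (by decide) (by decide) (by decide)
    · exact GE.flip_ab (a := 0) (b := 2) (c := 3) (GE.of_flip hv (e3 h 0 1 2 (by decide)) (by decide) (by decide) (by decide) (by decide))
        (by decide) (by decide) (by decide) (by decide)
  · have cA : v 0 = 0 → GE (tp 1) (bp 1) v 0 3 := fun h =>
      GE.merge_ba (a := 0) (b := 1) (c := 3) (GE.of_flip hv (e0 h 1 2 3 (by decide)) (by decide) (by decide) (by decide) (by decide))
        (by decide) (by decide) (by decide) (by decide)
    rcases hz' with h | h | h | h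
    · exact cA h
    · exact GE.of_merge hv (e1 h 0 2 3 (by decide)) (by decide) (by decide) (by decide) (by decide)
    · exact GE.of_merge hv (e2 h 0 1 3 (by decide)) (by decide) (by decide) (by decide) (by decide)
    · exact cA (red_first' hv (e3 h 0 1 2 (by decide)) (by decide) (by decide) (by decide) (by decide))
  · have cC : v 2 = 0 → GE (tp 2) (bp 2) v 0 3 := fun h =>
      GE.of_flip hv (e2 h 0 1 3 (by decide)) (by decide) (by decide) (by decide) (by decide)
    rcases hz' with h | h | h | h
    · exact GE.flip_bc (a := 0) (b := 1) (c := 3) (GE.of_merge hv (e0 h 1 2 3 (by decide)) (by decide) (by decide) (by decide) (by decide))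
        (by decide) (by decide) (by decide) (by decide)
    · exact GE.of_merge hv (e1 h 0 2 3 (by decide)) (by decide) (by decide) (by decide) (by decide)
    · exact cC h
    · exact cC (red_last' hv (e3 h 0 1 2 (by decide)) (by decide) (by decide) (by decide) (by decide))
  · have cA : v 0 = 0 → GE (tp 3) (bp 3) v 0 3 := fun h =>
      GE.merge_ba (a := 0) (b := 1) (c := 3) (GE.of_merge hv' (e0 h 3 2 1 (by decide)) (by decide) (by decide) (by decide) (by decide)).swap.comm
        (by decide) (by decide) (by decide) (by decide)
    have cC : v 2 = 0 → GE (tp 3) (bp 3) v 0 3 := fun h =>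
      GE.of_merge hv (e2 h 0 1 3 (by decide)) (by decide) (by decide) (by decide) (by decide)
    rcases hz' with h | h | h | h
    · exact cA h
    · exact cC (red_last' hv (e1 h 0 3 2 (by decide)) (by decide) (by decide) (by decide) (by decide))
    · exact cC h
    · exact cA (red_first' hv (e3 h 0 1 2 (by decide)) (by decide) (by decide) (by decide) (by decide))
  · have cD : v 3 = 0 → GE (bp 4) (tp 4) v 3 0 := fun h =>
      GE.merge_ba (a := 3) (b := 2) (c := 0) (GE.of_flip hv' (e3 h 2 1 0 (by decide)) (by decide) (by decide) (by decide) (by decide))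
        (by decide) (by decide) (by decide) (by decide)
    refine GE.comm (GE.swap ?_)
    rcases hz' with h | h | h | h
    · exact cD (red_first' hv' (e0 h 3 2 1 (by decide)) (by decide) (by decide) (by decide) (by decide))
    · exact GE.of_merge hv' (e1 h 3 2 0 (by decide)) (by decide) (by decide) (by decide) (by decide)
    · exact GE.of_merge hv' (e2 h 3 1 0 (by decide)) (by decide) (by decide) (by decide) (by decide)
    · exact cD h
  · have cB : v 1 = 0 → GE (bp 5) (tp 5) v 3 0 := fun h =>
      GE.of_flip hv' (e1 h 3 2 0 (by decide)) (by decide) (by decide) (by decide) (by decide)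
    refine GE.comm (GE.swap ?_)
    rcases hz' with h | h | h | h
    · exact cB (red_last' hv' (e0 h 3 2 1 (by decide)) (by decide) (by decide) (by decide) (by decide))
    · exact cB h
    · exact GE.of_merge hv' (e2 h 3 1 0 (by decide)) (by decide) (by decide) (by decide) (by decide)
    · exact GE.flip_bc (a := 3) (b := 2) (c := 0) (GE.of_merge hv' (e3 h 2 1 0 (by decide)) (by decide) (by decide) (by decide) (by decide))
        (by decide) (by decide) (by decide) (by decide)
  · have cD : v 3 = 0 → GE (bp 6) (tp 6) v 3 0 := fun h =>
      GE.merge_ba (a := 3) (b := 2) (c := 0) (GE.of_merge hv (e3 h 0 1 2 (by decide)) (by decide) (by decide) (by decide) (by decide)).swap.comm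
        (by decide) (by decide) (by decide) (by decide)
    have cB : v 1 = 0 → GE (bp 6) (tp 6) v 3 0 := fun h =>
      GE.of_merge hv' (e1 h 3 2 0 (by decide)) (by decide) (by decide) (by decide) (by decide)
    refine GE.comm (GE.swap ?_)
    rcases hz' with h | h | h | h
    · exact cD (red_first' hv' (e0 h 3 2 1 (by decide)) (by decide) (by decide) (by decide) (by decide))
    · exact cB h
    · exact cB (red_last' hv' (e2 h 3 0 1 (by decide)) (by decide) (by decide) (by decide) (by decide))
    · exact cD h
end IET

set_option linter.unusedSectionVars false
set_option linter.unusedSimpArgs false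
set_option linter.unusedVariables false
set_option linter.style.longLine false
namespace IET
open Set Filter Topology

/-- An infinite Rauzy induction orbit. -/
structure Orbit (s : ℕ → Fin 7) (c : ℕ → Bool) (lam : ℕ → Fin 4 → ℝ) : Prop where
  next : ∀ n, s (n + 1) = nx (s n) (c n)
  dec : ∀ n, lam n = M (wn (s n) (c n)) (ls (s n) (c n)) (lam (n + 1))
  nonneg : ∀ n i, 0 ≤ lam n i

theorem exists_orbit (s₀ : Fin 7) (v : Fin 4 → ℝ) (hv : ∀ i, 0 ≤ v i) :
    ∃ s c lam, Orbit s c lam ∧ s 0 = s₀ ∧ lam 0 = v := by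
  classical
  let ch : Fin 7 × (Fin 4 → ℝ) → Bool := fun p => decide (p.2 (lb p.1) ≤ p.2 (lt p.1))
  let g : Fin 7 × (Fin 4 → ℝ) → Fin 7 × (Fin 4 → ℝ) := fun p =>
    (nx p.1 (ch p), p.2 - Pi.single (wn p.1 (ch p)) (p.2 (ls p.1 (ch p))))
  let o : ℕ → Fin 7 × (Fin 4 → ℝ) := fun n => g^[n] (s₀, v)
  have ho : ∀ n, o (n + 1) = g (o n) := fun n => Function.iterate_succ_apply' g n _
  have hne : ∀ s c, wn s c ≠ ls s c := fun s c => (step_s s c).ne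
  refine ⟨fun n => (o n).1, fun n => ch (o n), fun n => (o n).2, ⟨?_, ?_, ?_⟩, rfl, rfl⟩
  · intro n; simp only [ho]; rfl
  · intro n
    simp only [ho]
    change (o n).2 = M (wn (o n).1 (ch (o n))) (ls (o n).1 (ch (o n))) ((o n).2 - Pi.single (wn (o n).1 (ch (o n))) ((o n).2 (ls (o n).1 (ch (o n)))))
    have := hne (o n).1 (ch (o n))
    ext i
    simp [M, Pi.single_apply, this.symm]
  · intro n
    induction n with
    | zero => exact hv
    | succ n ih =>
      intro i
      simp only [ho]
      change 0 ≤ ((o n).2 - (Pi.single (wn (o n).1 (ch (o n))) ((o n).2 (ls (o n).1 (ch (o n)))) : Fin 4 → ℝ)) i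
      simp only [Pi.sub_apply, Pi.single_apply]
      split_ifs with hi
      · subst hi
        by_cases hc : (o n).2 (lb (o n).1) ≤ (o n).2 (lt (o n).1)
        · have : ch (o n) = true := decide_eq_true hc
          rw [this]; simp only [wn, ls]; linarith
        · have : ch (o n) = false := decide_eq_false hc
          rw [this]; simp only [wn, ls]; linarith
      · simpa using ih i

namespace Orbit
variable {s : ℕ → Fin 7} {c : ℕ → Bool} {lam : ℕ → Fin 4 → ℝ}

theorem hne (o : Orbit s c lam) (n : ℕ) : wn (s n) (c n) ≠ ls (s n) (c n) := (step_s _ _).ne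

theorem lam_w (o : Orbit s c lam) (n : ℕ) :
    lam n (wn (s n) (c n)) = lam (n + 1) (wn (s n) (c n)) + lam n (ls (s n) (c n)) := by
  conv_lhs => rw [o.dec n]
  conv_rhs => rw [o.dec n]
  rw [M_w, M_ne (o.hne n).symm]

theorem lam_ne (o : Orbit s c lam) (n : ℕ) {k : Fin 4} (hk : k ≠ wn (s n) (c n)) :
    lam n k = lam (n + 1) k := by
  conv_lhs => rw [o.dec n]
  rw [M_ne hk]

theorem tot_succ (o : Orbit s c lam) (n : ℕ) :
    tot (lam n) = tot (lam (n + 1)) + lam n (ls (s n) (c n)) := by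
  conv_lhs => rw [o.dec n]
  rw [tot_M, o.lam_ne n (o.hne n).symm]

theorem loser_tendsto (o : Orbit s c lam) :
    Tendsto (fun n => lam n (ls (s n) (c n))) atTop (𝓝 0) := by
  have hanti : Antitone fun n => tot (lam n) := antitone_nat_of_succ_le fun n => by
    have := o.tot_succ n; have := o.nonneg n (ls (s n) (c n)); linarith
  have hbdd : BddBelow (range fun n => tot (lam n)) :=
    ⟨0, by rintro _ ⟨n, rfl⟩; exact tot_nonneg (o.nonneg n)⟩
  have h1 := tendsto_atTop_ciInf hanti hbdd
  have h2 := h1.comp (tendsto_add_atTop_nat 1)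
  have h3 := h1.sub h2
  rw [sub_self] at h3
  refine h3.congr fun n => ?_
  have := o.tot_succ n
  simp only [Function.comp]; linarith

/-- A letter that stops winning eventually stops losing. -/
theorem stop_lose (o : Orbit s c lam) {X : Fin 4} {N : ℕ} (hw : ∀ n ≥ N, wn (s n) (c n) ≠ X)
    (hpos : 0 < lam N X) : ∀ᶠ n in atTop, ls (s n) (c n) ≠ X := by
  have hconst : ∀ n ≥ N, lam n X = lam N X := by
    intro n hn
    induction n, hn using Nat.le_induction with
    | base => rfl
    | succ n hn ih => rw [← ih, o.lam_ne n (hw n hn).symm]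
  filter_upwards [o.loser_tendsto.eventually (gt_mem_nhds hpos), eventually_ge_atTop N] with n h1 h2 h3
  rw [h3, hconst n h2] at h1
  exact lt_irrefl _ h1

theorem stay (o : Orbit s c lam) (S : Fin 7 → Prop) {N : ℕ} (h : S (s N))
    (hstep : ∀ n ≥ N, S (s n) → S (nx (s n) (c n))) : ∀ n ≥ N, S (s n) := by
  intro n hn
  induction n, hn using Nat.le_induction with
  | base => exact h
  | succ n hn ih => rw [o.next]; exact hstep n hn ih

theorem not_t (o : Orbit s c lam) (hD : ∀ n, 0 < lam n 3) (hB : ∀ n, s n = 3 → 0 < lam n 1) {N : ℕ}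
    (h0 : ∀ n ≥ N, s n ≠ 0) (hs : s N = 1 ∨ s N = 2 ∨ s N = 3) : False := by
  have hside := o.stay (fun x => x = 1 ∨ x = 2 ∨ x = 3) hs (fun n hn h => by
    have := h0 (n + 1) (by omega)
    rw [o.next] at this
    revert h this
    generalize s n = x; generalize c n = y
    revert x y; decide)
  by_cases h2 : ∃ m ≥ N, s m = 2
  · obtain ⟨m, hm, hm2⟩ := h2
    have hst : ∀ n ≥ m, s n = 2 := o.stay (fun x => x = 2) hm2 (fun n hn h => by
      have := h0 (n + 1) (by omega)
      rw [o.next] at this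
      revert h this
      generalize s n = x; generalize c n = y
      revert x y; decide)
    have hcf : ∀ n ≥ m, c n = false := fun n hn => by
      have := h0 (n + 1) (by omega)
      rw [o.next, hst n hn] at this
      revert this
      generalize c n = y; revert y; decide
    have := o.stop_lose (X := 3) (N := m) (fun n hn => by rw [hst n hn, hcf n hn]; decide) (hD m)
    obtain ⟨n, hn, hn'⟩ := (this.and (eventually_ge_atTop m)).exists
    rw [hst n hn', hcf n hn'] at hn
    exact hn (by decide)
  · push Not at h2
    have hcf : ∀ n ≥ N, s n = 1 → c n = false := fun n hn h => by
      have := h2 (n + 1) (by omega)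
      rw [o.next, h] at this
      revert this
      generalize c n = y; revert y; decide
    have := o.stop_lose (X := 3) (N := N) (fun n hn => by
      rcases hside n hn with h | h | h
      · rw [h, hcf n hn h]; decide
      · exact absurd h (h2 n hn)
      · rw [h]; generalize c n = y; revert y; decide) (hD N)
    obtain ⟨m, hm⟩ := (this.and (eventually_ge_atTop N)).exists_forall_of_atTop
    have h3 : ∀ n ≥ m, s n = 3 := fun n hn => by
      obtain ⟨ha, hb⟩ := hm n hn
      rcases hside n hb with h | h | h
      · rw [h, hcf n hb h] at ha; exact absurd rfl ha
      · exact absurd h (h2 n hb)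
      · exact h
    have hct : ∀ n ≥ m, c n = true := fun n hn => by
      have := h3 (n + 1) (by omega)
      rw [o.next, h3 n hn] at this
      revert this
      generalize c n = y; revert y; decide
    have := o.stop_lose (X := 1) (N := m) (fun n hn => by rw [h3 n hn, hct n hn]; decide) (hB m (h3 m le_rfl))
    obtain ⟨n, hn, hn'⟩ := (this.and (eventually_ge_atTop m)).exists
    rw [h3 n hn', hct n hn'] at hn
    exact hn (by decide)

theorem not_b (o : Orbit s c lam) (hA : ∀ n, 0 < lam n 0) (hC : ∀ n, s n = 6 → 0 < lam n 2) {N : ℕ}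
    (h0 : ∀ n ≥ N, s n ≠ 0) (hs : s N = 4 ∨ s N = 5 ∨ s N = 6) : False := by
  have hside := o.stay (fun x => x = 4 ∨ x = 5 ∨ x = 6) hs (fun n hn h => by
    have := h0 (n + 1) (by omega)
    rw [o.next] at this
    revert h this
    generalize s n = x; generalize c n = y
    revert x y; decide)
  by_cases h2 : ∃ m ≥ N, s m = 5
  · obtain ⟨m, hm, hm2⟩ := h2
    have hst : ∀ n ≥ m, s n = 5 := o.stay (fun x => x = 5) hm2 (fun n hn h => by
      have := h0 (n + 1) (by omega)
      rw [o.next] at this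
      revert h this
      generalize s n = x; generalize c n = y
      revert x y; decide)
    have hcf : ∀ n ≥ m, c n = true := fun n hn => by
      have := h0 (n + 1) (by omega)
      rw [o.next, hst n hn] at this
      revert this
      generalize c n = y; revert y; decide
    have := o.stop_lose (X := 0) (N := m) (fun n hn => by rw [hst n hn, hcf n hn]; decide) (hA m)
    obtain ⟨n, hn, hn'⟩ := (this.and (eventually_ge_atTop m)).exists
    rw [hst n hn', hcf n hn'] at hn
    exact hn (by decide)
  · push Not at h2
    have hcf : ∀ n ≥ N, s n = 4 → c n = true := fun n hn h => by
      have := h2 (n + 1) (by omega)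
      rw [o.next, h] at this
      revert this
      generalize c n = y; revert y; decide
    have := o.stop_lose (X := 0) (N := N) (fun n hn => by
      rcases hside n hn with h | h | h
      · rw [h, hcf n hn h]; decide
      · exact absurd h (h2 n hn)
      · rw [h]; generalize c n = y; revert y; decide) (hA N)
    obtain ⟨m, hm⟩ := (this.and (eventually_ge_atTop N)).exists_forall_of_atTop
    have h3 : ∀ n ≥ m, s n = 6 := fun n hn => by
      obtain ⟨ha, hb⟩ := hm n hn
      rcases hside n hb with h | h | h
      · rw [h, hcf n hb h] at ha; exact absurd rfl ha
      · exact absurd h (h2 n hb)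
      · exact h
    have hct : ∀ n ≥ m, c n = false := fun n hn => by
      have := h3 (n + 1) (by omega)
      rw [o.next, h3 n hn] at this
      revert this
      generalize c n = y; revert y; decide
    have := o.stop_lose (X := 2) (N := m) (fun n hn => by rw [h3 n hn, hct n hn]; decide) (hC m (h3 m le_rfl))
    obtain ⟨n, hn, hn'⟩ := (this.and (eventually_ge_atTop m)).exists
    rw [h3 n hn', hct n hn'] at hn
    exact hn (by decide)

/-- Every letter loses infinitely often. -/
theorem loses (o : Orbit s c lam) (hA : ∀ n, 0 < lam n 0) (hD : ∀ n, 0 < lam n 3)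
    (hB : ∀ n, s n = 3 → 0 < lam n 1) (hC : ∀ n, s n = 6 → 0 < lam n 2) :
    ∀ (X : Fin 4) (N : ℕ), ∃ n ≥ N, ls (s n) (c n) = X := by
  have c1 : ∀ N, ∃ n ≥ N, s n = 0 := by
    intro N
    by_contra hcon
    push Not at hcon
    have : s N = 0 ∨ (s N = 1 ∨ s N = 2 ∨ s N = 3) ∨ (s N = 4 ∨ s N = 5 ∨ s N = 6) := by
      generalize s N = x; revert x; decide
    rcases this with h | h | h
    · exact hcon N le_rfl h
    · exact o.not_t hD hB hcon h
    · exact o.not_b hA hC hcon h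
  have c2t : ∀ N, ∃ n ≥ N, s n = 0 ∧ c n = true := by
    intro N
    by_contra hcon
    push Not at hcon
    obtain ⟨m, hm, hm0⟩ := c1 N
    have hst := o.stay (fun x => x = 0 ∨ x = 4 ∨ x = 5 ∨ x = 6) (Or.inl hm0) (fun n hn h => by
      have := hcon n (by omega)
      revert h this
      generalize s n = x; generalize c n = y
      revert x y; decide)
    have := o.stop_lose (X := 3) (N := m) (fun n hn => by
      have h1 := hst n hn
      have h2 := hcon n (by omega)
      revert h1 h2
      generalize s n = x; generalize c n = y
      revert x y; decide) (hD m)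
    obtain ⟨k, hk⟩ := this.exists_forall_of_atTop
    obtain ⟨n, hn, hn0⟩ := c1 (max k m)
    have h1 := hk n (le_trans (le_max_left _ _) hn)
    have h2 := hcon n (le_trans hm (le_trans (le_max_right _ _) hn)) hn0
    rw [hn0] at h1
    revert h1 h2
    generalize c n = y; revert y; decide
  have c2b : ∀ N, ∃ n ≥ N, s n = 0 ∧ c n = false := by
    intro N
    by_contra hcon
    push Not at hcon
    obtain ⟨m, hm, hm0⟩ := c1 N
    have hst := o.stay (fun x => x = 0 ∨ x = 1 ∨ x = 2 ∨ x = 3) (Or.inl hm0) (fun n hn h => by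
      have := hcon n (by omega)
      revert h this
      generalize s n = x; generalize c n = y
      revert x y; decide)
    have := o.stop_lose (X := 0) (N := m) (fun n hn => by
      have h1 := hst n hn
      have h2 := hcon n (by omega)
      revert h1 h2
      generalize s n = x; generalize c n = y
      revert x y; decide) (hA m)
    obtain ⟨k, hk⟩ := this.exists_forall_of_atTop
    obtain ⟨n, hn, hn0⟩ := c1 (max k m)
    have h1 := hk n (le_trans (le_max_left _ _) hn)
    have h2 := hcon n (le_trans hm (le_trans (le_max_right _ _) hn)) hn0
    rw [hn0] at h1
    revert h1 h2
    generalize c n = y; revert y; decide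
  have c3 : ∀ N, ∃ n ≥ N, s n = 1 ∧ c n = true := by
    intro N
    obtain ⟨m, hm, hm0, hmt⟩ := c2t N
    by_contra hcon
    push Not at hcon
    have hst := o.stay (N := m + 1) (fun x => x = 1 ∨ x = 3) (by rw [o.next, hm0, hmt]; decide) (fun n hn h => by
      have := hcon n (by omega)
      revert h this
      generalize s n = x; generalize c n = y
      revert x y; decide)
    obtain ⟨n, hn, hn0⟩ := c1 (m + 1)
    have := hst n hn
    rw [hn0] at this
    revert this; decide
  have c4 : ∀ N, ∃ n ≥ N, s n = 2 ∧ c n = true := by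
    intro N
    obtain ⟨m, hm, hm0, hmt⟩ := c3 N
    by_contra hcon
    push Not at hcon
    have hst := o.stay (N := m + 1) (fun x => x = 2) (by rw [o.next, hm0, hmt]; decide) (fun n hn h => by
      have := hcon n (by omega)
      revert h this
      generalize s n = x; generalize c n = y
      revert x y; decide)
    obtain ⟨n, hn, hn0⟩ := c1 (m + 1)
    have := hst n hn
    rw [hn0] at this
    revert this; decide
  intro X N
  fin_cases X
  · obtain ⟨n, hn, h1, h2⟩ := c2t N
    exact ⟨n, hn, by rw [h1, h2]; decide⟩
  · obtain ⟨n, hn, h1, h2⟩ := c3 N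
    exact ⟨n, hn, by rw [h1, h2]; decide⟩
  · obtain ⟨n, hn, h1, h2⟩ := c4 N
    exact ⟨n, hn, by rw [h1, h2]; decide⟩
  · obtain ⟨n, hn, h1, h2⟩ := c2b N
    exact ⟨n, hn, by rw [h1, h2]; decide⟩

end Orbit
end IET

set_option linter.unusedSectionVars false
set_option linter.unusedSimpArgs false
set_option linter.unusedVariables false
set_option linter.style.longLine false
namespace IET
open Set Filter Topology

/-- Limits of almost invariant distribution functions. -/
theorem limit_lin {ι : Type*} [Fintype ι] {τ β : ι → ℕ} {L : ι → ℝ} (hL : ∀ i, 0 ≤ L i) (hT : tot L = 1)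
    (hU : UEF τ β L) {H : ℕ → ℝ → ℝ} {ε : ℕ → ℝ} (hm : ∀ n, MonotoneOn (H n) (Icc 0 1))
    (h0 : ∀ n, H n 0 = 0) (h1 : ∀ n, H n 1 = 1) (ha : ∀ n, AInv τ β L (H n) (ε n))
    (hε : Tendsto ε atTop (𝓝 0)) {x : ℝ} (hx : x ∈ Icc (0:ℝ) 1) :
    Tendsto (fun n => H n x) atTop (𝓝 x) := by
  rw [tendsto_iff_ultrafilter]
  intro g hg
  have hH : ∀ n, ∀ y ∈ Icc (0:ℝ) 1, H n y ∈ Icc (0:ℝ) 1 := fun n y hy =>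
    ⟨by rw [← h0 n]; exact hm n (left_mem_Icc.2 zero_le_one) hy hy.1,
     by rw [← h1 n]; exact hm n hy (right_mem_Icc.2 zero_le_one) hy.2⟩
  have hex : ∀ y : ℝ, ∃ z, y ∈ Icc (0:ℝ) 1 → Tendsto (fun n => H n y) g (𝓝 z) := by
    intro y
    by_cases hy : y ∈ Icc (0:ℝ) 1
    · obtain ⟨z, -, hz⟩ := isCompact_Icc.ultrafilter_le_nhds (g.map fun n => H n y)
        (by rw [le_principal_iff]; exact mem_map.2 (univ_mem' fun n => hH n y hy))
      exact ⟨z, fun _ => hz⟩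
    · exact ⟨0, fun h => absurd h hy⟩
  choose Φ hΦ using hex
  have m0 : (0:ℝ) ∈ Icc (0:ℝ) 1 := left_mem_Icc.2 zero_le_one
  have m1 : (1:ℝ) ∈ Icc (0:ℝ) 1 := right_mem_Icc.2 zero_le_one
  have f0 : Φ 0 = 0 := tendsto_nhds_unique (hΦ 0 m0) (by simp [h0])
  have f1 : Φ 1 = 1 := tendsto_nhds_unique (hΦ 1 m1) (by simp [h1])
  have fm : MonotoneOn Φ (Icc 0 (tot L)) := by
    rw [hT]
    intro a ha b hb hab
    exact le_of_tendsto_of_tendsto' (hΦ a ha) (hΦ b hb) fun n => hm n ha hb hab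
  have mem : ∀ (σ : ι → ℕ) j u, 0 ≤ u → u ≤ L j → st σ L j + u ∈ Icc (0:ℝ) 1 := fun σ j u hu hu' =>
    ⟨by linarith [st_nonneg (τ := σ) hL j], by linarith [st_add_le (τ := σ) hL j]⟩
  have fi : Inv τ β L Φ := by
    intro j u hu hu'
    have e0 : ∀ σ : ι → ℕ, st σ L j ∈ Icc (0:ℝ) 1 := fun σ => by
      simpa using mem σ j 0 le_rfl (hL j)
    have t := (((hΦ _ (mem β j u hu hu')).sub (hΦ _ (e0 β))).sub ((hΦ _ (mem τ j u hu hu')).sub (hΦ _ (e0 τ)))).abs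
    have := le_of_tendsto_of_tendsto' t (hε.mono_left hg) fun n => by
      obtain ⟨E, hE0, hEs, hE⟩ := ha n
      exact (hE j u hu hu').trans ((le_tot hE0 j).trans hEs)
    rw [← sub_eq_zero]; exact abs_nonpos_iff.1 this
  have := hU Φ fm f0 fi x (by rw [hT]; exact hx)
  rw [hT, f1, mul_one, one_mul] at this
  have t := hΦ x hx
  rw [this] at t; exact t

theorem st_lt {ι : Type*} [Fintype ι] {τ : ι → ℕ} {L : ι → ℝ} (h : ∀ i, 0 ≤ L i) {j k : ι} (hjk : τ k < τ j) :
    st τ L k + L k ≤ st τ L j := by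
  classical
  have : L k = ∑ i, if i = k then L i else 0 := by simp
  rw [st, this, ← Finset.sum_add_distrib, st]
  refine Finset.sum_le_sum fun i _ => ?_
  by_cases hk : i = k
  · subst hk; simp [hjk]
  · simp only [hk, if_false, add_zero]
    split_ifs with h1 h2
    · exact le_rfl
    · omega
    · exact h i
    · exact le_rfl

/-- The clamp function of an interval. -/
theorem clamp {ι : Type*} [Fintype ι] [DecidableEq ι] {τ β : ι → ℕ} (hτ : Function.Injective τ) {L : ι → ℝ} (hL : ∀ i, 0 ≤ L i)
    {w : ι} (hw : 0 < L w) : ∃ F : ℝ → ℝ, Monotone F ∧ F 0 = 0 ∧ F (tot L) = 1 ∧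
      mass τ L F = Pi.single w 1 ∧ AInv τ β L F (Fintype.card ι) := by
  set F : ℝ → ℝ := fun x => max 0 (min 1 ((x - st τ L w) / L w)) with hF
  have z : ∀ x ≤ st τ L w, F x = 0 := fun x hx => by
    have : (x - st τ L w) / L w ≤ 0 := div_nonpos_of_nonpos_of_nonneg (by linarith) hw.le
    simp only [hF]
    rw [max_eq_left]; exact (min_le_right _ _).trans this
  have o : ∀ x, st τ L w + L w ≤ x → F x = 1 := fun x hx => by
    have : 1 ≤ (x - st τ L w) / L w := by rw [le_div_iff₀ hw]; linarith
    simp only [hF]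
    rw [min_eq_left this]; simp
  have m : Monotone F := by
    intro a b hab
    simp only [hF]
    gcongr
  have b : ∀ x, 0 ≤ F x ∧ F x ≤ 1 := fun x => ⟨le_max_left _ _, max_le zero_le_one (min_le_left _ _)⟩
  refine ⟨F, m, z _ (st_nonneg hL w), o _ (st_add_le hL w), ?_, ?_⟩
  · ext k
    by_cases hk : k = w
    · subst hk; simp [mass, z _ le_rfl, o _ le_rfl]
    · rw [Pi.single_eq_of_ne hk, mass]
      rcases lt_trichotomy (τ k) (τ w) with h | h | h
      · have := st_lt hL h
        rw [z _ this, z _ (by linarith [hL k])]; ring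
      · exact absurd (hτ h) hk
      · have := st_lt hL h
        rw [o _ this, o _ (by linarith [hL k])]; ring
  · refine ⟨fun _ => 1, fun _ => zero_le_one, by simp [tot], fun j u hu _ => ?_⟩
    have h1 := m (show st β L j ≤ st β L j + u by linarith)
    have h2 := m (show st τ L j ≤ st τ L j + u by linarith)
    have := b (st β L j); have := b (st τ L j); have := b (st β L j + u); have := b (st τ L j + u)
    rw [abs_le]; constructor <;> linarith

/-- `M` as a linear map -/
def Ml (w l : Fin 4) : (Fin 4 → ℝ) →ₗ[ℝ] (Fin 4 → ℝ) where
  toFun := M w l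
  map_add' := M_add w l
  map_smul' := M_smul w l

/-- Products of the Rauzy matrices. -/
def A (s : ℕ → Fin 7) (c : ℕ → Bool) : ℕ → (Fin 4 → ℝ) →ₗ[ℝ] (Fin 4 → ℝ)
  | 0 => LinearMap.id
  | n + 1 => (A s c n).comp (Ml (wn (s n) (c n)) (ls (s n) (c n)))

theorem A_zero (s c v) : A s c 0 v = v := rfl
theorem A_succ (s c n v) : A s c (n + 1) v = A s c n (M (wn (s n) (c n)) (ls (s n) (c n)) v) := rfl

theorem A_nonneg (s c n) : ∀ {v : Fin 4 → ℝ}, (∀ i, 0 ≤ v i) → ∀ i, 0 ≤ A s c n v i := by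
  induction n with
  | zero => intro v hv i; exact hv i
  | succ n ih => intro v hv i; rw [A_succ]; exact ih (M_nonneg _ _ hv) i

theorem tot_A (s c n) : ∀ {v : Fin 4 → ℝ}, (∀ i, 0 ≤ v i) → tot v ≤ tot (A s c n v) := by
  induction n with
  | zero => intro v hv; exact le_rfl
  | succ n ih => intro v hv; rw [A_succ]; refine le_trans ?_ (ih (M_nonneg _ _ hv)); rw [tot_M]; linarith [hv (ls (s n) (c n))]

theorem A_continuous (s c n) : Continuous (A s c n) := (A s c n).continuous_of_finiteDimensional

/-- column -/
def col (s : ℕ → Fin 7) (c : ℕ → Bool) (n : ℕ) (j : Fin 4) : Fin 4 → ℝ := A s c n (Pi.single j 1)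

theorem col_ls (s c n) : col s c (n + 1) (ls (s n) (c n)) = col s c n (ls (s n) (c n)) + col s c n (wn (s n) (c n)) := by
  rw [col, A_succ, M, Pi.single_eq_same, map_add]; rfl
theorem col_ne (s c n) {j} (h : j ≠ ls (s n) (c n)) : col s c (n + 1) j = col s c n j := by
  rw [col, A_succ, M, Pi.single_eq_of_ne h.symm]; simp [col]

theorem one_le_col (s c n j) : 1 ≤ tot (col s c n j) := by
  have := tot_A s c n (v := Pi.single j 1) (fun i => by rw [Pi.single_apply]; split_ifs <;> norm_num)
  rwa [tot_single] at this

theorem A_eq_sum (s c n) (v : Fin 4 → ℝ) (k : Fin 4) : A s c n v k = ∑ j, v j * col s c n j k := by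
  have := LinearMap.pi_apply_eq_sum_univ (A s c n) v
  rw [this, Finset.sum_apply]
  refine Finset.sum_congr rfl fun j _ => ?_
  rw [Pi.smul_apply, smul_eq_mul, col]
  have : (fun i => if j = i then (1:ℝ) else 0) = Pi.single j 1 := by
    ext i; simp [Pi.single_apply, eq_comm]
  rw [this]

theorem tot_A_eq_sum (s c n) (v : Fin 4 → ℝ) : tot (A s c n v) = ∑ j, v j * tot (col s c n j) := by
  simp only [tot, A_eq_sum, Finset.mul_sum]
  rw [Finset.sum_comm]

theorem col_tendsto {s : ℕ → Fin 7} {c : ℕ → Bool} (hl : ∀ (X : Fin 4) (N : ℕ), ∃ n ≥ N, ls (s n) (c n) = X) (j : Fin 4) :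
    Tendsto (fun n => tot (col s c n j)) atTop atTop := by
  have hmono : Monotone fun n => tot (col s c n j) := monotone_nat_of_le_succ fun n => by
    by_cases h : j = ls (s n) (c n)
    · rw [h, col_ls, tot_add]; linarith [one_le_col s c n (wn (s n) (c n))]
    · rw [col_ne _ _ _ h]
  apply tendsto_atTop_atTop_of_monotone hmono
  have : ∀ m : ℕ, ∃ n, (m:ℝ) ≤ tot (col s c n j) := by
    intro m
    induction m with
    | zero => exact ⟨0, by have := one_le_col s c 0 j; push_cast; linarith⟩
    | succ m ih =>
      obtain ⟨n, hn⟩ := ih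
      obtain ⟨k, hk, hk'⟩ := hl j n
      refine ⟨k + 1, ?_⟩
      have h1 := hmono hk
      simp only at h1
      rw [← hk', col_ls, tot_add, hk']
      push_cast
      linarith [one_le_col s c k (wn (s k) (c k))]
  intro b
  obtain ⟨m, hm⟩ := exists_nat_ge b
  obtain ⟨n, hn⟩ := this m
  exact ⟨n, hm.trans hn⟩

namespace Orbit
variable {s : ℕ → Fin 7} {c : ℕ → Bool} {lam : ℕ → Fin 4 → ℝ}

theorem lam_A (o : Orbit s c lam) (n : ℕ) : lam 0 = A s c n (lam n) := by
  induction n with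
  | zero => rfl
  | succ n ih => rw [A_succ, ← o.dec n, ih]

theorem extend (o : Orbit s c lam) (n : ℕ) : ∀ {F : ℝ → ℝ} {ε : ℝ}, MonotoneOn F (Icc 0 (tot (lam n))) → F 0 = 0 →
    F (tot (lam n)) = tot (mass (tp (s n)) (lam n) F) → AInv (tp (s n)) (bp (s n)) (lam n) F ε →
    ∃ G, MonotoneOn G (Icc 0 (tot (lam 0))) ∧ G 0 = 0 ∧ G (tot (lam 0)) = tot (mass (tp (s 0)) (lam 0) G) ∧
      mass (tp (s 0)) (lam 0) G = A s c n (mass (tp (s n)) (lam n) F) ∧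
      AInv (tp (s 0)) (bp (s 0)) (lam 0) G ε := by
  induction n with
  | zero => intro F ε h1 h2 h3 h4; exact ⟨F, h1, h2, h3, rfl, h4⟩
  | succ n ih =>
    intro F ε h1 h2 h3 h4
    have hst := step_s (s n) (c n)
    rw [← o.next n] at hst
    obtain ⟨G, g1, g2, g3, g4, g5⟩ := hst.ext (o.nonneg (n + 1)) h1 h4
    rw [← o.dec n] at g1 g3 g4 g5
    have h6 : G (tot (lam n)) = tot (mass (tp (s n)) (lam n) G) := by
      rw [g3, g4, tot_M, h3]
    obtain ⟨K, k1, k2, k3, k4, k5⟩ := ih g1 (by rw [g2 _ (tot_nonneg (o.nonneg _)), h2]) h6 g5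
    exact ⟨K, k1, k2, k3, by rw [k4, g4, A_succ], k5⟩

theorem winner_col (o : Orbit s c lam) (hT : tot (lam 0) = 1) (hU : UEF (tp (s 0)) (bp (s 0)) (lam 0))
    (hl : ∀ (X : Fin 4) (N : ℕ), ∃ n ≥ N, ls (s n) (c n) = X) (hw : ∀ n, 0 < lam n (wn (s n) (c n))) (k : Fin 4) :
    Tendsto (fun n => col s c n (wn (s n) (c n)) k / tot (col s c n (wn (s n) (c n)))) atTop (𝓝 (lam 0 k)) := by
  have hinj : ∀ x, Function.Injective (tp x) := by decide
  have key : ∀ n, ∃ H : ℝ → ℝ, MonotoneOn H (Icc 0 1) ∧ H 0 = 0 ∧ H 1 = 1 ∧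
      (∀ k, mass (tp (s 0)) (lam 0) H k = col s c n (wn (s n) (c n)) k / tot (col s c n (wn (s n) (c n)))) ∧
      AInv (tp (s 0)) (bp (s 0)) (lam 0) H (4 / tot (col s c n (wn (s n) (c n)))) := by
    intro n
    obtain ⟨F, f1, f2, f3, f4, f5⟩ := clamp (β := bp (s n)) (hinj (s n)) (o.nonneg n) (hw n)
    obtain ⟨G, g1, g2, g3, g4, g5⟩ := o.extend n (f1.monotoneOn _) f2 (by rw [f3, f4, tot_single]) f5
    rw [f4] at g4
    have hpos : 0 < tot (col s c n (wn (s n) (c n))) := by linarith [one_le_col s c n (wn (s n) (c n))]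
    rw [hT] at g1 g3
    rw [g4] at g3
    change G 1 = tot (col s c n (wn (s n) (c n))) at g3
    set h := tot (col s c n (wn (s n) (c n))) with hh
    refine ⟨fun x => G x / h, fun a ha b hb hab => ?_, by simp [g2], ?_, fun k => ?_, ?_⟩
    · exact div_le_div_of_nonneg_right (g1 ha hb hab) hpos.le
    · simp only [g3]; exact div_self hpos.ne'
    · have := congrFun g4 k
      change _ = col s c n (wn (s n) (c n)) k at this
      rw [← this]; simp only [mass]; ring
    · obtain ⟨E, e1, e2, e3⟩ := g5
      refine ⟨fun j => E j / h, fun j => div_nonneg (e1 j) hpos.le, ?_, fun j u hu hu' => ?_⟩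
      · have : tot (fun j => E j / h) = tot E / h := by simp [tot, Finset.sum_div]
        rw [this]
        apply div_le_div_of_nonneg_right _ hpos.le
        simpa using e2
      · have := e3 j u hu hu'
        have e : ∀ a b c d : ℝ, a / h - b / h - (c / h - d / h) = (a - b - (c - d)) / h := fun a b c d => by ring
        rw [e, abs_div, abs_of_pos hpos]
        exact div_le_div_of_nonneg_right this hpos.le
  choose H h1 h2 h3 h4 h5 using key
  have hεt : Tendsto (fun n => 4 / tot (col s c n (wn (s n) (c n)))) atTop (𝓝 0) := by
    apply Tendsto.const_div_atTop
    rw [tendsto_atTop]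
    intro b
    have : ∀ᶠ n in atTop, ∀ j, b ≤ tot (col s c n j) :=
      eventually_all.2 fun j => (col_tendsto hl j).eventually_ge_atTop b
    filter_upwards [this] with n hn using hn _
  have hlim : ∀ x ∈ Icc (0:ℝ) 1, Tendsto (fun n => H n x) atTop (𝓝 x) := fun x hx =>
    limit_lin (o.nonneg 0) hT hU h1 h2 h3 h5 hεt hx
  have a1 := st_nonneg (τ := tp (s 0)) (o.nonneg 0) k
  have a2 := st_add_le (τ := tp (s 0)) (o.nonneg 0) k
  have a3 := o.nonneg 0 k
  have := (hlim (st (tp (s 0)) (lam 0) k + lam 0 k) ⟨by linarith, by linarith⟩).sub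
    (hlim (st (tp (s 0)) (lam 0) k) ⟨by linarith, by linarith⟩)
  rw [add_sub_cancel_left] at this
  exact this.congr fun n => h4 n k

theorem all_col (o : Orbit s c lam) (hT : tot (lam 0) = 1) (hU : UEF (tp (s 0)) (bp (s 0)) (lam 0))
    (hl : ∀ (X : Fin 4) (N : ℕ), ∃ n ≥ N, ls (s n) (c n) = X) (hw : ∀ n, 0 < lam n (wn (s n) (c n)))
    {ε : ℝ} (hε : 0 < ε) : ∀ᶠ n in atTop, ∀ k j, |col s c n j k - tot (col s c n j) * lam 0 k| ≤ ε * tot (col s c n j) := by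
  rw [eventually_all]
  intro k
  have h1 := (o.winner_col hT hU hl hw k).eventually (Metric.closedBall_mem_nhds _ (half_pos hε))
  obtain ⟨N, hN⟩ := h1.exists_forall_of_atTop
  have hN' : ∀ n ≥ N, |col s c n (wn (s n) (c n)) k - tot (col s c n (wn (s n) (c n))) * lam 0 k| ≤ ε / 2 * tot (col s c n (wn (s n) (c n))) := by
    intro n hn
    have := hN n hn
    rw [Real.dist_eq] at this
    have hpos : 0 < tot (col s c n (wn (s n) (c n))) := by linarith [one_le_col s c n (wn (s n) (c n))]
    have e : col s c n (wn (s n) (c n)) k - tot (col s c n (wn (s n) (c n))) * lam 0 k =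
      (col s c n (wn (s n) (c n)) k / tot (col s c n (wn (s n) (c n))) - lam 0 k) * tot (col s c n (wn (s n) (c n))) := by
      field_simp
    rw [e, abs_mul, abs_of_pos hpos]
    exact mul_le_mul_of_nonneg_right this hpos.le
  have h2 : ∀ n ≥ N, ∀ j, |col s c n j k - tot (col s c n j) * lam 0 k| ≤
      |col s c N j k - tot (col s c N j) * lam 0 k| + ε / 2 * tot (col s c n j) := by
    intro n hn
    induction n, hn using Nat.le_induction with
    | base => intro j; have := one_le_col s c N j; nlinarith
    | succ n hn ih =>
      intro j
      by_cases hj : j = ls (s n) (c n)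
      · have i1 := ih j
        have i2 := hN' n hn
        subst hj
        rw [col_ls, tot_add, Pi.add_apply]
        rw [abs_le] at i1 i2 ⊢
        constructor <;> nlinarith
      · rw [col_ne _ _ _ hj]; exact ih j
  rw [eventually_all]
  intro j
  filter_upwards [eventually_ge_atTop N, (col_tendsto hl j).eventually_ge_atTop
    (|col s c N j k - tot (col s c N j) * lam 0 k| / (ε / 2))] with n hn hn'
  have := h2 n hn j
  rw [div_le_iff₀ (half_pos hε)] at hn'
  linarith

/-- The nested cones shrink to the length vector. -/
theorem cone (o : Orbit s c lam) (hT : tot (lam 0) = 1) (hU : UEF (tp (s 0)) (bp (s 0)) (lam 0))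
    (hl : ∀ (X : Fin 4) (N : ℕ), ∃ n ≥ N, ls (s n) (c n) = X) (hw : ∀ n, 0 < lam n (wn (s n) (c n)))
    {ε : ℝ} (hε : 0 < ε) : ∀ᶠ n in atTop, ∀ v : Fin 4 → ℝ, (∀ i, 0 ≤ v i) → ∀ k,
      |A s c n v k - tot (A s c n v) * lam 0 k| ≤ ε * tot (A s c n v) := by
  filter_upwards [o.all_col hT hU hl hw hε] with n hn v hv k
  rw [A_eq_sum, tot_A_eq_sum, Finset.sum_mul, ← Finset.sum_sub_distrib, Finset.mul_sum]
  refine (Finset.abs_sum_le_sum_abs _ _).trans (Finset.sum_le_sum fun j _ => ?_)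
  rw [mul_assoc, ← mul_sub, abs_mul, abs_of_nonneg (hv j)]
  have := mul_le_mul_of_nonneg_left (hn k j) (hv j)
  linarith

end Orbit
end IET

set_option linter.unusedSectionVars false
set_option linter.unusedSimpArgs false
set_option linter.unusedVariables false
set_option linter.style.longLine false
namespace IET
open Set Filter Topology

/-- Infinite concatenation of paths converging to a point. -/
theorem inf_concat {X : Type*} [TopologicalSpace X] {S : Set X} {K : ℕ → Set X} {x : ℕ → X} {L : X}
    (hL : L ∈ S) (hj : ∀ n, JoinedIn (S ∩ K n) (x n) (x (n + 1)))
    (hK : ∀ V ∈ 𝓝 L, ∀ᶠ n in atTop, K n ⊆ V) : JoinedIn S (x 0) L := by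
  choose γ hγ using hj
  let G : ℕ → ℝ → X := fun n => (γ n).extend
  have G0 : ∀ n, G n 0 = x n := fun n => by simp [G]
  have G1 : ∀ n, G n 1 = x (n + 1) := fun n => by simp [G]
  set g : ℝ → X := fun z => G ⌊z⌋₊ (z - ⌊z⌋₊) with hg
  have gmem : ∀ z, g z ∈ S ∩ K ⌊z⌋₊ := fun z => by
    have : g z ∈ range (γ ⌊z⌋₊) := by
      rw [← Path.extend_range]; exact mem_range_self _
    obtain ⟨t, ht⟩ := this
    rw [← ht]; exact hγ _ t
  let C : ℕ → Set ℝ := fun n => {z | ((n:ℝ) ≤ z ∨ n = 0) ∧ z ≤ n + 1}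
  have gC : ∀ n, ∀ z ∈ C n, g z = G n (z - n) := by
    rintro n z ⟨h1, h2⟩
    rcases h2.eq_or_lt with h2 | h2
    · have : ⌊z⌋₊ = n + 1 := by rw [h2]; exact_mod_cast Nat.floor_natCast (n + 1)
      have e1 : z - ((n + 1 : ℕ) : ℝ) = 0 := by push_cast; linarith
      have e2 : z - n = 1 := by linarith
      change G ⌊z⌋₊ (z - ⌊z⌋₊) = _
      rw [this, e1, e2, G0, G1]
    · have : ⌊z⌋₊ = n := by
        rcases h1 with h1 | h1
        · rw [Nat.floor_eq_iff ((Nat.cast_nonneg n).trans h1)]; exact ⟨h1, h2⟩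
        · subst h1; rw [Nat.floor_eq_zero]; simpa using h2
      change G ⌊z⌋₊ (z - ⌊z⌋₊) = _
      rw [this]
  have gcont : Continuous g := by
    apply LocallyFinite.continuous (f := C)
    · intro z
      refine ⟨Iio (z + 1), Iio_mem_nhds (by linarith), (finite_Iic (⌈z + 1⌉₊)).subset ?_⟩
      rintro n ⟨y, ⟨h1, h2⟩, h3⟩
      rcases h1 with h1 | h1
      · have : (n:ℝ) ≤ ⌈z + 1⌉₊ := h1.trans (h3.le.trans (Nat.le_ceil _))
        exact_mod_cast this
      · subst h1; exact Nat.zero_le _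
    · rw [eq_univ_iff_forall]
      intro z
      rw [mem_iUnion]
      refine ⟨⌊z⌋₊, ?_, (Nat.lt_floor_add_one z).le⟩
      by_cases hz : 0 ≤ z
      · exact Or.inl (Nat.floor_le hz)
      · exact Or.inr (Nat.floor_of_nonpos (by linarith))
    · intro n
      by_cases hn : n = 0
      · subst hn
        have : C 0 = Iic 1 := by ext z; simp [C]
        rw [this]; exact isClosed_Iic
      · have : C n = Icc (n:ℝ) (n + 1) := by ext z; simp [C, hn]
        rw [this]; exact isClosed_Icc
    · intro n
      apply ContinuousOn.congr (f := fun z => G n (z - n)) _ (gC n)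
      exact ((γ n).continuous_extend.comp (continuous_id.sub continuous_const)).continuousOn
  have glim : Tendsto g atTop (𝓝 L) := by
    intro V hV
    have h1 := (hK V hV)
    have h2 : ∀ᶠ z : ℝ in atTop, K ⌊z⌋₊ ⊆ V := tendsto_nat_floor_atTop.eventually h1
    have h3 : ∀ᶠ z : ℝ in atTop, g z ∈ V := by
      filter_upwards [h2] with z hz using hz (gmem z).2
    exact h3
  set f : ℝ → X := fun t => if t < 1 then g (t / (1 - t)) else L with hf
  apply JoinedIn.ofLine (f := f)
  · intro t ht
    rcases ht.2.eq_or_lt with h1 | h1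
    · subst h1
      have hf1 : f 1 = L := by simp [hf]
      rw [ContinuousWithinAt, hf1]
      have : Tendsto f (𝓝[Iio 1] 1) (𝓝 L) := by
        have h3 : Tendsto (fun t : ℝ => t / (1 - t)) (𝓝[Iio 1] 1) atTop := by
          simp only [div_eq_mul_inv]
          apply Tendsto.pos_mul_atTop one_pos (tendsto_id.mono_left nhdsWithin_le_nhds)
          apply tendsto_inv_nhdsGT_zero.comp
          rw [tendsto_nhdsWithin_iff]
          constructor
          · have : Tendsto (fun t : ℝ => 1 - t) (𝓝 1) (𝓝 (1 - 1)) := tendsto_const_nhds.sub tendsto_id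
            rw [sub_self] at this
            exact this.mono_left nhdsWithin_le_nhds
          · filter_upwards [self_mem_nhdsWithin] with t ht
            simpa using ht
        refine (glim.comp h3).congr' ?_
        filter_upwards [self_mem_nhdsWithin] with t ht
        have : t < 1 := ht
        simp [hf, this]
      have h4 : Tendsto f (𝓝[Iic 1] 1) (𝓝 L) := by
        rw [← Iio_insert, nhdsWithin_insert, tendsto_sup]
        refine ⟨?_, this⟩
        rw [← hf1]; exact tendsto_pure_nhds f 1
      exact h4.mono_left (nhdsWithin_mono _ fun y hy => hy.2)
    · apply ContinuousAt.continuousWithinAt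
      have : ContinuousAt (fun t : ℝ => g (t / (1 - t))) t :=
        gcont.continuousAt.comp (continuousAt_id.div (continuousAt_const.sub continuousAt_id) (by intro h; have h' : (1:ℝ) - t = 0 := h; linarith))
      apply this.congr
      filter_upwards [Iio_mem_nhds h1] with y hy
      have : y < 1 := hy
      simp [hf, this]
  · have := gC 0 0 ⟨by simp, by simp⟩
    have e : (0:ℝ) - (0:ℕ) = 0 := by simp
    rw [e, G0] at this
    simp [hf, this]
  · simp [hf]
  · rintro _ ⟨t, -, rfl⟩
    simp only [hf]
    split_ifs
    · exact (gmem _).1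
    · exact hL

theorem fv_mem (s : Fin 7) : fv ∈ US s := (arrow_f s true).source_mem

namespace Orbit
variable {s : ℕ → Fin 7} {c : ℕ → Bool} {lam : ℕ → Fin 4 → ℝ}

theorem A_mem (hs : ∀ n, s (n + 1) = nx (s n) (c n)) (n : ℕ) : ∀ {v}, v ∈ US (s n) → A s c n v ∈ US (s 0) := by
  induction n with
  | zero => intro v hv; exact hv
  | succ n ih =>
    intro v hv
    rw [A_succ]
    apply ih
    apply (step_s (s n) (c n)).mem
    rw [← hs n]; exact hv

theorem thmB (o : Orbit s c lam) (hT : tot (lam 0) = 1) (hU : UEF (tp (s 0)) (bp (s 0)) (lam 0))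
    (hl : ∀ (X : Fin 4) (N : ℕ), ∃ n ≥ N, ls (s n) (c n) = X) (hw : ∀ n, 0 < lam n (wn (s n) (c n))) :
    JoinedIn (US (s 0)) fv (lam 0) := by
  let N : (Fin 4 → ℝ) → (Fin 4 → ℝ) := fun v => (tot v)⁻¹ • v
  have hpos : ∀ n v, v ∈ US (s n) → 0 < tot (A s c n v) := fun n v hv =>
    lt_of_lt_of_le hv.2.1 (tot_A s c n hv.1)
  let K : ℕ → Set (Fin 4 → ℝ) := fun n => {y | ∃ v ∈ US (s n), y = N (A s c n v)}
  have tcont : Continuous (tot : (Fin 4 → ℝ) → ℝ) := continuous_finsetSum _ fun i _ => continuous_apply i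
  have main : JoinedIn (US (s 0)) (N (A s c 0 fv)) (lam 0) := by
    have hm0 : lam 0 ∈ US (s 0) := ⟨o.nonneg 0, by rw [hT]; exact one_pos, hU⟩
    apply inf_concat (K := K) (x := fun n => N (A s c n fv)) hm0
    · intro n
      have h1 := arrow_f (s n) (c n)
      have h2 : ContinuousOn (fun v => N (A s c n v)) (US (s n)) := by
        intro v hv
        apply ContinuousAt.continuousWithinAt
        exact ((tcont.comp (A_continuous s c n)).continuousAt.inv₀ (hpos n v hv).ne').smul (A_continuous s c n).continuousAt
      refine (h1.map_continuousOn h2).mono ?_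
      rintro _ ⟨v, hv, rfl⟩
      exact ⟨U_smul (A_mem o.next n hv) (inv_pos.2 (hpos n v hv)), v, hv, rfl⟩
    · intro V hV
      obtain ⟨ε, hε, hεV⟩ := Metric.nhds_basis_closedBall.mem_iff.1 hV
      filter_upwards [o.cone hT hU hl hw hε] with n hn
      rintro _ ⟨v, hv, rfl⟩
      apply hεV
      rw [Metric.mem_closedBall, dist_pi_le_iff hε.le]
      intro k
      have hp := hpos n v hv
      have := hn v hv.1 k
      have e : N (A s c n v) k - lam 0 k = (A s c n v k - tot (A s c n v) * lam 0 k) / tot (A s c n v) := by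
        simp only [N, Pi.smul_apply, smul_eq_mul]; field_simp
      rw [Real.dist_eq, e, abs_div, abs_of_pos hp, div_le_iff₀ hp]
      exact this
  exact (join_smul (fv_mem (s 0)) (inv_pos.2 (fv_mem (s 0)).2.1)).trans main

end Orbit

theorem AD_center {x y : ℝ} (hx : 0 < x) (hy : 0 < y) (h : Irrational (x / y)) :
    JoinedIn (US 0) fv (v2 0 3 x y) := by
  set r := (x + y)⁻¹ with hr
  have hr0 : 0 < r := by positivity
  have hv := AD_mem 0 hx hy h
  have hrv := U_smul hv hr0
  obtain ⟨s, c, lam, o, hs, hlam⟩ := exists_orbit 0 (r • v2 0 3 x y) hrv.1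
  have inv : ∀ n, (s n = 0 ∨ s n = 1 ∨ s n = 2 ∨ s n = 4 ∨ s n = 5) ∧ lam n 1 = 0 ∧ lam n 2 = 0 ∧
      0 < lam n 0 ∧ 0 < lam n 3 ∧ Irrational (lam n 0 / lam n 3) := by
    intro n
    induction n with
    | zero =>
      rw [hs, hlam]
      refine ⟨Or.inl rfl, ?_, ?_, ?_, ?_, ?_⟩
      · simp [v2]
      · simp [v2]
      · simpa [v2] using mul_pos hr0 hx
      · simpa [v2] using mul_pos hr0 hy
      · have : (r • v2 (0 : Fin 4) 3 x y) 0 / (r • v2 (0 : Fin 4) 3 x y) 3 = x / y := by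
          simp only [v2, Pi.smul_apply, smul_eq_mul, Pi.add_apply]
          simp; field_simp
        rw [this]; exact h
    | succ n ih =>
      obtain ⟨h1, h2, h3, h4, h5, h6⟩ := ih
      have hw := o.lam_w n
      have hn := fun k => o.lam_ne n (k := k)
      have hnn := o.nonneg (n + 1)
      rw [o.next]
      have same : ∀ w : Fin 4, wn (s n) (c n) = w → lam n (ls (s n) (c n)) = 0 → ∀ k, lam (n + 1) k = lam n k := by
        intro w hw1 hl k
        by_cases hk : k = wn (s n) (c n)
        · subst hk; rw [hw, hl, add_zero]
        · exact (hn k hk).symm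
      rcases h1 with h1 | h1 | h1 | h1 | h1 <;> cases hc : c n <;> rw [h1, hc] at hw hn same <;> rw [h1]
      · change lam n 0 = lam (n + 1) 0 + lam n 3 at hw
        have hn1 := hn 1 (by decide); have hn2 := hn 2 (by decide); have hn3 := hn 3 (by decide)
        have e : lam (n + 1) 0 / lam (n + 1) 3 = lam n 0 / lam n 3 - 1 := by
          rw [← hn3, eq_sub_of_add_eq hw.symm]; field_simp
        have hirr : Irrational (lam (n + 1) 0 / lam (n + 1) 3) := by rw [e]; simpa using h6.sub_intCast 1
        refine ⟨by decide, by rw [← hn1, h2], by rw [← hn2, h3], ?_, by rw [← hn3]; exact h5, hirr⟩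
        refine lt_of_le_of_ne (hnn 0) fun h0 => ?_
        rw [← h0] at hirr; simp at hirr
      · change lam n 3 = lam (n + 1) 3 + lam n 0 at hw
        have hn1 := hn 1 (by decide); have hn2 := hn 2 (by decide); have hn3 := hn 0 (by decide)
        have e : lam (n + 1) 3 / lam (n + 1) 0 = lam n 3 / lam n 0 - 1 := by
          rw [← hn3, eq_sub_of_add_eq hw.symm]; field_simp
        have hirr : Irrational (lam (n + 1) 3 / lam (n + 1) 0) := by rw [e]; simpa using (irr_inv h6).sub_intCast 1
        refine ⟨by decide, by rw [← hn1, h2], by rw [← hn2, h3], by rw [← hn3]; exact h4, ?_, irr_inv hirr⟩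
        refine lt_of_le_of_ne (hnn 3) fun h0 => ?_
        rw [← h0] at hirr; simp at hirr
      · change lam n 1 = lam (n + 1) 1 + lam n 3 at hw
        linarith [hnn 1]
      · have e := same _ rfl h2
        simp only [e]; exact ⟨by decide, h2, h3, h4, h5, h6⟩
      · change lam n 2 = lam (n + 1) 2 + lam n 3 at hw
        linarith [hnn 2]
      · have e := same _ rfl h3
        simp only [e]; exact ⟨by decide, h2, h3, h4, h5, h6⟩
      · have e := same _ rfl h3
        simp only [e]; exact ⟨by decide, h2, h3, h4, h5, h6⟩
      · change lam n 2 = lam (n + 1) 2 + lam n 0 at hw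
        linarith [hnn 2]
      · have e := same _ rfl h2
        simp only [e]; exact ⟨by decide, h2, h3, h4, h5, h6⟩
      · change lam n 1 = lam (n + 1) 1 + lam n 0 at hw
        linarith [hnn 1]
  have hl := o.loses (fun n => (inv n).2.2.2.1) (fun n => (inv n).2.2.2.2.1)
    (fun n h => by
      have := (inv n).1
      rw [h] at this; exact absurd this (by decide)) (fun n h => by
      have := (inv n).1
      rw [h] at this; exact absurd this (by decide))
  have hwp : ∀ n, 0 < lam n (wn (s n) (c n)) := by
    intro n
    obtain ⟨h1, h2, h3, h4, h5, h6⟩ := inv n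
    have hw := o.lam_w n
    have hnn := o.nonneg (n + 1)
    rcases h1 with h1 | h1 | h1 | h1 | h1 <;> cases hc : c n <;> rw [h1, hc] at hw <;> rw [h1]
    · exact h4
    · exact h5
    · change lam n 1 = lam (n + 1) 1 + lam n 3 at hw
      linarith [hnn 1]
    · exact h5
    · change lam n 2 = lam (n + 1) 2 + lam n 3 at hw
      linarith [hnn 2]
    · exact h5
    · exact h4
    · change lam n 2 = lam (n + 1) 2 + lam n 0 at hw
      linarith [hnn 2]
    · exact h4
    · change lam n 1 = lam (n + 1) 1 + lam n 0 at hw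
      linarith [hnn 1]
  have := o.thmB (by rw [hlam, tot_smul, tot_v2, hr]; field_simp) (by rw [hs, hlam]; exact hrv.2.2) hl hwp
  rw [hs, hlam] at this
  exact this.trans (join_smul hv hr0).symm

/-- The uniquely ergodic set of each state is path connected. -/
theorem thmA (s₀ : Fin 7) {v : Fin 4 → ℝ} (hv : v ∈ US s₀) : JoinedIn (US s₀) v fv := by
  set r := (tot v)⁻¹ with hr
  have hr0 : 0 < r := inv_pos.2 hv.2.1
  have hrv := U_smul hv hr0
  obtain ⟨s, c, lam, o, hs, hlam⟩ := exists_orbit s₀ (r • v) hrv.1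
  have hT : tot (lam 0) = 1 := by rw [hlam, tot_smul, hr]; exact inv_mul_cancel₀ hv.2.1.ne'
  have htp : ∀ n, 0 < tot (lam n) := by
    intro n
    refine lt_of_le_of_ne (tot_nonneg (o.nonneg n)) fun h0 => ?_
    have : lam n = 0 := by
      ext i
      have h1 := le_tot (o.nonneg n) i
      have h2 := o.nonneg n i
      simp only [Pi.zero_apply]; linarith
    have h2 := o.lam_A n
    rw [this, map_zero] at h2
    rw [h2] at hT
    simp [tot] at hT
  have hmem : ∀ n, lam n ∈ US (s n) := by
    intro n
    induction n with
    | zero => rw [hs, hlam]; exact hrv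
    | succ n ih =>
      have hst := step_s (s n) (c n)
      rw [← o.next n] at hst
      refine ⟨o.nonneg _, htp _, hst.uef_conv (o.nonneg _) (htp _) ?_⟩
      rw [← o.dec n]; exact ih.2.2
  have main : JoinedIn (US (s 0)) (lam 0) fv := by
    by_cases hall : ∀ n i, 0 < lam n i
    · exact (o.thmB hT (hmem 0).2.2 (o.loses (fun n => hall n 0) (fun n => hall n 3) (fun n _ => hall n 1)
        (fun n _ => hall n 2)) (fun n => hall n _)).symm
    · push Not at hall
      obtain ⟨n, i, hi⟩ := hall
      have hz : lam n i = 0 := le_antisymm hi (o.nonneg n i)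
      obtain ⟨x, y, hx, hy, hirr, hj⟩ := zero_AD (s n) (hmem n) ⟨i, hz⟩
      have h1 : JoinedIn (US (s n)) (lam n) fv := hj.trans (AD_from_center (s n) (AD_center hx hy hirr)).symm
      clear hi hz hj
      induction n with
      | zero => exact h1
      | succ n ih =>
        apply ih
        have h2 : JoinedIn (US (nx (s n) (c n))) (lam (n + 1)) fv := by rw [← o.next n]; exact h1
        have h3 := arrow_join (s n) (c n) h2
        rw [← o.dec n] at h3
        exact h3.trans (arrow_f (s n) (c n)).symm
  rw [hs, hlam] at main
  exact (join_smul hv hr0).trans main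
end IET

set_option linter.unusedSectionVars false
set_option linter.unusedSimpArgs false
set_option linter.unusedVariables false
set_option linter.style.longLine false
namespace IET
open Set Filter Topology

section restriction
variable {ι κ : Type*} [Fintype ι] [Fintype κ] [DecidableEq ι] [DecidableEq κ]

/-- extension by zero -/
noncomputable def Ez (q : κ → ι) (v : κ → ℝ) : ι → ℝ := Function.extend q v 0

variable {q : κ → ι}

theorem Ez_apply (hq : Function.Injective q) (v : κ → ℝ) (a : κ) : Ez q v (q a) = v a := hq.extend_apply _ _ _
theorem Ez_zero (v : κ → ℝ) {i : ι} (h : i ∉ range q) : Ez q v i = 0 := by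
  rw [Ez, Function.extend_apply' _ _ _ h]; rfl

theorem st_Ez (hq : Function.Injective q) {τ : ι → ℕ} {τ' : κ → ℕ} (h : ∀ a b, τ' a < τ' b ↔ τ (q a) < τ (q b)) (v : κ → ℝ) (a : κ) :
    st τ (Ez q v) (q a) = st τ' v a := by
  rw [st, st]
  symm
  apply Fintype.sum_of_injective q hq
  · intro i hi; rw [Ez_zero v hi]; simp
  · intro b; rw [Ez_apply hq]; simp only [h]

theorem tot_Ez (hq : Function.Injective q) (v : κ → ℝ) : tot (Ez q v) = tot v := by
  rw [tot, tot]
  symm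
  apply Fintype.sum_of_injective q hq
  · intro i hi; exact Ez_zero v hi
  · intro b; rw [Ez_apply hq]

theorem Inv_Ez (hq : Function.Injective q) {τ β : ι → ℕ} {τ' β' : κ → ℕ} (h : ∀ a b, τ' a < τ' b ↔ τ (q a) < τ (q b))
    (h' : ∀ a b, β' a < β' b ↔ β (q a) < β (q b)) (v : κ → ℝ) (F : ℝ → ℝ) :
    Inv τ β (Ez q v) F ↔ Inv τ' β' v F := by
  constructor
  · intro hi a u h0 h1
    have := hi (q a) u h0 (by rwa [Ez_apply hq])
    rwa [st_Ez hq h, st_Ez hq h'] at this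
  · intro hi j u h0 h1
    by_cases hj : j ∈ range q
    · obtain ⟨a, rfl⟩ := hj
      rw [st_Ez hq h, st_Ez hq h']
      exact hi a u h0 (by rwa [Ez_apply hq] at h1)
    · rw [Ez_zero v hj] at h1
      have : u = 0 := le_antisymm h1 h0
      subst this; simp

theorem Ez_mem (hq : Function.Injective q) {τ β : ι → ℕ} {τ' β' : κ → ℕ} (h : ∀ a b, τ' a < τ' b ↔ τ (q a) < τ (q b))
    (h' : ∀ a b, β' a < β' b ↔ β (q a) < β (q b)) (v : κ → ℝ) :
    Ez q v ∈ U τ β ↔ v ∈ U τ' β' := by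
  simp only [U, Set.mem_ofPred_eq, UEF, tot_Ez hq, Inv_Ez hq h h']
  have : (∀ i, 0 ≤ Ez q v i) ↔ ∀ i, 0 ≤ v i := by
    constructor
    · intro H a; have := H (q a); rwa [Ez_apply hq] at this
    · intro H i
      by_cases hj : i ∈ range q
      · obtain ⟨a, rfl⟩ := hj; rw [Ez_apply hq]; exact H a
      · rw [Ez_zero v hj]
  rw [this]

theorem Ez_continuous (hq : Function.Injective q) : Continuous (Ez q : (κ → ℝ) → ι → ℝ) := by
  apply continuous_pi
  intro i
  by_cases hj : i ∈ range q
  · obtain ⟨a, rfl⟩ := hj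
    simp only [Ez_apply hq]; exact continuous_apply a
  · simp only [Ez_zero _ hj]; exact continuous_const

theorem Ez_join (hq : Function.Injective q) {τ β : ι → ℕ} {τ' β' : κ → ℕ} (h : ∀ a b, τ' a < τ' b ↔ τ (q a) < τ (q b))
    (h' : ∀ a b, β' a < β' b ↔ β (q a) < β (q b)) {v v' : κ → ℝ} (hj : JoinedIn (U τ' β') v v') :
    JoinedIn (U τ β) (Ez q v) (Ez q v') := by
  refine (hj.map (Ez_continuous hq)).mono ?_
  rintro _ ⟨x, hx, rfl⟩
  exact (Ez_mem hq h h' x).2 hx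

theorem Ez_v2 (hq : Function.Injective q) (a b : κ) (x y : ℝ) : Ez q (v2 a b x y) = v2 (q a) (q b) x y := by
  ext i
  by_cases hj : i ∈ range q
  · obtain ⟨k, rfl⟩ := hj
    rw [Ez_apply hq]
    simp [v2, Pi.single_apply, hq.eq_iff]
  · rw [Ez_zero _ hj]
    have h1 : i ≠ q a := fun h => hj ⟨a, h.symm⟩
    have h2 : i ≠ q b := fun h => hj ⟨b, h.symm⟩
    simp [v2, h1, h2]

theorem Ez_restrict (hq : Function.Injective q) {L : ι → ℝ} (h : ∀ i, i ∉ range q → L i = 0) : Ez q (fun a => L (q a)) = L := by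
  ext i
  by_cases hj : i ∈ range q
  · obtain ⟨k, rfl⟩ := hj
    rw [Ez_apply hq]
  · rw [Ez_zero _ hj, h i hj]

/-- All uniquely ergodic vectors on a face of Rauzy type are joined. -/
theorem face_join {τ β : ι → ℕ} {q : Fin 4 → ι} (hq : Function.Injective q) (s : Fin 7)
    (h : ∀ a b, tp s a < tp s b ↔ τ (q a) < τ (q b))
    (h' : ∀ a b, bp s a < bp s b ↔ β (q a) < β (q b)) {v v' : ι → ℝ} (hv : v ∈ U τ β) (hv' : v' ∈ U τ β)
    (hs : ∀ i, i ∉ range q → v i = 0) (hs' : ∀ i, i ∉ range q → v' i = 0) : JoinedIn (U τ β) v v' := by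
  have hv2 : Ez q (fun a => v (q a)) ∈ U τ β := by rw [Ez_restrict hq hs]; exact hv
  have hv2' : Ez q (fun a => v' (q a)) ∈ U τ β := by rw [Ez_restrict hq hs']; exact hv'
  rw [← Ez_restrict hq hs, ← Ez_restrict hq hs']
  have e1 := thmA s ((Ez_mem hq h h' _).1 hv2)
  have e2 := thmA s ((Ez_mem hq h h' _).1 hv2')
  exact Ez_join hq h h' (e1.trans e2.symm)
end restriction
end IET

set_option linter.unusedSectionVars false
set_option linter.unusedSimpArgs false
set_option linter.unusedVariables false
set_option linter.style.longLine false
namespace IET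
open Set Filter Topology

section bridge
variable {ι : Type*} [Fintype ι]

theorem partial_eq {τ : ι → ℕ} {L : ι → ℝ} (hτ : Function.Injective τ) (j : ι) :
    (∑ k, if τ k < τ j + 1 then L k else 0) = st τ L j + L j := by
  classical
  have : L j = ∑ k, if k = j then L k else 0 := by simp
  rw [st, this, ← Finset.sum_add_distrib]
  refine Finset.sum_congr rfl fun k _ => ?_
  by_cases hk : k = j
  · subst hk; simp
  · have : τ k ≠ τ j := fun h => hk (hτ h)
    have : τ k < τ j + 1 ↔ τ k < τ j := by omega
    simp [hk, this]

theorem partial_ne {τ : ι → ℕ} {L : ι → ℝ} {m : ℕ} (h : ∀ k, τ k ≠ m) :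
    (∑ k, if τ k < m + 1 then L k else 0) = ∑ k, if τ k < m then L k else 0 := by
  refine Finset.sum_congr rfl fun k _ => ?_
  have := h k
  have : τ k < m + 1 ↔ τ k < m := by omega
  simp [this]

theorem partial_tot (τ : ι → ℕ) (L : ι → ℝ) : ∃ m, (∑ k, if τ k < m then L k else 0) = tot L := by
  refine ⟨∑ k, (τ k + 1), Finset.sum_congr rfl fun k _ => ?_⟩
  have : τ k + 1 ≤ ∑ k, (τ k + 1) := Finset.single_le_sum (f := fun k => τ k + 1) (fun _ _ => Nat.zero_le _) (Finset.mem_univ k)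
  rw [if_pos (by omega)]

theorem exists_right {τ : ι → ℕ} {L : ι → ℝ} (hτ : Function.Injective τ) {x : ℝ} (h0 : 0 ≤ x)
    (h1 : x < tot L) : ∃ j, st τ L j ≤ x ∧ x < st τ L j + L j := by
  by_contra hc
  push Not at hc
  have : ∀ m : ℕ, (∑ k, if τ k < m then L k else 0) ≤ x := by
    intro m
    induction m with
    | zero => simpa using h0
    | succ m ih =>
      by_cases hk : ∃ k, τ k = m
      · obtain ⟨k, rfl⟩ := hk
        rw [partial_eq hτ]; exact hc k ih
      · push Not at hk
        rw [partial_ne hk]; exact ih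
  obtain ⟨m, hm⟩ := partial_tot τ L
  have := this m
  linarith

theorem exists_left {τ : ι → ℕ} {L : ι → ℝ} (hτ : Function.Injective τ) {x : ℝ} (h0 : 0 < x)
    (h1 : x ≤ tot L) : ∃ j, st τ L j < x ∧ x ≤ st τ L j + L j := by
  by_contra hc
  push Not at hc
  have : ∀ m : ℕ, (∑ k, if τ k < m then L k else 0) < x := by
    intro m
    induction m with
    | zero => simpa using h0
    | succ m ih =>
      by_cases hk : ∃ k, τ k = m
      · obtain ⟨k, rfl⟩ := hk
        rw [partial_eq hτ]; exact hc k ih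
      · push Not at hk
        rw [partial_ne hk]; exact ih
  obtain ⟨m, hm⟩ := partial_tot τ L
  have := this m
  linarith

theorem right_unique {τ : ι → ℕ} {L : ι → ℝ} (hτ : Function.Injective τ) (hL : ∀ i, 0 ≤ L i) {x : ℝ} {j k : ι}
    (hj : st τ L j ≤ x ∧ x < st τ L j + L j) (hk : st τ L k ≤ x ∧ x < st τ L k + L k) : j = k := by
  rcases lt_trichotomy (τ j) (τ k) with h | h | h
  · have := st_lt hL h; linarith [hj.2, hk.1]
  · exact hτ h
  · have := st_lt hL h; linarith [hj.1, hk.2]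

open Classical in
/-- the interval exchange, right-continuous version -/
noncomputable def gR (τ β : ι → ℕ) (L : ι → ℝ) (x : ℝ) : ℝ :=
  if h : ∃ j, st τ L j ≤ x ∧ x < st τ L j + L j then x - st τ L h.choose + st β L h.choose else x

open Classical in
/-- the interval exchange, left-continuous version -/
noncomputable def gL (τ β : ι → ℕ) (L : ι → ℝ) (x : ℝ) : ℝ :=
  if h : ∃ j, st τ L j < x ∧ x ≤ st τ L j + L j then x - st τ L h.choose + st β L h.choose else x

variable {τ β : ι → ℕ} {L : ι → ℝ}

theorem gR_eq (hτ : Function.Injective τ) (hL : ∀ i, 0 ≤ L i) {x : ℝ} {j : ι}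
    (hj : st τ L j ≤ x ∧ x < st τ L j + L j) : gR τ β L x = x - st τ L j + st β L j := by
  have h : ∃ j, st τ L j ≤ x ∧ x < st τ L j + L j := ⟨j, hj⟩
  rw [gR, dif_pos h, right_unique hτ hL h.choose_spec hj]

theorem gL_spec (hτ : Function.Injective τ) {x : ℝ} (h0 : 0 < x) (h1 : x ≤ tot L) :
    ∃ j, st τ L j < x ∧ x ≤ st τ L j + L j ∧ gL τ β L x = x - st τ L j + st β L j := by
  have h := exists_left (L := L) hτ h0 h1
  exact ⟨h.choose, h.choose_spec.1, h.choose_spec.2, by rw [gL, dif_pos h]⟩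

theorem gR_mapsTo (hτ : Function.Injective τ) (hL : ∀ i, 0 ≤ L i) :
    MapsTo (gR τ β L) (Ico 0 (tot L)) (Ico 0 (tot L)) := by
  intro x hx
  obtain ⟨j, hj⟩ := exists_right hτ hx.1 hx.2
  rw [gR_eq hτ hL hj]
  have := st_nonneg (τ := β) hL j
  have := st_add_le (τ := β) hL j
  constructor <;> linarith [hj.1, hj.2]

theorem gL_mapsTo (hτ : Function.Injective τ) (hL : ∀ i, 0 ≤ L i) :
    MapsTo (gL τ β L) (Ioc 0 (tot L)) (Ioc 0 (tot L)) := by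
  intro x hx
  obtain ⟨j, hj, hj', e⟩ := gL_spec (β := β) hτ hx.1 hx.2
  rw [e]
  have := st_nonneg (τ := β) hL j
  have := st_add_le (τ := β) hL j
  constructor <;> linarith

/-- The two versions agree just to the left of any point. -/
theorem gR_near (hτ : Function.Injective τ) (hL : ∀ i, 0 ≤ L i) {x : ℝ} (hx : x ∈ Ioc 0 (tot L)) (k : ℕ) :
    ∀ᶠ δ in 𝓝[>] (0:ℝ), (gR τ β L)^[k] (x - δ) = (gL τ β L)^[k] x - δ := by
  induction k with
  | zero => simp
  | succ k ih =>
    have hy := (gL_mapsTo (β := β) hτ hL).iterate k hx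
    obtain ⟨j, hj, hj', e⟩ := gL_spec (β := β) hτ hy.1 hy.2
    have h2 : ∀ᶠ δ in 𝓝[>] (0:ℝ), δ ∈ Ioo 0 ((gL τ β L)^[k] x - st τ L j) :=
      Ioo_mem_nhdsGT (by linarith)
    filter_upwards [ih, h2] with δ h3 h4
    rw [Function.iterate_succ_apply', Function.iterate_succ_apply', h3, e,
      gR_eq hτ hL (j := j) ⟨by linarith [h4.2], by linarith [h4.1]⟩]
    ring

theorem no_periodic (hτ : Function.Injective τ) (hL : ∀ i, 0 ≤ L i) (ht : tot L = 1)
    (hU : ∀ μ : Measure ℝ, IsProbabilityMeasure μ → μ (Set.Ico (0:ℝ) 1)ᶜ = 0 →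
      (∀ A : Set ℝ, MeasurableSet A → μ ((gR τ β L) ⁻¹' A) = μ A) →
      μ = volume.restrict (Set.Ico (0:ℝ) 1)) {x : ℝ} (hx : x ∈ Ico (0:ℝ) 1) {p : ℕ} (hp : 0 < p) :
    (gR τ β L)^[p] x ≠ x := by
  intro hper
  set g := gR τ β L with hg
  have hp0 : (p : ENNReal) ≠ 0 := by simpa using hp.ne'
  have hpt : (p : ENNReal) ≠ ⊤ := by simp
  set μ : Measure ℝ := (p : ENNReal)⁻¹ • ∑ k ∈ Finset.range p, Measure.dirac (g^[k] x) with hμ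
  have hap : ∀ A : Set ℝ, μ A = (p : ENNReal)⁻¹ * ∑ k ∈ Finset.range p, A.indicator 1 (g^[k] x) := by
    intro A
    simp [hμ, Measure.dirac_apply]
  have hmaps := gR_mapsTo (β := β) hτ hL
  rw [ht] at hmaps
  have hin : ∀ k, g^[k] x ∈ Ico (0:ℝ) 1 := fun k => hmaps.iterate k hx
  have h := hU μ ⟨by
    rw [hap]; simp [ENNReal.inv_mul_cancel hp0 hpt]⟩ (by
    rw [hap]; simp [indicator, hin]) (by
    intro A hA
    rw [hap, hap]
    congr 1
    have e : ∀ k, (g ⁻¹' A).indicator (1 : ℝ → ENNReal) (g^[k] x) = A.indicator 1 (g^[k + 1] x) := by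
      intro k; rw [Function.iterate_succ_apply']; rfl
    simp only [e]
    have h1 := Finset.sum_range_succ' (fun k => A.indicator (1 : ℝ → ENNReal) (g^[k] x)) p
    have h2 := Finset.sum_range_succ (fun k => A.indicator (1 : ℝ → ENNReal) (g^[k] x)) p
    rw [h1, hper] at h2
    simp only [Function.iterate_zero, id] at h2
    have hfin : A.indicator (1 : ℝ → ENNReal) x ≠ ⊤ := by
      by_cases hxA : x ∈ A <;> simp [hxA]
    exact (ENNReal.add_left_inj hfin).1 h2)
  have h3 : μ {x} = 0 := by rw [h]; simp
  rw [hap, mul_eq_zero] at h3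
  rcases h3 with h3 | h3
  · simp at h3
  · rw [Finset.sum_eq_zero_iff] at h3
    have := h3 0 (by simpa using hp)
    simp at this

/-- a positive invariant jump forces a periodic point -/
theorem periodic_of_atom {T : ℝ → ℝ} {S : Set ℝ} (hT : MapsTo T S S) {μ : Measure ℝ} (hS : μ S ≠ ⊤)
    {J : ℝ → ℝ} (hJ : ∀ x ∈ S, J (T x) = J x) (hμ : ∀ x, ENNReal.ofReal (J x) ≤ μ {x}) {x : ℝ} (hx : x ∈ S)
    (hpos : 0 < J x) : ∃ y ∈ S, ∃ p, 0 < p ∧ T^[p] y = y := by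
  by_contra hc
  push Not at hc
  have hin : ∀ k, T^[k] x ∈ S := fun k => hT.iterate k hx
  have hJk : ∀ k, J (T^[k] x) = J x := by
    intro k
    induction k with
    | zero => rfl
    | succ k ih => rw [Function.iterate_succ_apply', hJ _ (hin k), ih]
  have hinj : Function.Injective (fun k => T^[k] x) := by
    have : ∀ m n, m < n → T^[m] x ≠ T^[n] x := by
      intro m n hmn he
      refine hc _ (hin m) (n - m) (by omega) ?_
      rw [← Function.iterate_add_apply, Nat.sub_add_cancel hmn.le, he]
    intro m n he
    rcases lt_trichotomy m n with h | h | h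
    · exact absurd he (this _ _ h)
    · exact h
    · exact absurd he.symm (this _ _ h)
  have h1 : μ (⋃ k : ℕ, {T^[k] x}) = ∑' k, μ {T^[k] x} :=
    measure_iUnion (fun m n hmn => by
      simpa using fun h => hmn (hinj h)) (fun k => measurableSet_singleton _)
  have h2 : μ (⋃ k : ℕ, {T^[k] x}) ≤ μ S := measure_mono (by
    intro y hy; simp only [mem_iUnion, mem_singleton_iff] at hy; obtain ⟨k, rfl⟩ := hy; exact hin k)
  have h3 : ∑' k : ℕ, ENNReal.ofReal (J x) ≤ ∑' k : ℕ, μ {T^[k] x} :=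
    ENNReal.tsum_le_tsum fun k => by rw [← hJk k]; exact hμ _
  rw [ENNReal.tsum_const_eq_top_of_ne_zero (by simpa using hpos)] at h3
  exact hS (top_le_iff.1 (h3.trans (h1 ▸ h2)))

end bridge
end IET

set_option linter.unusedSectionVars false
set_option linter.unusedSimpArgs false
set_option linter.unusedVariables false
set_option linter.style.longLine false
namespace IET
open Set Filter Topology

section bridge
variable {ι : Type*} [Fintype ι] {τ β : ι → ℕ} {L : ι → ℝ}

/-- unique ergodicity in terms of measures -/
def UEM (T : ℝ → ℝ) : Prop :=
  ∀ μ : Measure ℝ, IsProbabilityMeasure μ → μ (Set.Ico (0:ℝ) 1)ᶜ = 0 →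
    (∀ A : Set ℝ, MeasurableSet A → μ (T ⁻¹' A) = μ A) →
    μ = volume.restrict (Set.Ico (0:ℝ) 1)

theorem gR_preimage (hτ : Function.Injective τ) (hβ : Function.Injective β) (hL : ∀ i, 0 ≤ L i)
    (ht : tot L = 1) (j : ι) {u : ℝ} (h0 : 0 ≤ u) (h1 : u ≤ L j) :
    gR τ β L ⁻¹' (Ico (st β L j) (st β L j + u)) ∩ Ico 0 1 = Ico (st τ L j) (st τ L j + u) := by
  ext x
  simp only [mem_inter_iff, mem_preimage, mem_Ico]
  constructor
  · rintro ⟨h2, h3⟩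
    obtain ⟨k, hk⟩ := exists_right (L := L) hτ h3.1 (by rw [ht]; exact h3.2)
    rw [gR_eq hτ hL hk] at h2
    have : k = j := right_unique hβ hL (x := x - st τ L k + st β L k) ⟨by linarith, by linarith⟩
      ⟨h2.1, by linarith⟩
    subst this
    constructor <;> linarith
  · intro h
    have hj : st τ L j ≤ x ∧ x < st τ L j + L j := ⟨h.1, by linarith⟩
    rw [gR_eq hτ hL hj]
    have := st_nonneg (τ := τ) hL j
    have := st_add_le (τ := τ) hL j
    refine ⟨⟨?_, ?_⟩, ?_, ?_⟩ <;> linarith [h.1, h.2]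

theorem UEM_of_UEF (hτ : Function.Injective τ) (hβ : Function.Injective β) (hL : ∀ i, 0 ≤ L i)
    (ht : tot L = 1) (hU : UEF τ β L) : UEM (gR τ β L) := by
  intro μ hμ hc hinv
  have hI : ∀ A : Set ℝ, μ (A ∩ Ico 0 1) = μ A := fun A => by
    exact measure_inter_conull hc
  set F : ℝ → ℝ := fun x => μ.real (Ico 0 x) with hF
  have hdiff : ∀ a b, 0 ≤ a → a ≤ b → F b - F a = μ.real (Ico a b) := by
    intro a b h0 hab
    have : Ico 0 b = Ico 0 a ∪ Ico a b := (Ico_union_Ico_eq_Ico h0 hab).symm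
    simp only [hF]
    rw [this, measureReal_union (by
      rw [Set.disjoint_left]; rintro x ⟨_, h1⟩ ⟨h2, _⟩; linarith) measurableSet_Ico]
    ring
  have hF1 : F 1 = 1 := by
    have := hI univ
    rw [univ_inter, measure_univ] at this
    simp [hF, Measure.real, this]
  have key := hU F (fun a ha b hb hab => by
      have := hdiff a b ha.1 hab
      have := measureReal_nonneg (μ := μ) (s := Ico a b); linarith) (by simp [hF]) (by
    intro j u h0 h1
    have b0 := st_nonneg (τ := τ) hL j
    have b1 := st_nonneg (τ := β) hL j
    rw [hdiff _ _ b1 (by linarith), hdiff _ _ b0 (by linarith)]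
    rw [Measure.real, Measure.real, ← hinv _ measurableSet_Ico, ← hI, gR_preimage hτ hβ hL ht j h0 h1])
  rw [ht, hF1] at key
  refine Measure.ext_of_Ico _ _ fun a b hab => ?_
  rw [← hI, Measure.restrict_apply measurableSet_Ico, Ico_inter_Ico]
  rcases le_or_gt (b ⊓ 1) (a ⊔ 0) with h | h
  · rw [Ico_eq_empty (not_lt.2 h)]; simp
  · have h0 : 0 ≤ a ⊔ 0 := le_sup_right
    have h1 : b ⊓ 1 ≤ 1 := inf_le_right
    have e := hdiff _ _ h0 h.le
    have k1 := key (a ⊔ 0) ⟨h0, by linarith⟩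
    have k2 := key (b ⊓ 1) ⟨by linarith, h1⟩
    rw [Real.volume_Ico, ← ofReal_measureReal, ← e]
    congr 1; linarith

theorem leftLim_inv {G : ℝ → ℝ} (hG : Monotone G) (hi : Inv τ β L G) {j : ι} {x : ℝ} (hx : st τ L j < x)
    (hx' : x ≤ st τ L j + L j) :
    G (x - st τ L j + st β L j) - Function.leftLim G (x - st τ L j + st β L j) = G x - Function.leftLim G x := by
  set t := - st τ L j + st β L j with htdef
  set c := G (st β L j) - G (st τ L j) with hc
  have e1 : x - st τ L j + st β L j = x + t := by rw [htdef]; ring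
  have key : ∀ y, st τ L j ≤ y → y ≤ x → G (y + t) = G y + c := by
    intro y h1 h2
    have := hi j (y - st τ L j) (by linarith) (by linarith)
    rw [show st β L j + (y - st τ L j) = y + t by rw [htdef]; ring,
      show st τ L j + (y - st τ L j) = y by ring] at this
    rw [hc]; linarith
  rw [e1, key x hx.le le_rfl]
  have hl := hG.tendsto_leftLim (x + t)
  have hm : Tendsto (fun y => y + t) (𝓝[<] x) (𝓝[<] (x + t)) := by
    refine tendsto_nhdsWithin_iff.2 ⟨?_, ?_⟩
    · exact (Continuous.tendsto (by fun_prop) x).mono_left nhdsWithin_le_nhds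
    · filter_upwards [self_mem_nhdsWithin] with y hy
      simp only [mem_Iio] at hy ⊢; linarith
  have h2 : Tendsto (fun y => G y + c) (𝓝[<] x) (𝓝 (Function.leftLim G (x + t))) := by
    refine (hl.comp hm).congr' ?_
    filter_upwards [Ioo_mem_nhdsLT hx] with y hy
    exact key y hy.1.le hy.2.le
  have h3 := (hG.tendsto_leftLim x).add_const c
  rw [tendsto_nhds_unique h2 h3]
  ring

/-- A monotone quasi-invariant function of a uniquely ergodic exchange has no left jumps. -/
theorem leftLim_eq (hτ : Function.Injective τ) (hL : ∀ i, 0 ≤ L i) (ht : tot L = 1)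
    (hU : UEM (gR τ β L)) {G : ℝ → ℝ} (hG : Monotone G) (hi : Inv τ β L G) {x : ℝ} (hx : x ∈ Ioc (0:ℝ) 1) :
    Function.leftLim G x = G x := by
  by_contra hne
  have hpos : 0 < G x - Function.leftLim G x := by
    have := hG.leftLim_le (le_refl x)
    have := lt_of_le_of_ne this hne
    linarith
  have hmaps := gL_mapsTo (β := β) hτ hL
  rw [ht] at hmaps
  obtain ⟨y, hy, p, hp, hper⟩ := periodic_of_atom hmaps (μ := hG.stieltjesFunction.measure)
    (J := fun x => G x - Function.leftLim G x) (by
      exact measure_Ioc_lt_top.ne) (by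
      intro y hy
      obtain ⟨j, h1, h2, e⟩ := gL_spec (L := L) (β := β) hτ hy.1 (by rw [ht]; exact hy.2)
      simp only [e]
      exact leftLim_inv hG hi h1 h2) (by
      intro y
      rw [StieltjesFunction.measure_singleton]
      apply ENNReal.ofReal_le_ofReal
      have e1 : Function.leftLim hG.stieltjesFunction y = Function.leftLim G y :=
        leftLim_rightLim (hG.tendsto_leftLim y)
      have e2 : hG.stieltjesFunction y = Function.rightLim G y := rfl
      rw [e1, e2]
      have := hG.le_rightLim (le_refl y)
      linarith) hx hpos
  have h1 := gR_near (β := β) hτ hL (x := y) (by rw [ht]; exact hy) p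
  have h2 : ∀ᶠ δ in 𝓝[>] (0:ℝ), δ ∈ Ioo 0 y := Ioo_mem_nhdsGT hy.1
  obtain ⟨δ, h3, h4⟩ := (h1.and h2).exists
  rw [hper] at h3
  exact no_periodic hτ hL ht hU (x := y - δ) ⟨by linarith [h4.2], by linarith [h4.1, hy.2]⟩ hp h3

theorem translate_eq {μ : Measure ℝ} {a b l : ℝ}
    (h : ∀ u v, 0 ≤ u → u ≤ v → v ≤ l → μ (Ico (b + u) (b + v)) = μ (Ico (a + u) (a + v)))
    [IsLocallyFiniteMeasure μ] {A : Set ℝ} (hA : MeasurableSet A) :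
    μ ((fun x => x - a + b) ⁻¹' A ∩ Ico a (a + l)) = μ (A ∩ Ico b (b + l)) := by
  have hm : Measurable (fun x : ℝ => x - a + b) := by fun_prop
  have : μ.restrict (Ico b (b + l)) = (μ.restrict (Ico a (a + l))).map (fun x => x - a + b) := by
    refine Measure.ext_of_Ico _ _ fun c d hcd => ?_
    rw [Measure.map_apply hm measurableSet_Ico, Measure.restrict_apply measurableSet_Ico,
      Measure.restrict_apply (hm measurableSet_Ico)]
    have e : (fun x : ℝ => x - a + b) ⁻¹' Ico c d = Ico (c + a - b) (d + a - b) := by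
      ext x; simp only [mem_preimage, mem_Ico]
      constructor <;> rintro ⟨h1, h2⟩ <;> constructor <;> linarith
    rw [e, Ico_inter_Ico, Ico_inter_Ico]
    have e1 : (c + a - b) ⊔ a = a + (c ⊔ b - b) := by
      rcases le_total c b with h | h
      · rw [sup_eq_right.2 h, sup_eq_right.2 (by linarith)]; ring
      · rw [sup_eq_left.2 h, sup_eq_left.2 (by linarith)]; ring
    have e2 : (d + a - b) ⊓ (a + l) = a + (d ⊓ (b + l) - b) := by
      rcases le_total d (b + l) with h | h
      · rw [inf_eq_left.2 h, inf_eq_left.2 (by linarith)]; ring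
      · rw [inf_eq_right.2 h, inf_eq_right.2 (by linarith)]; ring
    rw [e1, e2]
    have h1 : b ≤ c ⊔ b := le_sup_right
    have h2 : d ⊓ (b + l) ≤ b + l := inf_le_right
    rcases le_or_gt (d ⊓ (b + l)) (c ⊔ b) with h3 | h3
    · rw [Ico_eq_empty (not_lt.2 h3), Ico_eq_empty (not_lt.2 (by linarith))]
    · rw [← h _ _ (by linarith) (by linarith) (by linarith)]
      congr 2 <;> ring
  have h2 : μ.restrict (Ico b (b + l)) A = _ := congrArg (fun ν : Measure ℝ => ν A) this
  rw [Measure.map_apply hm hA, Measure.restrict_apply hA, Measure.restrict_apply (hm hA)] at h2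
  exact h2.symm

theorem measure_split {τ : ι → ℕ} (hτ : Function.Injective τ) (hL : ∀ i, 0 ≤ L i) (ht : tot L = 1) (μ : Measure ℝ)
    (A : Set ℝ) (hA : ∀ j, MeasurableSet (A ∩ Ico (st τ L j) (st τ L j + L j))) :
    μ (A ∩ Ico 0 1) = ∑ j, μ (A ∩ Ico (st τ L j) (st τ L j + L j)) := by
  have e : A ∩ Ico 0 1 = ⋃ j, A ∩ Ico (st τ L j) (st τ L j + L j) := by
    rw [← inter_iUnion]
    congr 1
    ext x
    simp only [mem_iUnion, mem_Ico]
    constructor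
    · rintro ⟨h0, h1⟩
      exact exists_right hτ h0 (by rw [ht]; exact h1)
    · rintro ⟨j, h1, h2⟩
      have := st_nonneg (τ := τ) hL j
      have := st_add_le (τ := τ) hL j
      constructor <;> linarith
  rw [e, measure_iUnion ?_ hA, tsum_fintype]
  intro j k hjk
  rw [Function.onFun, Set.disjoint_left]
  rintro x ⟨_, h1⟩ ⟨_, h2⟩
  exact hjk (right_unique hτ hL h1 h2)

theorem UEF_of_UEM (hτ : Function.Injective τ) (hβ : Function.Injective β) (hL : ∀ i, 0 ≤ L i)
    (ht : tot L = 1) (hU : UEM (gR τ β L)) : UEF τ β L := by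
  have main : ∀ G : ℝ → ℝ, Monotone G → G 0 = 0 → G 1 = 1 → (∀ x ≤ 0, G x = 0) → Inv τ β L G →
      ∀ x ∈ Icc (0:ℝ) 1, G x = x := by
    intro G hG h0 h1 hneg hi
    set μ := hG.stieltjesFunction.measure with hμ
    have hll : ∀ x ∈ Icc (0:ℝ) 1, Function.leftLim hG.stieltjesFunction x = G x := by
      intro x hx
      have e1 : Function.leftLim hG.stieltjesFunction x = Function.leftLim G x :=
        leftLim_rightLim (hG.tendsto_leftLim x)
      rw [e1]
      rcases hx.1.eq_or_lt with h | h
      · rw [← h, h0]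
        apply leftLim_eq_of_tendsto
        · refine (tendsto_const_nhds (x := (0:ℝ))).congr' ?_
          filter_upwards [self_mem_nhdsWithin] with y hy
          exact (hneg y (le_of_lt hy)).symm
      · exact leftLim_eq hτ hL ht hU hG hi ⟨h, hx.2⟩
    have hIco : ∀ a b, 0 ≤ a → a ≤ b → b ≤ 1 → μ (Ico a b) = ENNReal.ofReal (G b - G a) := by
      intro a b ha hab hb
      rw [hμ, StieltjesFunction.measure_Ico, hll b ⟨by linarith, hb⟩, hll a ⟨ha, by linarith⟩]
    have hres := hU (μ.restrict (Ico 0 1)) ⟨by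
      rw [Measure.restrict_apply_univ, hIco 0 1 le_rfl zero_le_one le_rfl, h0, h1]; simp⟩ (by
      rw [Measure.restrict_apply measurableSet_Ico.compl]; simp) (by
      intro A hA
      rw [Measure.restrict_apply' measurableSet_Ico, Measure.restrict_apply' measurableSet_Ico]
      have hloc : ∀ j, gR τ β L ⁻¹' A ∩ Ico (st τ L j) (st τ L j + L j)
          = (fun x => x - st τ L j + st β L j) ⁻¹' A ∩ Ico (st τ L j) (st τ L j + L j) := by
        intro j
        ext x
        simp only [mem_inter_iff, mem_preimage, and_congr_left_iff]
        intro hx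
        rw [gR_eq hτ hL hx]
      rw [measure_split hτ hL ht μ _ (fun j => by
          rw [hloc]
          exact (Measurable.comp (measurable_id.add_const _) (measurable_id.sub_const _) hA).inter measurableSet_Ico),
        measure_split hβ hL ht μ A (fun j => hA.inter measurableSet_Ico)]
      refine Finset.sum_congr rfl fun j _ => ?_
      rw [hloc]
      refine translate_eq ?_ hA
      intro u v hu huv hv
      have b0 := st_nonneg (τ := τ) hL j
      have b1 := st_nonneg (τ := β) hL j
      have b2 := st_add_le (τ := τ) hL j
      have b3 := st_add_le (τ := β) hL j
      rw [hIco _ _ (by linarith) (by linarith) (by linarith), hIco _ _ (by linarith) (by linarith) (by linarith)]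
      have k1 := hi j u hu (by linarith)
      have k2 := hi j v (by linarith) hv
      congr 1; linarith)
    intro x hx
    have h2 : μ.restrict (Ico 0 1) (Ico 0 x) = volume.restrict (Ico 0 1) (Ico 0 x) := by rw [hres]
    have e : Ico 0 x ∩ Ico (0:ℝ) 1 = Ico 0 x := by
      rw [inter_eq_left]; exact Ico_subset_Ico_right hx.2
    rw [Measure.restrict_apply measurableSet_Ico, Measure.restrict_apply measurableSet_Ico, e,
      hIco 0 x le_rfl hx.1 hx.2, Real.volume_Ico, h0, sub_zero, sub_zero] at h2
    have hGx : 0 ≤ G x := by rw [← h0]; exact hG hx.1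
    exact (ENNReal.ofReal_eq_ofReal_iff hGx hx.1).1 h2
  intro F hm h0 hi x hx
  rw [ht] at hm hx ⊢
  have hF1 : 0 ≤ F 1 := by
    have := hm (left_mem_Icc.2 zero_le_one) (right_mem_Icc.2 zero_le_one) zero_le_one
    linarith
  rcases hF1.eq_or_lt with hz | hpos
  · have a1 := hm (left_mem_Icc.2 zero_le_one) hx hx.1
    have a2 := hm hx (right_mem_Icc.2 zero_le_one) hx.2
    have : F x = 0 := by linarith
    rw [this, ← hz]; ring
  · have hcl : ∀ y : ℝ, 0 ≤ y → y ≤ 1 → max 0 (min y 1) = y := by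
      intro y h1 h2; rw [min_eq_left h2, max_eq_right h1]
    have := main (fun y => F (max 0 (min y 1)) / F 1) (by
      intro a b hab
      have : F (max 0 (min a 1)) ≤ F (max 0 (min b 1)) := by
        apply hm ⟨le_max_left _ _, max_le zero_le_one (min_le_right _ _)⟩
          ⟨le_max_left _ _, max_le zero_le_one (min_le_right _ _)⟩
        gcongr
      exact div_le_div_of_nonneg_right this hpos.le) (by simp [h0]) (by simp [hpos.ne']) (by
      intro y hy
      rw [min_eq_left (by linarith), max_eq_left hy, h0, zero_div]) (by
      intro j u hu huL
      have b0 := st_nonneg (τ := τ) hL j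
      have b1 := st_nonneg (τ := β) hL j
      have b2 := st_add_le (τ := τ) hL j
      have b3 := st_add_le (τ := β) hL j
      simp only
      rw [hcl _ (by linarith) (by linarith), hcl _ (by linarith) (by linarith),
        hcl _ (by linarith) (by linarith), hcl _ (by linarith) (by linarith)]
      have := hi j u hu huL
      rw [← sub_div, ← sub_div, this]) x hx
    simp only [hcl x hx.1 hx.2] at this
    rw [div_eq_iff hpos.ne'] at this
    rw [this]; ring

end bridge
end IET

set_option linter.unusedSectionVars false
set_option linter.unusedSimpArgs false
set_option linter.unusedVariables false
set_option linter.style.longLine false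
namespace IET
open Set Filter Topology

/-- top position of the letters of the diagram -/
def posv : Fin 7 → Fin 4 → Fin 4 :=
  ![![0,1,2,3], ![0,1,2,3], ![0,1,2,3], ![0,1,3,2], ![0,2,3,1], ![0,3,1,2], ![0,2,3,1]]
/-- bottom position of the letters of the diagram -/
def botv : Fin 7 → Fin 4 → Fin 4 :=
  ![![3,2,1,0], ![1,3,2,0], ![2,1,3,0], ![1,3,2,0], ![3,2,1,0], ![3,2,1,0], ![2,3,1,0]]

theorem posv_inj : ∀ s, Function.Injective (posv s) := by decide
theorem tp_iff : ∀ s a b, tp s a < tp s b ↔ posv s a < posv s b := by decide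
theorem bp_iff : ∀ s a b, bp s a < bp s b ↔ botv s a < botv s b := by decide

/-- the permutations of Rauzy type as words -/
def isR (a b c e : Fin 4) : Prop := ∃ s : Fin 7, ∀ k, ![a, b, c, e] (posv s k) = botv s k
instance (a b c e : Fin 4) : Decidable (isR a b c e) := by unfold isR; infer_instance

theorem vec_eq (σ : Fin 4 → Fin 4) : ![σ 0, σ 1, σ 2, σ 3] = σ := by
  ext k; fin_cases k <;> rfl

theorem isR_of_mem {σ : Equiv.Perm (Fin 4)} (h : σ ∈ RauzyClass4321) : isR (σ 0) (σ 1) (σ 2) (σ 3) := by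
  have key : ∀ a b c e, (σ⁻¹ 0, σ⁻¹ 1, σ⁻¹ 2, σ⁻¹ 3) = (a, b, c, e) → σ a = 0 ∧ σ b = 1 ∧ σ c = 2 ∧ σ e = 3 := by
    intro a b c e h
    simp only [Prod.mk.injEq, Equiv.Perm.inv_eq_iff_eq] at h
    exact ⟨h.1.symm, h.2.1.symm, h.2.2.1.symm, h.2.2.2.symm⟩
  simp only [RauzyClass4321, Set.mem_ofPred_eq, mem_insert_iff, mem_singleton_iff] at h
  rcases h with h | h | h | h | h | h | h <;>
  · obtain ⟨h1, h2, h3, h4⟩ := key _ _ _ _ h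
    rw [h1, h2, h3, h4]; decide

set_option synthInstance.maxHeartbeats 400000 in
set_option synthInstance.maxSize 4000 in
set_option maxRecDepth 100000 in
theorem class_irr : ∀ a b c e : Fin 4, a ≠ b → a ≠ c → a ≠ e → b ≠ c → b ≠ e → c ≠ e → a ≠ 0 → (1 < a ∨ 1 < b) → e ≠ 3 →
    ¬ (a = 3 ∧ b = 1 ∧ c = 2 ∧ e = 0) →
    isR a b c e ∨ (a = 2 ∧ b = 3 ∧ c = 0 ∧ e = 1) ∨ (a = 3 ∧ b = 2 ∧ c = 0 ∧ e = 1) ∨ (a = 2 ∧ b = 3 ∧ c = 1 ∧ e = 0)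
      ∨ (a = 3 ∧ b = 0 ∧ c = 1 ∧ e = 2) ∨ (a = 1 ∧ b = 2 ∧ c = 3 ∧ e = 0) := by decide

theorem class_perm {σ : Equiv.Perm (Fin 4)} (h : PermIrreducible σ) (hs : σ ≠ Equiv.swap 0 3) :
    isR (σ 0) (σ 1) (σ 2) (σ 3) ∨ (⇑σ = ![2,3,0,1]) ∨ (⇑σ = ![3,2,0,1]) ∨ (⇑σ = ![2,3,1,0])
      ∨ (⇑σ = ![3,0,1,2]) ∨ (⇑σ = ![1,2,3,0]) := by
  have hne : ∀ a b : Fin 4, a ≠ b → σ a ≠ σ b := fun a b hab he => hab (σ.injective he)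
  have e : ∀ a b c e : Fin 4, σ 0 = a ∧ σ 1 = b ∧ σ 2 = c ∧ σ 3 = e → ⇑σ = ![a, b, c, e] := by
    rintro a b c e ⟨rfl, rfl, rfl, rfl⟩; exact (vec_eq σ).symm
  have h1 : σ 0 ≠ 0 := by
    obtain ⟨i, hi, hi'⟩ := h 1 (by omega) (by omega)
    have : i = 0 := by ext; simp; omega
    subst this
    intro h0; rw [h0] at hi'; simp at hi'
  have h2 : 1 < σ 0 ∨ 1 < σ 1 := by
    obtain ⟨i, hi, hi'⟩ := h 2 (by omega) (by omega)
    have : i = 0 ∨ i = 1 := by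
      revert hi; clear hi'; revert i; decide
    rcases this with rfl | rfl
    · left; rw [Fin.lt_def]; exact hi'
    · right; rw [Fin.lt_def]; exact hi'
  have h3 : σ 3 ≠ 3 := by
    obtain ⟨i, hi, hi'⟩ := h 3 (by omega) (by omega)
    intro h0
    have h4 : σ i = 3 := by ext; have := (σ i).isLt; simp; omega
    have : i = 3 := σ.injective (h4.trans h0.symm)
    subst this; simp at hi
  have h4 : ¬ (σ 0 = 3 ∧ σ 1 = 1 ∧ σ 2 = 2 ∧ σ 3 = 0) := by
    intro h4
    apply hs
    have := e _ _ _ _ h4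
    ext k : 1
    rw [this]
    revert k; decide
  have := class_irr _ _ _ _ (hne 0 1 (by decide)) (hne 0 2 (by decide)) (hne 0 3 (by decide)) (hne 1 2 (by decide))
    (hne 1 3 (by decide)) (hne 2 3 (by decide)) h1 h2 h3 h4
  rcases this with h | h | h | h | h | h
  · exact Or.inl h
  · exact Or.inr (Or.inl (e _ _ _ _ h))
  · exact Or.inr (Or.inr (Or.inl (e _ _ _ _ h)))
  · exact Or.inr (Or.inr (Or.inr (Or.inl (e _ _ _ _ h))))
  · exact Or.inr (Or.inr (Or.inr (Or.inr (Or.inl (e _ _ _ _ h)))))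
  · exact Or.inr (Or.inr (Or.inr (Or.inr (Or.inr (e _ _ _ _ h)))))

section mixed
variable {ι : Type*} [Fintype ι] [DecidableEq ι] {τ β : ι → ℕ}

/-- All uniquely ergodic vectors on a Rauzy face are joined. -/
theorem face_join_perm {u : Fin 4 → ι} (hu : StrictMono (τ ∘ u)) {σ : Fin 4 → Fin 4}
    (hσ : ∀ a b, σ a < σ b ↔ β (u a) < β (u b)) (hR : isR (σ 0) (σ 1) (σ 2) (σ 3))
    {v v' : ι → ℝ} (hv : v ∈ U τ β) (hv' : v' ∈ U τ β)
    (hs : ∀ i, i ∉ range u → v i = 0) (hs' : ∀ i, i ∉ range u → v' i = 0) : JoinedIn (U τ β) v v' := by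
  obtain ⟨s, h⟩ := hR
  rw [vec_eq] at h
  have hr : range (u ∘ posv s) = range u :=
    ((Finite.injective_iff_surjective.1 (posv_inj s))).range_comp u
  have hinj : Function.Injective u := fun a b hab => hu.injective (by simp [hab])
  refine face_join (q := u ∘ posv s) (hinj.comp (posv_inj s)) s ?_ ?_ hv hv' (by rwa [hr]) (by rwa [hr])
  · intro a b
    rw [tp_iff]; exact hu.lt_iff_lt.symm
  · intro a b
    rw [bp_iff, ← h, ← h]; exact hσ _ _

/-- some irrational vectors on two edges are joined -/
def Conn (τ β : ι → ℕ) (a b c e : ι) : Prop :=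
  ∃ x y : ℝ, 0 < x ∧ 0 < y ∧ Irrational (x / y) ∧ GE τ β (v2 a b x y) c e

theorem Conn.symm {a b c e : ι} (h : Conn τ β a b c e) : Conn τ β c e a b := by
  obtain ⟨x, y, hx, hy, hi, x', y', hx', hy', hi', hj⟩ := h
  exact ⟨x', y', hx', hy', hi', x, y, hx, hy, hi, hj.symm⟩

theorem irr_s2 : Irrational (√2 / 1) := by simpa using irrational_sqrt_two

theorem Conn.of {a b c e : ι} (h1 : τ a < τ b) (h2 : β b < β a)
    (h : ∀ v, GE τ β v a b → GE τ β v c e) : Conn τ β a b c e :=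
  ⟨√2, 1, by positivity, one_pos, irr_s2, h _
    ⟨√2, 1, by positivity, one_pos, irr_s2, JoinedIn.refl (edge_mem h1 h2 (by positivity) one_pos irr_s2)⟩⟩

theorem v2_supp {S : Set ι} {a b : ι} (ha : a ∈ S) (hb : b ∈ S) (x y : ℝ) : ∀ i, i ∉ S → v2 a b x y i = 0 := by
  intro i hi
  have h1 : i ≠ a := fun h => hi (h ▸ ha)
  have h2 : i ≠ b := fun h => hi (h ▸ hb)
  simp [v2, h1, h2]

set_option synthInstance.maxHeartbeats 400000 in
set_option synthInstance.maxSize 4000 in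
set_option maxRecDepth 100000 in
theorem pairs1 : ∀ i j k l : Fin 4, (∀ m, m = i ∨ m = j ∨ m = k ∨ m = l) → i < j → k < l →
    (i = 0 ∧ j = 1 ∧ k = 2 ∧ l = 3) ∨ (i = 2 ∧ j = 3 ∧ k = 0 ∧ l = 1) ∨
    (i = 0 ∧ j = 2 ∧ k = 1 ∧ l = 3) ∨ (i = 1 ∧ j = 3 ∧ k = 0 ∧ l = 2) ∨
    (i = 0 ∧ j = 3 ∧ k = 1 ∧ l = 2) ∨ (i = 1 ∧ j = 2 ∧ k = 0 ∧ l = 3) := by decide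

theorem mixed_join {u : Fin 4 → ι} (hu : StrictMono (τ ∘ u)) {σ : Equiv.Perm (Fin 4)}
    (hσ : ∀ a b, σ a < σ b ↔ β (u a) < β (u b)) (hi : PermIrreducible σ) (hs : σ ≠ Equiv.swap 0 3)
    {i j k l : Fin 4} (hcov : ∀ m, m = i ∨ m = j ∨ m = k ∨ m = l) (hij : i < j) (hkl : k < l)
    (hr : σ j < σ i) (hr' : σ l < σ k) : Conn τ β (u i) (u j) (u k) (u l) := by
  have ht : ∀ {a b}, a < b → τ (u a) < τ (u b) := fun h => hu h
  have hb : ∀ {a b}, σ a < σ b → β (u a) < β (u b) := fun h => (hσ _ _).1 h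
  rcases class_perm hi hs with h | h | h | h | h | h
  · refine ⟨√2, 1, by positivity, one_pos, irr_s2, √2, 1, by positivity, one_pos, irr_s2, ?_⟩
    refine face_join_perm hu hσ h (edge_mem (ht hij) (hb hr) (by positivity) one_pos irr_s2)
      (edge_mem (ht hkl) (hb hr') (by positivity) one_pos irr_s2)
      (v2_supp (mem_range_self _) (mem_range_self _) _ _) (v2_supp (mem_range_self _) (mem_range_self _) _ _)
  · rw [h] at hb hr hr'
    have A : Conn τ β (u 0) (u 2) (u 1) (u 3) := by
      refine Conn.of (ht (by decide)) (hb (by decide)) fun v hv => ?_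
      have h1 : GE τ β v (u 1) (u 2) := hv.merge_ab (ht (by decide)) (ht (by decide)) (hb (by decide)) (hb (by decide))
      exact (h1.comm.swap.merge_ab (hb (by decide)) (hb (by decide)) (ht (by decide)) (ht (by decide))).swap.comm
    have B : Conn τ β (u 0) (u 3) (u 1) (u 2) := by
      refine Conn.of (ht (by decide)) (hb (by decide)) fun v hv => ?_
      have h1 : GE τ β v (u 1) (u 3) := hv.merge_ab (ht (by decide)) (ht (by decide)) (hb (by decide)) (hb (by decide))
      exact (h1.comm.swap.merge_ba (hb (by decide)) (hb (by decide)) (ht (by decide)) (ht (by decide))).swap.comm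
    rcases pairs1 i j k l hcov hij hkl with ⟨rfl, rfl, rfl, rfl⟩ | ⟨rfl, rfl, rfl, rfl⟩ | ⟨rfl, rfl, rfl, rfl⟩ |
      ⟨rfl, rfl, rfl, rfl⟩ | ⟨rfl, rfl, rfl, rfl⟩ | ⟨rfl, rfl, rfl, rfl⟩
    · exact absurd hr (by decide)
    · exact absurd hr (by decide)
    · exact A
    · exact A.symm
    · exact B
    · exact B.symm
  · rw [h] at hb hr hr'
    have A : Conn τ β (u 1) (u 3) (u 0) (u 2) := by
      refine Conn.of (ht (by decide)) (hb (by decide)) fun v hv => ?_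
      have h1 : GE τ β v (u 0) (u 3) := hv.flip_bc (ht (by decide)) (ht (by decide)) (hb (by decide)) (hb (by decide))
      exact (h1.comm.swap.merge_ba (hb (by decide)) (hb (by decide)) (ht (by decide)) (ht (by decide))).swap.comm
    have B : Conn τ β (u 1) (u 2) (u 0) (u 3) := by
      refine Conn.of (ht (by decide)) (hb (by decide)) fun v hv => ?_
      have h1 : GE τ β v (u 0) (u 2) := hv.flip_bc (ht (by decide)) (ht (by decide)) (hb (by decide)) (hb (by decide))
      exact (h1.comm.swap.merge_ab (hb (by decide)) (hb (by decide)) (ht (by decide)) (ht (by decide))).swap.comm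
    rcases pairs1 i j k l hcov hij hkl with ⟨rfl, rfl, rfl, rfl⟩ | ⟨rfl, rfl, rfl, rfl⟩ | ⟨rfl, rfl, rfl, rfl⟩ |
      ⟨rfl, rfl, rfl, rfl⟩ | ⟨rfl, rfl, rfl, rfl⟩ | ⟨rfl, rfl, rfl, rfl⟩
    · exact absurd hr' (by decide)
    · exact absurd hr (by decide)
    · exact A.symm
    · exact A
    · exact B.symm
    · exact B
  · rw [h] at hb hr hr'
    have A : Conn τ β (u 0) (u 2) (u 1) (u 3) := by
      refine Conn.of (ht (by decide)) (hb (by decide)) fun v hv => ?_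
      have h1 : GE τ β v (u 0) (u 3) := hv.flip_ab (ht (by decide)) (ht (by decide)) (hb (by decide)) (hb (by decide))
      exact h1.merge_ab (ht (by decide)) (ht (by decide)) (hb (by decide)) (hb (by decide))
    have B : Conn τ β (u 1) (u 2) (u 0) (u 3) := by
      refine Conn.of (ht (by decide)) (hb (by decide)) fun v hv => ?_
      have h1 : GE τ β v (u 1) (u 3) := hv.flip_ab (ht (by decide)) (ht (by decide)) (hb (by decide)) (hb (by decide))
      exact h1.merge_ba (ht (by decide)) (ht (by decide)) (hb (by decide)) (hb (by decide))
    rcases pairs1 i j k l hcov hij hkl with ⟨rfl, rfl, rfl, rfl⟩ | ⟨rfl, rfl, rfl, rfl⟩ | ⟨rfl, rfl, rfl, rfl⟩ |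
      ⟨rfl, rfl, rfl, rfl⟩ | ⟨rfl, rfl, rfl, rfl⟩ | ⟨rfl, rfl, rfl, rfl⟩
    · exact absurd hr (by decide)
    · exact absurd hr' (by decide)
    · exact A
    · exact A.symm
    · exact B.symm
    · exact B
  · rw [h] at hr hr'
    exfalso; clear hb ht hσ
    revert i j k l; decide
  · rw [h] at hr hr'
    exfalso; clear hb ht hσ
    revert i j k l; decide

end mixed

theorem ietMap_eq {d : ℕ} (π : Equiv.Perm (Fin d)) {L : Fin d → ℝ} (hL : ∀ i, 0 ≤ L i) :
    ietMap π L = gR (fun i => i.val) (fun i => (π i).val) L := by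
  have hτ : Function.Injective (fun i : Fin d => i.val) := Fin.val_injective
  have e1 : ∀ j : Fin d, (∑ k ∈ Finset.univ.filter (fun k => k < j), L k) = st (fun i : Fin d => i.val) L j := by
    intro j; rw [st, Finset.sum_filter]; rfl
  have e2 : ∀ j : Fin d, (∑ k ∈ Finset.univ.filter (fun k => π k < π j), L k) = st (fun i : Fin d => (π i).val) L j := by
    intro j; rw [st, Finset.sum_filter]; rfl
  funext x
  by_cases h : ∃ j : Fin d, (∑ k ∈ Finset.univ.filter (fun k => k < j), L k) ≤ x ∧
      x < (∑ k ∈ Finset.univ.filter (fun k => k < j), L k) + L j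
  · rw [ietMap, dif_pos h]
    have hs := h.choose_spec
    rw [e1] at hs
    rw [gR_eq hτ hL hs, e1, e2]
  · rw [ietMap, dif_neg h, gR, dif_neg]
    simpa only [e1] using h

theorem final_join (d : ℕ) (π : Equiv.Perm (Fin d))
    (p q : Fin 4 → Fin d) (hp : StrictMono p) (hq : StrictMono q)
    (hpR : RestrictsToRauzyClass π p) (hqR : RestrictsToRauzyClass π q)
    (hacc : AccessiblePair π p q) {LT LS : Fin d → ℝ}
    (hLT : LT ∈ U (fun i : Fin d => i.val) (fun i => (π i).val))
    (hLS : LS ∈ U (fun i : Fin d => i.val) (fun i => (π i).val))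
    (hLTsupp : ∀ i, i ∉ Set.range p → LT i = 0)
    (hLSsupp : ∀ i, i ∉ Set.range q → LS i = 0) :
    JoinedIn (U (fun i : Fin d => i.val) (fun i => (π i).val)) LT LS := by
  obtain ⟨σp, hσp, hrp⟩ := hpR
  obtain ⟨σq, hσq, hrq⟩ := hqR
  obtain ⟨r1, r2, s1, s2, hr, hs, -, ⟨u, hu, hru, σ, hσ, hirr, hne⟩, hp', hq'⟩ := hacc
  obtain ⟨i, hi⟩ : p r1 ∈ range u := by rw [hru]; simp
  obtain ⟨j, hj⟩ : p r2 ∈ range u := by rw [hru]; simp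
  obtain ⟨k, hk⟩ : q s1 ∈ range u := by rw [hru]; simp
  obtain ⟨l, hl⟩ : q s2 ∈ range u := by rw [hru]; simp
  have hcov : ∀ m, m = i ∨ m = j ∨ m = k ∨ m = l := by
    intro m
    have : u m ∈ range u := mem_range_self m
    rw [hru, ← hi, ← hj, ← hk, ← hl] at this
    simpa [hu.injective.eq_iff] using this
  have hC := mixed_join (τ := fun i : Fin d => i.val) (β := fun i => (π i).val) (u := u) (fun a b h => hu h) hσ hirr hne hcov
    (hu.lt_iff_lt.1 (by rw [hi, hj]; exact hp hr)) (hu.lt_iff_lt.1 (by rw [hk, hl]; exact hq hs))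
    ((hσ _ _).2 (by rw [hi, hj]; exact hp')) ((hσ _ _).2 (by rw [hk, hl]; exact hq'))
  rw [hi, hj, hk, hl] at hC
  obtain ⟨x, y, hx, hy, hxy, x', y', hx', hy', hxy', hjn⟩ := hC
  have m1 : v2 (p r1) (p r2) x y ∈ U (fun i : Fin d => i.val) (fun i => (π i).val) := hjn.source_mem
  have m2 := hjn.target_mem
  have j1 := face_join_perm (τ := fun i : Fin d => i.val) (β := fun i => (π i).val) (u := p) (fun a b h => hp h) hrp
    (isR_of_mem hσp) hLT m1 hLTsupp (v2_supp (mem_range_self _) (mem_range_self _) _ _)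
  have j2 := face_join_perm (τ := fun i : Fin d => i.val) (β := fun i => (π i).val) (u := q) (fun a b h => hq h) hrq
    (isR_of_mem hσq) hLS m2 hLSsupp (v2_supp (mem_range_self _) (mem_range_self _) _ _)
  exact (j1.trans hjn).trans j2.symm

end IET

/-- Two uniquely ergodic IETs supported on an accessible pair of `4`-tuples may be
joined by a path of uniquely ergodic IETs. -/
theorem joining_accessible (d : ℕ) (π : Equiv.Perm (Fin d)) (hπ : ¬ IETDegenerate π)
    (p q : Fin 4 → Fin d) (hp : StrictMono p) (hq : StrictMono q)
    (hpR : RestrictsToRauzyClass π p) (hqR : RestrictsToRauzyClass π q)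
    (hacc : AccessiblePair π p q)
    (LT LS : Fin d → ℝ)
    (hLTnn : ∀ i, 0 ≤ LT i) (hLTsum : ∑ i, LT i = 1)
    (hLSnn : ∀ i, 0 ≤ LS i) (hLSsum : ∑ i, LS i = 1)
    (hLTsupp : ∀ i, i ∉ Set.range p → LT i = 0)
    (hLSsupp : ∀ i, i ∉ Set.range q → LS i = 0)
    (hLTue : UniquelyErgodicOn01 (ietMap π LT))
    (hLSue : UniquelyErgodicOn01 (ietMap π LS)) :
    ∃ γ : Path LT LS, ∀ t : unitInterval,
      (∀ i, 0 ≤ γ t i) ∧ (∑ i, γ t i) = 1 ∧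
      UniquelyErgodicOn01 (ietMap π (γ t)) := by
  have hτ : Function.Injective (fun i : Fin d => i.val) := Fin.val_injective
  have hβ : Function.Injective (fun i : Fin d => (π i).val) := fun a b h => π.injective (Fin.val_injective h)
  have tT : IET.tot LT = 1 := hLTsum
  have tS : IET.tot LS = 1 := hLSsum
  rw [IET.ietMap_eq π hLTnn] at hLTue
  rw [IET.ietMap_eq π hLSnn] at hLSue
  have hT := IET.UEF_of_UEM hτ hβ hLTnn tT hLTue
  have hS := IET.UEF_of_UEM hτ hβ hLSnn tS hLSue
  have hJ := IET.final_join d π p q hp hq hpR hqR hacc ⟨hLTnn, by rw [tT]; exact one_pos, hT⟩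
    ⟨hLSnn, by rw [tS]; exact one_pos, hS⟩ hLTsupp hLSsupp
  obtain ⟨γ, hγ⟩ := hJ
  have hc : Continuous fun t : unitInterval => (IET.tot (γ t))⁻¹ • γ t := by
    refine Continuous.smul (Continuous.inv₀ ?_ fun t => (hγ t).2.1.ne') γ.continuous
    exact continuous_finsetSum _ fun i _ => (continuous_apply i).comp γ.continuous
  refine ⟨⟨⟨fun t => (IET.tot (γ t))⁻¹ • γ t, hc⟩, ?_, ?_⟩, fun t => ?_⟩
  · simp [tT]
  · simp [tS]
  · have hpos := (hγ t).2.1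
    have hnn : ∀ i, 0 ≤ ((IET.tot (γ t))⁻¹ • γ t) i := fun i =>
      mul_nonneg (inv_nonneg.2 hpos.le) ((hγ t).1 i)
    have ht : IET.tot ((IET.tot (γ t))⁻¹ • γ t) = 1 := by
      rw [IET.tot_smul, inv_mul_cancel₀ hpos.ne']
    refine ⟨hnn, ht, ?_⟩
    have := IET.UEM_of_UEF hτ hβ hnn ht ((hγ t).2.2.smul (inv_pos.2 hpos))
    rw [← IET.ietMap_eq π hnn] at this
    exact this
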